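/- For each n ≥ 1 let p_n be a probability measure on the symmetric group S_n that is invariant under conjugation, and assume that for every ε > 0, p_n({σ : #(σ)/n > ε}) → 0 as n → ∞. For σ ∈ S_n define the rescaled rotated profile φ_{n,σ}(i) := f_{λ(σ)}(i)/(2√n) for i ∈ ℤ. Then for every ε > 0, p_n({σ : sup_{i ∈ ℤ} |φ_{n,σ}(i) − Ω(i/(2√n))| < ε}) → 1 as n → ∞, where Ω(s) = (2/π)(s·arcsin(s) + √(1−s²)) for |s| < 1 and Ω(s) = |s| for |s| ≥ 1. -/

import Mathlib

noncomputable section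

/-- `s` is (the index set of) an increasing subsequence of `σ`. -/
def IncSeq {n : ℕ} (σ : Equiv.Perm (Fin n)) (s : Finset (Fin n)) : Prop :=
  ∀ i ∈ s, ∀ j ∈ s, i < j → σ i < σ j

/-- `s` is a union of `k` increasing subsequences of `σ`. -/
def IsUnionInc {n : ℕ} (σ : Equiv.Perm (Fin n)) (k : ℕ) (s : Finset (Fin n)) : Prop :=
  ∃ f : Fin k → Finset (Fin n), (∀ t, IncSeq σ (f t)) ∧ s = Finset.univ.biUnion f

/-- M_k(σ): maximal cardinality of a union of `k` increasing subsequences of `σ`. -/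
def Minc {n : ℕ} (σ : Equiv.Perm (Fin n)) (k : ℕ) : ℕ :=
  sSup {m | ∃ s : Finset (Fin n), IsUnionInc σ k s ∧ s.card = m}

/-- The Robinson–Schensted shape of `σ` (0-based: `shape σ k` is the row λ_{k+1}(σ)),
via Greene's theorem: λ_k(σ) = M_k(σ) − M_{k−1}(σ). -/
def shape {n : ℕ} (σ : Equiv.Perm (Fin n)) : ℕ → ℕ :=
  fun k => Minc σ (k + 1) - Minc σ k

/-- The profile of a partition `l` (0-based indexing: `l k` is the row λ_{k+1}):
`f_λ(i) = i + 2·|{k ≥ 1 : λ_k − k ≥ i}|`. -/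
def profile (l : ℕ → ℕ) (i : ℤ) : ℤ :=
  i + 2 * (Set.ncard {k : ℕ | i ≤ (l k : ℤ) - ((k : ℤ) + 1)} : ℤ)

/-- #(σ): number of cycles of `σ`, fixed points counted as cycles. -/
def numCycles {n : ℕ} (σ : Equiv.Perm (Fin n)) : ℕ :=
  σ.cycleType.card + (Finset.univ.filter fun x => σ x = x).card

/-- The probability of the event `P` under the probability mass function `p` on `S_n`. -/
def permProb {n : ℕ} (p : Equiv.Perm (Fin n) → ℝ) (P : Equiv.Perm (Fin n) → Prop) : ℝ :=
  ∑ σ, Set.indicator {σ' | P σ'} p σ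

/-- The Vershik–Kerov–Logan–Shepp limit shape. -/
def Omega (s : ℝ) : ℝ :=
  if |s| < 1 then (2 / Real.pi) * (s * Real.arcsin s + Real.sqrt (1 - s ^ 2)) else |s|

noncomputable section

namespace RS

/-- row insertion -/
def ins : List ℕ → ℕ → List ℕ × Option ℕ
  | [], x => ([x], none)
  | a :: R, x => if x < a then (x :: R, some a) else (a :: (ins R x).1, (ins R x).2)

/-- tableau insertion -/
def insT : List (List ℕ) → ℕ → List (List ℕ)
  | [], x => [[x]]
  | R :: T, x => match (ins R x).2 with
    | none => (ins R x).1 :: T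
    | some y => (ins R x).1 :: insT T y

/-- reading word -/
def rd : List (List ℕ) → List ℕ
  | [] => []
  | R :: T => rd T ++ R

/-- P tableau of reversed word -/
def PT : List ℕ → List (List ℕ)
  | [] => []
  | x :: w => insT (PT w) x

def gd (k : ℕ) (c : ℕ → ℕ) (w : List ℕ) : Prop :=
  w.Pairwise (fun a b => c a = c b → c a < k → a < b)

def cnt (k : ℕ) (c : ℕ → ℕ) (w : List ℕ) : ℕ := w.countP (fun a => c a < k)

def LEk (w w' : List ℕ) : Prop := ∀ k c, gd k c w → ∃ c', gd k c' w' ∧ cnt k c w ≤ cnt k c' w'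

inductive Kn : List ℕ → List ℕ → Prop
  | refl (w) : Kn w w
  | symm {w w'} : Kn w w' → Kn w' w
  | trans {w w' w''} : Kn w w' → Kn w' w'' → Kn w w''
  | k1 (u v : List ℕ) (x y z : ℕ) : x < y → y < z → Kn (u ++ y :: x :: z :: v) (u ++ y :: z :: x :: v)
  | k2 (u v : List ℕ) (x y z : ℕ) : x < y → y < z → Kn (u ++ x :: z :: y :: v) (u ++ z :: x :: y :: v)

lemma Kn.ctx {w w' : List ℕ} (h : Kn w w') (a b : List ℕ) : Kn (a ++ w ++ b) (a ++ w' ++ b) := by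
  induction h with
  | refl w => exact Kn.refl _
  | symm _ ih => exact Kn.symm ih
  | trans _ _ ih1 ih2 => exact Kn.trans ih1 ih2
  | k1 u v x y z h1 h2 => simpa using Kn.k1 (a ++ u) (v ++ b) x y z h1 h2
  | k2 u v x y z h1 h2 => simpa using Kn.k2 (a ++ u) (v ++ b) x y z h1 h2

lemma Kn.perm {w w' : List ℕ} (h : Kn w w') : w.Perm w' := by
  induction h with
  | refl w => exact List.Perm.refl _
  | symm _ ih => exact ih.symm
  | trans _ _ ih1 ih2 => exact ih1.trans ih2
  | k1 u v x y z h1 h2 => exact List.Perm.append_left _ (List.Perm.cons _ (List.Perm.swap _ _ _))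
  | k2 u v x y z h1 h2 => exact List.Perm.append_left _ (List.Perm.swap _ _ _)

lemma LE_easy (u v : List ℕ) (x z : ℕ) (h : x < z) : LEk (u ++ z :: x :: v) (u ++ x :: z :: v) := by
  intro k c hc
  refine ⟨c, ?_, ?_⟩
  · simp only [gd, List.pairwise_append, List.pairwise_cons, List.mem_cons] at hc ⊢
    grind
  · simp only [cnt, List.countP_append, List.countP_cons]; omega

lemma LE_same (u v : List ℕ) (x z : ℕ) (k : ℕ) (c : ℕ → ℕ) (h : c x = c z → ¬ c x < k)
    (hc : gd k c (u ++ x :: z :: v)) : gd k c (u ++ z :: x :: v) := by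
  simp only [gd, List.pairwise_append, List.pairwise_cons, List.mem_cons] at hc ⊢
  grind

lemma cnt_congr (k : ℕ) (c c' : ℕ → ℕ) (w : List ℕ) (h : ∀ a ∈ w, (c a < k ↔ c' a < k)) :
    cnt k c w = cnt k c' w := by
  unfold cnt
  apply List.countP_congr
  intro a ha
  simpa using h a ha

lemma cnt_perm (k : ℕ) (c : ℕ → ℕ) {w w' : List ℕ} (h : w.Perm w') : cnt k c w = cnt k c w' :=
  h.countP_eq _

lemma LE_k1 (u v : List ℕ) (x y z : ℕ) (h1 : x < y) (h2 : y < z)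
    (hn : (u ++ y :: x :: z :: v).Nodup) : LEk (u ++ y :: x :: z :: v) (u ++ y :: z :: x :: v) := by
  intro k c hc
  have hp : (u ++ y :: x :: z :: v).Perm (u ++ y :: z :: x :: v) :=
    List.Perm.append_left _ (List.Perm.cons _ (List.Perm.swap _ _ _))
  by_cases hxz : c x = c z → ¬ c x < k
  · refine ⟨c, ?_, (cnt_perm k c hp).le⟩
    have := LE_same (u ++ [y]) v x z k c hxz (by simpa using hc)
    simpa using this
  push Not at hxz
  obtain ⟨e, hk⟩ := hxz
  simp only [List.nodup_append, List.nodup_cons, List.mem_cons, not_or] at hn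
  obtain ⟨hu, ⟨⟨hyx, hyz, hyv⟩, ⟨hxz', hxv⟩, hzv, hv⟩, hd⟩ := hn
  have hud : ∀ a ∈ u, a ≠ x ∧ a ≠ y ∧ a ≠ z ∧ a ∉ v := by
    intro a ha
    refine ⟨hd a ha x (by simp), hd a ha y (by simp), hd a ha z (by simp), fun h => hd a ha a (by simp [h]) rfl⟩
  by_cases hs : c y < k
  · refine ⟨fun l => if l = z ∨ l ∈ v then (if c l = c y then c x else if c l = c x then c y else c l) else c l, ?_, ?_⟩
    · simp only [gd, List.pairwise_append, List.pairwise_cons, List.mem_cons] at hc ⊢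
      obtain ⟨hcu, ⟨hcy, hcx, hcz, hcv⟩, hcd⟩ := hc
      have hcv' : ∀ a ∈ v, ∀ b ∈ v, True := by simp
      refine ⟨?_, ⟨?_, ?_, ?_, ?_⟩, ?_⟩
      · refine hcu.imp_of_mem ?_
        intro a b ha hb; grind
      · grind
      · grind
      · grind
      · refine hcv.imp_of_mem ?_
        intro a b ha hb; grind
      · grind
    · rw [← cnt_perm k _ hp]
      apply le_of_eq
      apply cnt_congr
      intro a ha; grind
  · refine ⟨fun l => if l = x then c y else if l = y then c x else c l, ?_, ?_⟩
    · simp only [gd, List.pairwise_append, List.pairwise_cons, List.mem_cons] at hc ⊢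
      obtain ⟨hcu, ⟨hcy, hcx, hcz, hcv⟩, hcd⟩ := hc
      refine ⟨?_, ⟨?_, ?_, ?_, ?_⟩, ?_⟩
      · refine hcu.imp_of_mem ?_
        intro a b ha hb; grind
      · grind
      · grind
      · grind
      · refine hcv.imp_of_mem ?_
        intro a b ha hb; grind
      · grind
    · rw [← cnt_perm k _ hp]
      apply le_of_eq
      have e1 : cnt k c u = cnt k (fun l => if l = x then c y else if l = y then c x else c l) u :=
        cnt_congr _ _ _ _ (by grind)
      have e2 : cnt k c v = cnt k (fun l => if l = x then c y else if l = y then c x else c l) v :=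
        cnt_congr _ _ _ _ (by grind)
      simp only [cnt, List.countP_append, List.countP_cons] at e1 e2 ⊢
      rw [e1, e2]
      grind

lemma LE_k2 (u v : List ℕ) (x y z : ℕ) (h1 : x < y) (h2 : y < z)
    (hn : (u ++ x :: z :: y :: v).Nodup) : LEk (u ++ x :: z :: y :: v) (u ++ z :: x :: y :: v) := by
  intro k c hc
  have hp : (u ++ x :: z :: y :: v).Perm (u ++ z :: x :: y :: v) :=
    List.Perm.append_left _ (List.Perm.swap _ _ _)
  by_cases hxz : c x = c z → ¬ c x < k
  · refine ⟨c, ?_, (cnt_perm k c hp).le⟩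
    exact LE_same u (y :: v) x z k c hxz (by simpa using hc)
  push Not at hxz
  obtain ⟨e, hk⟩ := hxz
  simp only [List.nodup_append, List.nodup_cons, List.mem_cons, not_or] at hn
  obtain ⟨hu, ⟨⟨hxz', hxy, hxv⟩, ⟨hzy, hzv⟩, hyv, hv⟩, hd⟩ := hn
  have hud : ∀ a ∈ u, a ≠ x ∧ a ≠ y ∧ a ≠ z ∧ a ∉ v := by
    intro a ha
    refine ⟨hd a ha x (by simp), hd a ha y (by simp), hd a ha z (by simp), fun h => hd a ha a (by simp [h]) rfl⟩
  by_cases hs : c y < k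
  · refine ⟨fun l => if l = z ∨ l = y ∨ l ∈ v then (if c l = c y then c x else if c l = c x then c y else c l) else c l, ?_, ?_⟩
    · simp only [gd, List.pairwise_append, List.pairwise_cons, List.mem_cons] at hc ⊢
      obtain ⟨hcu, ⟨hcy, hcx, hcz, hcv⟩, hcd⟩ := hc
      refine ⟨?_, ⟨?_, ?_, ?_, ?_⟩, ?_⟩
      · refine hcu.imp_of_mem ?_
        intro a b ha hb; grind
      · grind
      · grind
      · grind
      · refine hcv.imp_of_mem ?_
        intro a b ha hb; grind
      · grind
    · rw [← cnt_perm k _ hp]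
      apply le_of_eq
      apply cnt_congr
      intro a ha; grind
  · refine ⟨fun l => if l = z then c y else if l = y then c x else c l, ?_, ?_⟩
    · simp only [gd, List.pairwise_append, List.pairwise_cons, List.mem_cons] at hc ⊢
      obtain ⟨hcu, ⟨hcy, hcx, hcz, hcv⟩, hcd⟩ := hc
      refine ⟨?_, ⟨?_, ?_, ?_, ?_⟩, ?_⟩
      · refine hcu.imp_of_mem ?_
        intro a b ha hb; grind
      · grind
      · grind
      · grind
      · refine hcv.imp_of_mem ?_
        intro a b ha hb; grind
      · grind
    · rw [← cnt_perm k _ hp]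
      apply le_of_eq
      have e1 : cnt k c u = cnt k (fun l => if l = z then c y else if l = y then c x else c l) u :=
        cnt_congr _ _ _ _ (by grind)
      have e2 : cnt k c v = cnt k (fun l => if l = z then c y else if l = y then c x else c l) v :=
        cnt_congr _ _ _ _ (by grind)
      simp only [cnt, List.countP_append, List.countP_cons] at e1 e2 ⊢
      rw [e1, e2]
      grind

lemma LEk.trans {a b c : List ℕ} (h : LEk a b) (h' : LEk b c) : LEk a c := by
  intro k f hf
  obtain ⟨f1, h1, h2⟩ := h k f hf
  obtain ⟨f2, h3, h4⟩ := h' k f1 h1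
  exact ⟨f2, h3, h2.trans h4⟩

lemma Kn.le {w w' : List ℕ} (h : Kn w w') : w.Nodup → LEk w w' ∧ LEk w' w := by
  induction h with
  | refl w => exact fun _ => ⟨fun k c h => ⟨c, h, le_rfl⟩, fun k c h => ⟨c, h, le_rfl⟩⟩
  | symm h ih => intro hn; exact (ih (h.perm.nodup_iff.2 hn)).symm
  | trans h h' ih1 ih2 =>
    intro hn
    have a := ih1 hn
    have b := ih2 (h.perm.nodup_iff.1 hn)
    exact ⟨a.1.trans b.1, b.2.trans a.2⟩
  | k1 u v x y z h1 h2 =>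
    intro hn
    exact ⟨LE_k1 u v x y z h1 h2 hn, by
      have := LE_easy (u ++ [y]) v x z (h1.trans h2)
      simpa using this⟩
  | k2 u v x y z h1 h2 =>
    intro hn
    exact ⟨LE_k2 u v x y z h1 h2 hn, LE_easy u (y :: v) x z (h1.trans h2)⟩

end RS
end

noncomputable section
namespace RS

lemma ins_spec (R : List ℕ) (x : ℕ) (hx : x ∉ R) :
    ((∀ a ∈ R, a < x) ∧ ins R x = (R ++ [x], none)) ∨
    ∃ A y B, R = A ++ y :: B ∧ (∀ a ∈ A, a < x) ∧ x < y ∧ ins R x = (A ++ x :: B, some y) := by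
  induction R with
  | nil => left; simp [ins]
  | cons a R ih =>
    simp only [List.mem_cons, not_or] at hx
    unfold ins
    split_ifs with h
    · right; exact ⟨[], a, R, by simp, by simp, h, by simp⟩
    · have h' : a < x := by omega
      rcases ih hx.2 with ⟨h1, h2⟩ | ⟨A, y, B, h1, h2, h3, h4⟩
      · left; simp [h2, h']; exact h1
      · right; exact ⟨a :: A, y, B, by simp [h1], by simp [h']; exact h2, h3, by simp [h4]⟩

lemma kn_row1 (B : List ℕ) : ∀ (x y : ℕ), x < y → (y :: B).Pairwise (· < ·) →
    Kn (y :: B ++ [x]) (y :: x :: B) := by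
  induction B with
  | nil => intro x y _ _; exact Kn.refl _
  | cons b B ih =>
    intro x y hxy hs
    simp only [List.pairwise_cons] at hs
    have hyb : y < b := hs.1 b (by simp)
    have h1 := (ih x b (hxy.trans hyb) (List.pairwise_cons.2 hs.2)).ctx [y] []
    have h2 := (Kn.k1 [] B x y b hxy hyb).symm
    simp at h1 h2
    exact h1.trans h2

lemma kn_row2 (A : List ℕ) (y : ℕ) : ∀ (h : ℕ) (B : List ℕ), (A ++ [h]).Pairwise (· < ·) → h < y →
    Kn (A ++ y :: h :: B) (y :: (A ++ h :: B)) := by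
  induction A with
  | nil => intro h B _ _; exact Kn.refl _
  | cons a A ih =>
    intro h B hs hy
    simp only [List.cons_append, List.pairwise_cons] at hs
    have h1 := (ih h B hs.2 hy).ctx [a] []
    simp at h1
    refine h1.trans ?_
    cases A with
    | nil =>
      have := Kn.k2 [] B a h y (hs.1 h (by simp)) hy
      simpa using this
    | cons a' A =>
      have h3 : a' < h := by
        have := hs.2
        simp only [List.cons_append, List.pairwise_cons] at this
        exact this.1 h (by simp)
      have := Kn.k2 [] (A ++ h :: B) a a' y (hs.1 a' (by simp)) (h3.trans hy)
      simpa using this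

def dom : List ℕ → List ℕ → Prop
  | _, [] => True
  | [], _ :: _ => False
  | a :: R, b :: S => a < b ∧ dom R S

def IsTab : List (List ℕ) → Prop
  | [] => True
  | R :: T => R ≠ [] ∧ R.Pairwise (· < ·) ∧ dom R (T.headD []) ∧ IsTab T

def sh (T : List (List ℕ)) (r : ℕ) : ℕ := (T.getD r []).length

lemma dom_nil (R) : dom R [] := by cases R <;> simp [dom]

lemma dom_append (R S U : List ℕ) (h : dom R S) : dom (R ++ U) S := by
  induction R generalizing S with
  | nil => cases S with
    | nil => exact dom_nil _
    | cons => simp [dom] at h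
  | cons a R ih => cases S with
    | nil => exact dom_nil _
    | cons b S => simp only [dom, List.cons_append] at h ⊢; exact ⟨h.1, ih _ h.2⟩

lemma dom_len (R S : List ℕ) (h : dom R S) : S.length ≤ R.length := by
  induction R generalizing S with
  | nil => cases S with
    | nil => simp
    | cons => simp [dom] at h
  | cons a R ih => cases S with
    | nil => simp
    | cons b S => simp only [dom] at h; simpa using ih _ h.2

lemma dom_repl (A B S : List ℕ) (x y : ℕ) (hxy : x < y) (h : dom (A ++ y :: B) S) :
    dom (A ++ x :: B) S := by
  induction A generalizing S with
  | nil => cases S with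
    | nil => exact dom_nil _
    | cons b S => simp only [dom, List.nil_append] at h ⊢; exact ⟨hxy.trans h.1, h.2⟩
  | cons a R ih => cases S with
    | nil => exact dom_nil _
    | cons b S => simp only [dom, List.cons_append] at h ⊢; exact ⟨h.1, ih _ h.2⟩

lemma dom_ins (A B S : List ℕ) (x y : ℕ) (hxy : x < y) (hA : ∀ a ∈ A, a < y)
    (h : dom (A ++ y :: B) S) : dom (A ++ x :: B) (ins S y).1 := by
  induction A generalizing S with
  | nil => cases S with
    | nil => simp [ins, dom, hxy, dom_nil]
    | cons b S =>
      simp only [dom, List.nil_append] at h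
      simp [ins, h.1, dom, hxy, h.2]
  | cons a R ih => cases S with
    | nil => simp [ins, dom, dom_nil, hA]
    | cons b S =>
      simp only [dom, List.cons_append] at h
      unfold ins
      split_ifs with hb
      · simp only [dom, List.cons_append]; exact ⟨hA a (by simp), dom_repl _ _ _ _ _ hxy h.2⟩
      · simp only [dom, List.cons_append]
        exact ⟨h.1, ih _ (fun a ha => hA a (by simp [ha])) h.2⟩

lemma head_insT (T : List (List ℕ)) (x : ℕ) : (insT T x).headD [] = (ins (T.headD []) x).1 := by
  cases T with
  | nil => simp [insT, ins]
  | cons R T =>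
    unfold insT
    split <;> simp

lemma sorted_repl (A B : List ℕ) (x y : ℕ) (hxy : x < y) (hA : ∀ a ∈ A, a < x)
    (h : (A ++ y :: B).Pairwise (· < ·)) : (A ++ x :: B).Pairwise (· < ·) := by
  simp only [List.pairwise_append, List.pairwise_cons, List.mem_cons] at h ⊢
  grind

lemma kn_insT (T : List (List ℕ)) : ∀ x, IsTab T → (x :: rd T).Nodup →
    Kn (rd T ++ [x]) (rd (insT T x)) ∧ IsTab (insT T x) := by
  induction T with
  | nil => intro x _ _; exact ⟨Kn.refl _, by simp [insT, IsTab, dom]⟩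
  | cons R T ih =>
    intro x hT hn
    obtain ⟨h0, h1, h2, h3⟩ := hT
    simp only [rd, List.nodup_cons, List.mem_append, not_or, List.nodup_append] at hn
    rcases ins_spec R x hn.1.2 with ⟨hl, he⟩ | ⟨A, y, B, hR, hA, hxy, he⟩
    · simp only [insT, he, rd]
      refine ⟨by simpa using Kn.refl _, by simp, ?_, dom_append _ _ _ h2, h3⟩
      simp only [List.pairwise_append, List.mem_singleton]
      exact ⟨h1, by simp, fun a ha b hb => hb ▸ hl a ha⟩
    · subst hR
      have hyT : (y :: rd T).Nodup := by
        simp only [List.nodup_cons]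
        refine ⟨fun hy => hn.2.2.2 y hy y (by simp) rfl, hn.2.1⟩
      obtain ⟨i1, i2⟩ := ih y h3 hyT
      simp only [insT, he, rd]
      have hA' : ∀ a ∈ A, a < y := fun a ha => (hA a ha).trans hxy
      refine ⟨?_, by simp, sorted_repl A B x y hxy hA h1, ?_, i2⟩
      · have a1 := (kn_row1 B x y hxy (List.pairwise_append.1 h1).2.1).ctx (rd T ++ A) []
        have a2 : (A ++ [x]).Pairwise (· < ·) := by
          have := sorted_repl A B x y hxy hA h1
          refine this.sublist ?_
          simp
        have a3 := (kn_row2 A y x B a2 hxy).ctx (rd T) []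
        have a4 := i1.ctx [] (A ++ x :: B)
        simp at a1 a3 a4 ⊢
        exact a1.trans (a3.trans a4)
      · rw [head_insT]
        exact dom_ins _ _ _ _ _ hxy hA' h2

lemma PT_spec (w : List ℕ) : w.Nodup → Kn w.reverse (rd (PT w)) ∧ IsTab (PT w) := by
  induction w with
  | nil => intro _; exact ⟨Kn.refl _, trivial⟩
  | cons x w ih =>
    intro hn
    have hn' := hn
    simp only [List.nodup_cons] at hn
    obtain ⟨i1, i2⟩ := ih hn.2
    have hp := i1.perm
    have : (x :: rd (PT w)).Nodup := by
      have : (x :: w).Perm (x :: rd (PT w)) := List.Perm.cons _ ((List.reverse_perm w).symm.trans hp)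
      exact this.nodup_iff.1 hn'
    obtain ⟨j1, j2⟩ := kn_insT (PT w) x i2 this
    refine ⟨?_, j2⟩
    have := i1.ctx [] [x]
    simp at this
    simp only [List.reverse_cons, PT]
    exact this.trans j1

lemma sh_insT (T : List (List ℕ)) : ∀ x, IsTab T → (x :: rd T).Nodup →
    ∃ r, sh (insT T x) = sh T + Pi.single r 1 := by
  induction T with
  | nil => intro x _ _; refine ⟨0, ?_⟩; ext r; cases r <;> simp [sh, insT]
  | cons R T ih =>
    intro x hT hn
    obtain ⟨h0, h1, h2, h3⟩ := hT
    simp only [rd, List.nodup_cons, List.mem_append, not_or, List.nodup_append] at hn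
    rcases ins_spec R x hn.1.2 with ⟨hl, he⟩ | ⟨A, y, B, hR, hA, hxy, he⟩
    · refine ⟨0, ?_⟩
      ext r; cases r <;> simp [sh, insT, he]
    · subst hR
      have hyT : (y :: rd T).Nodup := by
        simp only [List.nodup_cons]
        refine ⟨fun hy => hn.2.2.2 y hy y (by simp) rfl, hn.2.1⟩
      obtain ⟨r, hr⟩ := ih y h3 hyT
      refine ⟨r + 1, ?_⟩
      ext q
      cases q with
      | zero => simp [sh, insT, he]
      | succ q =>
        have := congrFun hr q
        simp only [sh, insT, he, List.getD_cons_succ, Pi.add_apply] at this ⊢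
        rw [this]
        simp [Pi.single_apply]

lemma sh_anti (T : List (List ℕ)) (hT : IsTab T) : Antitone (sh T) := by
  apply antitone_nat_of_succ_le
  induction T with
  | nil => intro n; simp [sh]
  | cons R T ih =>
    obtain ⟨h0, h1, h2, h3⟩ := hT
    intro n
    cases n with
    | zero =>
      have := dom_len _ _ h2
      cases T with
      | nil => simp [sh]
      | cons S T => simpa [sh] using this
    | succ n => exact ih h3 n

lemma sh_cons (R T) : sh (R :: T) 0 = R.length ∧ ∀ r, sh (R :: T) (r + 1) = sh T r := by
  simp [sh]

lemma insT_inj (T : List (List ℕ)) : ∀ T' x x', IsTab T → IsTab T' → (x :: rd T).Nodup →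
    (x' :: rd T').Nodup → sh T = sh T' → insT T x = insT T' x' → T = T' ∧ x = x' := by
  induction T with
  | nil =>
    intro T' x x' _ hT' _ _ hs he
    cases T' with
    | nil => simpa [insT] using he
    | cons R' T' =>
      have := congrFun hs 0
      simp [sh] at this
      exact absurd (List.length_eq_zero_iff.1 this.symm) hT'.1
  | cons R T ih =>
    intro T' x x' hT hT' hn hn' hs he
    cases T' with
    | nil =>
      have := congrFun hs 0
      simp [sh] at this
      exact absurd this hT.1
    | cons R' T' =>
      obtain ⟨h0, h1, h2, h3⟩ := hT
      obtain ⟨h0', h1', h2', h3'⟩ := hT'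
      have hlen : R.length = R'.length := by simpa [sh] using congrFun hs 0
      have hs' : sh T = sh T' := by
        ext r; simpa [sh] using congrFun hs (r + 1)
      simp only [rd, List.nodup_cons, List.mem_append, not_or, List.nodup_append] at hn hn'
      rcases ins_spec R x hn.1.2 with ⟨hl, hi⟩ | ⟨A, y, B, hR, hA, hxy, hi⟩ <;>
      rcases ins_spec R' x' hn'.1.2 with ⟨hl', hi'⟩ | ⟨A', y', B', hR', hA', hxy', hi'⟩
      · simp only [insT, hi, hi', List.cons.injEq] at he
        have := List.append_inj he.1 hlen
        simp at this
        exact ⟨by rw [this.1, he.2], this.2⟩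
      · simp only [insT, hi, hi', List.cons.injEq] at he
        have := congrArg List.length he.1
        subst hR'
        simp at this hlen
        omega
      · simp only [insT, hi, hi', List.cons.injEq] at he
        have := congrArg List.length he.1
        subst hR
        simp at this hlen
        omega
      · simp only [insT, hi, hi', List.cons.injEq] at he
        subst hR hR'
        have hyT : (y :: rd T).Nodup := by
          simp only [List.nodup_cons]
          refine ⟨fun hy => hn.2.2.2 y hy y (by simp) rfl, hn.2.1⟩
        have hyT' : (y' :: rd T').Nodup := by
          simp only [List.nodup_cons]
          refine ⟨fun hy => hn'.2.2.2 y' hy y' (by simp) rfl, hn'.2.1⟩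
        obtain ⟨e1, e2⟩ := ih T' y y' h3 h3' hyT hyT' hs' he.2
        subst e1 e2
        have key : ∀ (A B : List ℕ) (x : ℕ), x < y → (∀ a ∈ A, a < x) →
            (A ++ y :: B).Pairwise (· < ·) → (A ++ x :: B).filter (· < y) = A ++ [x] := by
          intro A B x hxy hA hp
          simp only [List.pairwise_append, List.pairwise_cons, List.mem_cons] at hp
          rw [List.filter_append, List.filter_cons]
          rw [List.filter_eq_self.2 (by intro a ha; simpa using (hA a ha).trans hxy)]
          rw [List.filter_eq_nil_iff.2 (by intro a ha; simpa using (hp.2.1.1 a ha).le)]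
          simp [hxy]
        have k1 := key A B x hxy hA h1
        have k2 := key A' B' x' hxy' hA' h1'
        rw [he.1, k2] at k1
        have k3 := List.append_inj' k1 rfl
        simp at k3
        obtain ⟨k4, k5⟩ := k3
        subst k4 k5
        have := he.1
        simp at this
        exact ⟨by rw [this], rfl⟩

end RS
end

noncomputable section
namespace RS

def WT : List (List ℕ) → Prop
  | [] => True
  | R :: T => dom R (T.headD []) ∧ WT T

lemma IsTab.wt : ∀ {T : List (List ℕ)}, IsTab T → WT T
  | [], _ => trivial
  | _ :: _, h => ⟨h.2.2.1, IsTab.wt h.2.2.2⟩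

def FC : List (List ℕ) → List ℕ
  | [] => []
  | [] :: T => FC T
  | (a :: _) :: T => a :: FC T

lemma WT.empty : ∀ {T : List (List ℕ)}, WT T → T.headD [] = [] → ∀ R ∈ T, R = []
  | [], _, _ => by simp
  | R :: T, h, h0 => by
    simp only [List.headD_cons] at h0
    subst h0
    have : T.headD [] = [] := by
      have := h.1
      generalize T.headD [] = S at this
      cases S with
      | nil => rfl
      | cons => simp [dom] at this
    have := WT.empty h.2 this
    simpa using this

lemma rd_empty : ∀ {T : List (List ℕ)}, (∀ R ∈ T, R = []) → rd T = []
  | [], _ => rfl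
  | R :: T, h => by
    simp only [List.mem_cons, forall_eq_or_imp] at h
    simp [rd, h.1, rd_empty h.2]

lemma FC_empty : ∀ {T : List (List ℕ)}, (∀ R ∈ T, R = []) → FC T = []
  | [], _ => rfl
  | R :: T, h => by
    simp only [List.mem_cons, forall_eq_or_imp] at h
    rw [h.1]; simp [FC, FC_empty h.2]

lemma cnt_FC (k : ℕ) (c : ℕ → ℕ) : ∀ T : List (List ℕ),
    cnt k c (rd T) = cnt k c (FC T) + cnt k c (rd (T.map List.tail))
  | [] => by simp [rd, FC, cnt]
  | [] :: T => by
    have := cnt_FC k c T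
    simpa [rd, FC] using this
  | (a :: R) :: T => by
    have := cnt_FC k c T
    simp only [cnt, rd, FC, List.map_cons, List.tail_cons, List.countP_append, List.countP_cons] at this ⊢
    omega

lemma rd_tail_sub : ∀ T : List (List ℕ), (rd (T.map List.tail)).Sublist (rd T)
  | [] => by simp [rd]
  | R :: T => by
    simp only [rd, List.map_cons]
    exact (rd_tail_sub T).append (List.tail_sublist R)

lemma FC_sub : ∀ T : List (List ℕ), (FC T).reverse.Sublist (rd T)
  | [] => by simp [rd, FC]
  | [] :: T => by simpa [rd, FC] using FC_sub T
  | (a :: R) :: T => by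
    simp only [rd, FC, List.reverse_cons]
    refine (FC_sub T).append ?_
    simp

lemma WT.tail : ∀ {T : List (List ℕ)}, WT T → WT (T.map List.tail)
  | [], _ => trivial
  | R :: T, h => by
    refine ⟨?_, WT.tail h.2⟩
    have h1 := h.1
    cases T with
    | nil => exact dom_nil _
    | cons S T =>
      simp only [List.headD_cons, List.map_cons] at h1 ⊢
      cases R with
      | nil => cases S with
        | nil => exact dom_nil _
        | cons => simp [dom] at h1
      | cons a R => cases S with
        | nil => exact dom_nil _
        | cons => simp only [dom] at h1; exact h1.2

lemma FC_sorted : ∀ {T : List (List ℕ)}, WT T → (FC T).Pairwise (· < ·) ∧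
    (FC T).head? = (T.headD []).head?
  | [], _ => by simp [FC]
  | [] :: T, h => by
    have := WT.empty h rfl
    have h2 := FC_empty this
    rw [h2]; simp
  | (a :: R) :: T, h => by
    obtain ⟨h1, h2⟩ := FC_sorted h.2
    refine ⟨?_, by simp [FC]⟩
    simp only [FC]
    have h3 := h.1
    generalize T.headD [] = S at h2 h3
    generalize hF : FC T = F at h1 h2
    cases F with
    | nil => simp
    | cons f F =>
      cases S with
      | nil => simp at h2
      | cons s S =>
        simp at h2; subst h2
        simp only [dom] at h3
        simp only [List.pairwise_cons, List.mem_cons] at h1 ⊢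
        grind

lemma cnt_FC_le (k : ℕ) (c : ℕ → ℕ) (T : List (List ℕ)) (hT : WT T) (hg : gd k c (rd T)) :
    cnt k c (FC T) ≤ min k (FC T).length := by
  refine le_min ?_ List.countP_le_length
  have h1 : gd k c (FC T).reverse := List.Pairwise.sublist (FC_sub T) hg
  have h2 := (FC_sorted hT).1
  unfold gd at h1
  rw [List.pairwise_reverse] at h1
  have h3 : (FC T).Pairwise (fun a b => c a < k → c b < k → c a ≠ c b) := by
    have := h1.and h2
    refine this.imp ?_
    intro a b h _ _ _
    grind
  rw [cnt, List.countP_eq_length_filter]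
  set L := (FC T).filter (fun a => decide (c a < k)) with hL
  have h4 : (L.map c).Nodup := by
    rw [List.Nodup, List.pairwise_map]
    have h5 : L.Pairwise (fun a b => c a < k → c b < k → c a ≠ c b) := h3.filter _
    refine h5.imp_of_mem ?_
    intro a b ha hb h
    simp [hL] at ha hb
    exact h ha.2 hb.2
  have h6 : (L.map c).toFinset ⊆ Finset.range k := by
    intro t ht
    simp [hL] at ht
    obtain ⟨a, ha, rfl⟩ := ht
    simpa using ha.2
  have h7 := Finset.card_le_card h6
  rw [List.toFinset_card_of_nodup h4] at h7
  simpa using h7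

lemma FC_len : ∀ (T : List (List ℕ)) (k : ℕ), WT T → min k (FC T).length ≤ 
    ∑ r ∈ Finset.range k, if 0 < sh T r then 1 else 0
  | [], k, _ => by simp [FC]
  | _, 0, _ => by simp
  | [] :: T, k + 1, h => by
    have := WT.empty h rfl
    have h2 := FC_empty this
    rw [h2]; simp
  | (a :: R) :: T, k + 1, h => by
    have := FC_len T k h.2
    rw [Finset.sum_range_succ']
    simp only [(sh_cons _ _).1, (sh_cons _ _).2, FC, List.length_cons]
    simp
    simp at this
    omega

lemma sh_tail (T : List (List ℕ)) (r : ℕ) : sh (T.map List.tail) r = sh T r - 1 := by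
  simp only [sh, List.getD_eq_getElem?_getD, List.getElem?_map]
  cases T[r]? <;> simp

lemma greene_upper (k : ℕ) (c : ℕ → ℕ) : ∀ (m : ℕ) (T : List (List ℕ)), sh T 0 ≤ m → WT T →
    gd k c (rd T) → cnt k c (rd T) ≤ ∑ r ∈ Finset.range k, sh T r := by
  intro m
  induction m with
  | zero =>
    intro T h0 hT hg
    have : T.headD [] = [] := by
      cases T with
      | nil => rfl
      | cons R T => simpa [sh] using h0
    rw [rd_empty (WT.empty hT this)]
    simp [cnt]
  | succ m ih =>
    intro T h0 hT hg
    have h1 := ih (T.map List.tail) (by rw [sh_tail]; omega) hT.tail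
      (List.Pairwise.sublist (rd_tail_sub T) hg)
    have h2 := cnt_FC_le k c T hT hg
    have h3 := FC_len T k hT
    rw [cnt_FC]
    have h4 : ∑ r ∈ Finset.range k, sh T r = (∑ r ∈ Finset.range k, if 0 < sh T r then 1 else 0) +
        ∑ r ∈ Finset.range k, sh (T.map List.tail) r := by
      rw [← Finset.sum_add_distrib]
      apply Finset.sum_congr rfl
      intro r _
      rw [sh_tail]
      split_ifs <;> omega
    omega

def rowOf : List (List ℕ) → ℕ → ℕ
  | [], _ => 0
  | R :: T, a => if a ∈ R then 0 else rowOf T a + 1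

lemma rowOf_gd : ∀ (T : List (List ℕ)), IsTab T → (rd T).Nodup →
    (rd T).Pairwise (fun a b => rowOf T a = rowOf T b → a < b)
  | [], _, _ => by simp [rd]
  | R :: T, h, hn => by
    simp only [rd, List.nodup_append] at hn
    have ih := rowOf_gd T h.2.2.2 hn.1
    simp only [rd, List.pairwise_append]
    refine ⟨?_, ?_, ?_⟩
    · refine ih.imp_of_mem ?_
      intro a b ha hb
      have h1 : a ∉ R := fun h => hn.2.2 a ha a h rfl
      have h2 : b ∉ R := fun h => hn.2.2 b hb b h rfl
      simp [rowOf, h1, h2]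
    · refine h.2.1.imp ?_
      intro a b hab _
      exact hab
    · intro a ha b hb
      have h1 : a ∉ R := fun h => hn.2.2 a ha a h rfl
      simp [rowOf, h1, hb]

lemma rowOf_cnt : ∀ (T : List (List ℕ)) (k : ℕ), (rd T).Nodup →
    cnt k (rowOf T) (rd T) = ∑ r ∈ Finset.range k, sh T r
  | [], k, _ => by simp [rd, cnt, sh]
  | R :: T, 0, _ => by simp [cnt]
  | R :: T, k + 1, hn => by
    simp only [rd, List.nodup_append] at hn
    have ih := rowOf_cnt T k hn.1
    rw [Finset.sum_range_succ']
    simp only [(sh_cons _ _).1, (sh_cons _ _).2, rd, cnt, List.countP_append]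
    rw [← ih]
    congr 1
    · apply List.countP_congr
      intro a ha
      have h1 : a ∉ R := fun h => hn.2.2 a ha a h rfl
      simp [rowOf, h1]
    · rw [List.countP_eq_length]
      intro a ha
      simp [rowOf, ha]

/-- Greene's theorem for words. -/
lemma greene (w : List ℕ) (hn : w.Nodup) (k : ℕ) :
    (∀ c, gd k c w.reverse → cnt k c w.reverse ≤ ∑ r ∈ Finset.range k, sh (PT w) r) ∧
    ∃ c, gd k c w.reverse ∧ cnt k c w.reverse = ∑ r ∈ Finset.range k, sh (PT w) r := by
  obtain ⟨h1, h2⟩ := PT_spec w hn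
  have hn' : w.reverse.Nodup := by simpa using hn
  obtain ⟨l1, l2⟩ := h1.le hn'
  have up : ∀ c, gd k c w.reverse → cnt k c w.reverse ≤ ∑ r ∈ Finset.range k, sh (PT w) r := by
    intro c hc
    obtain ⟨c', h3, h4⟩ := l1 k c hc
    exact h4.trans (greene_upper k c' _ _ le_rfl h2.wt h3)
  refine ⟨up, ?_⟩
  have hr : (rd (PT w)).Nodup := h1.perm.nodup_iff.1 hn'
  obtain ⟨c, h3, h4⟩ := l2 k (rowOf (PT w)) ((rowOf_gd _ h2 hr).imp (fun h e _ => h e))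
  refine ⟨c, h3, le_antisymm (up c h3) ?_⟩
  rwa [rowOf_cnt _ _ hr] at h4

end RS
end

noncomputable section
namespace RS

/-- reversed word of a permutation -/
def wd {n : ℕ} (σ : Equiv.Perm (Fin n)) : List ℕ := (List.ofFn (fun i => (σ i : ℕ))).reverse

lemma wd_nodup {n : ℕ} (σ : Equiv.Perm (Fin n)) : (wd σ).Nodup := by
  rw [wd, List.nodup_reverse, List.nodup_ofFn]
  intro i j h
  exact σ.injective (Fin.ext h)

lemma wd_perm {n : ℕ} (σ : Equiv.Perm (Fin n)) : (wd σ).Perm (List.range n) := by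
  rw [List.perm_ext_iff_of_nodup (wd_nodup σ) List.nodup_range]
  intro a
  simp only [wd, List.mem_reverse, List.mem_ofFn, List.mem_range]
  constructor
  · rintro ⟨i, rfl⟩; exact (σ i).2
  · intro h; exact ⟨σ.symm ⟨a, h⟩, by simp⟩

lemma wd_inj {n : ℕ} : Function.Injective (wd (n := n)) := by
  intro σ τ h
  simp only [wd, List.reverse_inj] at h
  have := List.ofFn_injective h
  ext i
  exact congrFun this i

lemma cnt_wd {n : ℕ} (σ : Equiv.Perm (Fin n)) (k : ℕ) (c : ℕ → ℕ) :
    cnt k c (wd σ).reverse = (Finset.univ.filter (fun i => c (σ i) < k)).card := by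
  rw [wd, List.reverse_reverse, cnt, List.ofFn_eq_map, List.countP_map, List.countP_eq_length_filter]
  rw [← List.toFinset_card_of_nodup ((List.nodup_finRange n).filter _)]
  congr 1
  ext i; simp

lemma gd_wd {n : ℕ} (σ : Equiv.Perm (Fin n)) (k : ℕ) (c : ℕ → ℕ) :
    gd k c (wd σ).reverse ↔ ∀ i j, i < j → c (σ i) = c (σ j) → c (σ i) < k → σ i < σ j := by
  rw [wd, List.reverse_reverse, gd, List.pairwise_ofFn]
  rfl

lemma Minc_eq {n : ℕ} (σ : Equiv.Perm (Fin n)) (k : ℕ) :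
    Minc σ k = ∑ r ∈ Finset.range k, sh (PT (wd σ)) r := by
  obtain ⟨h1, c, h2, h3⟩ := greene (wd σ) (wd_nodup σ) k
  unfold Minc
  have hle : ∀ m ∈ {m | ∃ s : Finset (Fin n), IsUnionInc σ k s ∧ s.card = m},
      m ≤ ∑ r ∈ Finset.range k, sh (PT (wd σ)) r := by
    rintro m ⟨s, ⟨f, hf, rfl⟩, rfl⟩
    classical
    let c : ℕ → ℕ := fun a => if h : ∃ t : ℕ, ∃ ht : t < k, ∃ i ∈ f ⟨t, ht⟩, (σ i : ℕ) = a then Nat.find h else k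
    have hc1 : ∀ i, c (σ i) < k → ∃ ht : c (σ i) < k, i ∈ f ⟨c (σ i), ht⟩ := by
      intro i hi
      by_cases h : ∃ t : ℕ, ∃ ht : t < k, ∃ j ∈ f ⟨t, ht⟩, (σ j : ℕ) = (σ i : ℕ)
      · have e : c (σ i) = Nat.find h := by simp only [c]; rw [dif_pos h]
        obtain ⟨ht, j, hj, hji⟩ := Nat.find_spec h
        have : j = i := σ.injective (Fin.ext hji)
        subst this
        refine ⟨hi, ?_⟩
        simp only [e]; exact hj
      · have e : c (σ i) = k := by simp only [c]; rw [dif_neg h]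
        omega
    have hg : gd k c (wd σ).reverse := by
      rw [gd_wd]
      intro i j hij e hk
      obtain ⟨ha, hb⟩ := hc1 i hk
      obtain ⟨ha', hb'⟩ := hc1 j (e ▸ hk)
      simp only [← e] at hb'
      exact hf _ i hb j hb' hij
    refine le_trans ?_ (h1 c hg)
    rw [cnt_wd]
    apply Finset.card_le_card
    intro i hi
    simp only [Finset.mem_biUnion, Finset.mem_univ, true_and] at hi
    obtain ⟨t, ht⟩ := hi
    simp only [Finset.mem_filter, Finset.mem_univ, true_and]
    have h : ∃ t : ℕ, ∃ ht : t < k, ∃ j ∈ f ⟨t, ht⟩, (σ j : ℕ) = (σ i : ℕ) := ⟨t, t.2, i, ht, rfl⟩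
    have e : c (σ i) = Nat.find h := by simp only [c]; rw [dif_pos h]
    rw [e]
    exact (Nat.find_spec h).1
  have hmem : (∑ r ∈ Finset.range k, sh (PT (wd σ)) r) ∈
      {m | ∃ s : Finset (Fin n), IsUnionInc σ k s ∧ s.card = m} := by
    refine ⟨Finset.univ.filter (fun i => c (σ i) < k), ?_, ?_⟩
    · refine ⟨fun t => Finset.univ.filter (fun i => c (σ i) = t), ?_, ?_⟩
      · intro t i hi j hj hij
        simp at hi hj
        rw [gd_wd] at h2
        exact h2 i j hij (hi.trans hj.symm) (hi ▸ t.2)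
      · ext i
        simp only [Finset.mem_filter, Finset.mem_univ, true_and, Finset.mem_biUnion]
        exact ⟨fun h => ⟨⟨_, h⟩, rfl⟩, fun ⟨t, ht⟩ => ht ▸ t.2⟩
    · rw [← cnt_wd, h3]
  exact le_antisymm (csSup_le ⟨_, hmem⟩ hle) (le_csSup ⟨_, hle⟩ hmem)

lemma shape_eq {n : ℕ} (σ : Equiv.Perm (Fin n)) : shape σ = sh (PT (wd σ)) := by
  ext k
  rw [shape, Minc_eq, Minc_eq, Finset.sum_range_succ]
  omega

lemma shape_anti {n : ℕ} (σ : Equiv.Perm (Fin n)) : Antitone (shape σ) := by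
  rw [shape_eq]
  exact sh_anti _ (PT_spec _ (wd_nodup σ)).2

lemma Minc_sum {n : ℕ} (σ : Equiv.Perm (Fin n)) (k : ℕ) :
    Minc σ k = ∑ r ∈ Finset.range k, shape σ r := by
  rw [shape_eq, Minc_eq]

end RS
end

noncomputable section
namespace RS
open Finset

def rem (l : ℕ → ℕ) (s : ℕ) : Prop := l (s + 1) < l s
def addb (l : ℕ → ℕ) (r : ℕ) : Prop := r = 0 ∨ l r < l (r - 1)

structure IsP (N n : ℕ) (l : ℕ → ℕ) : Prop where
  anti : Antitone l
  zero : ∀ r, n ≤ r → l r = 0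
  sum : ∑ r ∈ range N, l r = n

open Classical in
def Pn (N n : ℕ) : Finset (ℕ → ℕ) :=
  ((univ : Finset (Fin n → Fin (n + 1))).image
    (fun g => fun r => if h : r < n then (g ⟨r, h⟩ : ℕ) else 0)).filter (IsP N n)

lemma IsP.le {N n : ℕ} {l : ℕ → ℕ} (h : IsP N n l) (hn : n ≤ N) (r : ℕ) : l r ≤ n := by
  by_cases hr : r < N
  · rw [← h.sum]; exact single_le_sum (f := l) (fun _ _ => Nat.zero_le _) (mem_range.2 hr)
  · rw [h.zero r (by omega)]; omega

lemma mem_Pn {N n : ℕ} (hn : n ≤ N) {l : ℕ → ℕ} : l ∈ Pn N n ↔ IsP N n l := by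
  simp only [Pn, mem_filter, mem_image, mem_univ, true_and, and_iff_right_iff_imp]
  intro h
  refine ⟨fun i => ⟨l i, by have := h.le hn i; omega⟩, ?_⟩
  ext r
  by_cases hr : r < n
  · simp [hr]
  · simp [hr, h.zero r (by omega)]

lemma IsP.addb_le {N n r : ℕ} {l : ℕ → ℕ} (h : IsP N n l) (hr : addb l r) : r ≤ n := by
  by_contra hc
  rcases hr with hr | hr
  · omega
  · rw [h.zero (r - 1) (by omega)] at hr; omega

lemma IsP.rem_lt {N n r : ℕ} {l : ℕ → ℕ} (h : IsP N n l) (hr : rem l r) : r < n := by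
  by_contra hc
  unfold rem at hr
  rw [h.zero r (by omega)] at hr; omega

lemma IsP.add {N n r : ℕ} {l : ℕ → ℕ} (h : IsP N n l) (hn : n < N) (hr : addb l r) :
    IsP N (n + 1) (l + Pi.single r 1) := by
  have hrn := h.addb_le hr
  refine ⟨?_, ?_, ?_⟩
  · apply antitone_nat_of_succ_le
    intro m
    have h1 := h.anti (Nat.le_succ m)
    simp only [Pi.add_apply, Pi.single_apply]
    rcases hr with hr | hr
    · split_ifs <;> simp_all; omega
    · split_ifs with ha hb hb
      · omega
      · subst ha; simp at hr; omega
      · simp at h1; omega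
      · simpa using h1
  · intro q hq
    simp only [Pi.add_apply, Pi.single_apply]
    rw [if_neg (by omega), h.zero q (by omega), add_zero]
  · simp only [Pi.add_apply, sum_add_distrib, h.sum]
    rw [Finset.sum_pi_single']
    simp; omega

lemma sub_add_single {l : ℕ → ℕ} {s : ℕ} (h : 0 < l s) :
    l - Pi.single s 1 + Pi.single s 1 = l := by
  ext m
  simp only [Pi.add_apply, Pi.sub_apply, Pi.single_apply]
  split_ifs with h1
  · subst h1; omega
  · omega

lemma add_sub_single (l : ℕ → ℕ) (s : ℕ) :
    l + Pi.single s 1 - Pi.single s 1 = l := by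
  ext m
  simp only [Pi.add_apply, Pi.sub_apply]; omega

lemma IsP.sub {N n s : ℕ} {l : ℕ → ℕ} (h : IsP N (n + 1) l) (hn : n < N) (hs : rem l s) :
    IsP N n (l - Pi.single s 1) := by
  have hsn := h.rem_lt hs
  have hpos : 0 < l s := by unfold rem at hs; omega
  have hanti : Antitone (l - Pi.single s 1) := by
    apply antitone_nat_of_succ_le
    intro m
    have h1 := h.anti (Nat.le_succ m)
    unfold rem at hs
    simp only [Pi.sub_apply, Pi.single_apply]
    split_ifs with ha hb hb
    · omega
    · simp at h1; omega
    · subst hb; omega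
    · simpa using h1
  have hsum : ∑ r ∈ range N, (l - Pi.single s 1 : ℕ → ℕ) r = n := by
    have h1 := h.sum
    rw [← sub_add_single hpos] at h1
    simp only [Pi.add_apply, sum_add_distrib] at h1
    rw [Finset.sum_pi_single'] at h1
    simp only [mem_range] at h1
    rw [if_pos (by omega)] at h1
    omega
  refine ⟨hanti, ?_, hsum⟩
  intro q hq
  by_contra hc
  have hq' : q < N := by
    by_contra hc'
    apply hc
    simp only [Pi.sub_apply]
    rw [h.zero q (by omega)]; simp
  have h2 : ∑ r ∈ range (q + 1), 1 ≤ ∑ r ∈ range (q + 1), (l - Pi.single s 1 : ℕ → ℕ) r := by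
    apply sum_le_sum
    intro r hr
    have := hanti (show r ≤ q by simp at hr; omega)
    omega
  have h3 : ∑ r ∈ range (q + 1), (l - Pi.single s 1 : ℕ → ℕ) r ≤ n := by
    rw [← hsum]
    apply sum_le_sum_of_subset
    intro r; simp; omega
  have h4 := h2.trans h3
  rw [sum_const, card_range, smul_eq_mul, mul_one] at h4
  omega

open Classical in
def f (N : ℕ) : ℕ → (ℕ → ℕ) → ℕ
  | 0, l => if l = 0 then 1 else 0
  | n + 1, l => ∑ s ∈ range N, if rem l s then f N n (l - Pi.single s 1) else 0

open Classical in
lemma sum_swap {N n : ℕ} (hn : n < N) (F : (ℕ → ℕ) → ℕ → ℂ) :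
    ∑ k ∈ Pn N n, ∑ s ∈ range N, (if addb k s then F k s else 0) =
    ∑ l ∈ Pn N (n + 1), ∑ s ∈ range N, (if rem l s then F (l - Pi.single s 1) s else 0) := by
  simp only [← sum_filter]
  rw [sum_sigma', sum_sigma']
  refine sum_bij' (fun x _ => ⟨x.1 + Pi.single x.2 1, x.2⟩) (fun x _ => ⟨x.1 - Pi.single x.2 1, x.2⟩)
    ?_ ?_ ?_ ?_ ?_
  · rintro ⟨k, s⟩ h
    simp only [mem_sigma, mem_filter, mem_range] at h ⊢
    rw [mem_Pn hn.le] at h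
    rw [mem_Pn (by omega)]
    refine ⟨h.1.add hn h.2.2, h.2.1, ?_⟩
    have := h.1.anti (Nat.le_succ s)
    simp [rem]; simp at this; omega
  · rintro ⟨k, s⟩ h
    simp only [mem_sigma, mem_filter, mem_range] at h ⊢
    rw [mem_Pn (by omega)] at h
    rw [mem_Pn hn.le]
    refine ⟨h.1.sub hn h.2.2, h.2.1, ?_⟩
    by_cases hs : s = 0
    · left; exact hs
    · right
      have := h.1.anti (show s - 1 ≤ s by omega)
      have h2 := h.2.2
      unfold rem at h2
      simp only [Pi.sub_apply, Pi.single_apply]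
      rw [if_pos trivial, if_neg (show ¬ (s - 1 = s) by omega)]
      omega
  · rintro ⟨k, s⟩ h
    simp
  · rintro ⟨k, s⟩ h
    simp only [mem_sigma, mem_filter, mem_range] at h ⊢
    have h2 := h.2.2
    unfold rem at h2
    rw [sub_add_single (by omega)]
  · rintro ⟨k, s⟩ h
    simp

open Classical in
lemma comm_pt {l : ℕ → ℕ} (hl : Antitone l) (g : ℤ → ℂ) (H : (ℕ → ℕ) → ℂ) (r s : ℕ) :
    (if addb l r then g ((l r : ℤ) - r) * (if rem (l + Pi.single r 1) s then
        H (l + Pi.single r 1 - Pi.single s 1) else 0) else 0) =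
    (if rem l s then (if addb (l - Pi.single s 1) r then
        g (((l - Pi.single s 1 : ℕ → ℕ) r : ℤ) - r) * H (l - Pi.single s 1 + Pi.single r 1) else 0) else 0) +
    (if s = r then ((if addb l r then g ((l r : ℤ) - r) else 0) -
      (if rem l r then g ((l r : ℤ) - 1 - r) else 0)) * H l else 0) := by
  by_cases hsr : s = r
  · subst hsr
    have h1 : rem (l + Pi.single s 1) s := by
      have := hl (Nat.le_succ s)
      simp [rem]; simp at this; omega
    rw [if_pos h1, add_sub_single, if_pos rfl]
    by_cases h2 : rem l s
    · have h3 : addb (l - Pi.single s 1) s := by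
        by_cases hs : s = 0
        · left; exact hs
        · right
          have := hl (show s - 1 ≤ s by omega)
          unfold rem at h2
          simp only [Pi.sub_apply, Pi.single_apply]
          rw [if_pos trivial, if_neg (show ¬ (s - 1 = s) by omega)]
          omega
      have h4 : 0 < l s := by unfold rem at h2; omega
      rw [if_pos h2, if_pos h2, if_pos h3, sub_add_single h4]
      simp only [Pi.sub_apply, Pi.single_eq_same]
      rw [Nat.cast_sub (by omega)]
      by_cases h5 : addb l s <;> simp [h5] <;> ring
    · rw [if_neg h2, if_neg h2]
      by_cases h5 : addb l s <;> simp [h5]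
  · rw [if_neg hsr, add_zero]
    have hiff : (addb l r ∧ rem (l + Pi.single r 1) s) ↔ (rem l s ∧ addb (l - Pi.single s 1) r) := by
      have a1 := hl (Nat.le_succ s)
      have a2 := hl (show r - 1 ≤ r by omega)
      simp only [addb, rem, Pi.add_apply, Pi.sub_apply, Pi.single_apply]
      simp only [Nat.succ_eq_add_one] at a1
      rw [if_neg hsr, if_neg (Ne.symm hsr)]
      by_cases b1 : s + 1 = r
      · subst b1
        simp at *
        omega
      · rw [if_neg b1]
        by_cases b2 : r - 1 = s
        · have : r = 0 := by omega
          simp [this]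
        · rw [if_neg b2]
          simp
          tauto
    by_cases h : addb l r ∧ rem (l + Pi.single r 1) s
    · have h' := hiff.1 h
      rw [if_pos h.1, if_pos h.2, if_pos h'.1, if_pos h'.2]
      congr 2
      · simp [Ne.symm hsr]
      · have := h'.1
        unfold rem at this
        ext m
        simp only [Pi.add_apply, Pi.sub_apply, Pi.single_apply]
        by_cases m1 : m = r
        · subst m1; simp [Ne.symm hsr]
        · by_cases m2 : m = s
          · subst m2; simp [m1]
          · simp [m1, m2]
    · have h' := mt hiff.2 h
      by_cases c1 : addb l r
      · rw [if_pos c1, if_neg (fun hh => h ⟨c1, hh⟩), mul_zero]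
        by_cases c2 : rem l s
        · rw [if_pos c2, if_neg (fun hh => h' ⟨c2, hh⟩)]
        · rw [if_neg c2]
      · rw [if_neg c1]
        by_cases c2 : rem l s
        · rw [if_pos c2, if_neg (fun hh => h' ⟨c2, hh⟩)]
        · rw [if_neg c2]

open Classical in
def cor (N : ℕ) (g : ℤ → ℂ) (l : ℕ → ℕ) : ℂ :=
  ∑ r ∈ range N, ((if addb l r then g ((l r : ℤ) - r) else 0) -
      (if rem l r then g ((l r : ℤ) - 1 - r) else 0))

open Classical in
lemma comm {N : ℕ} {l : ℕ → ℕ} (hl : Antitone l) (g : ℤ → ℂ) (H : (ℕ → ℕ) → ℂ) :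
    ∑ r ∈ range N, (if addb l r then g ((l r : ℤ) - r) * ∑ s ∈ range N, (if rem (l + Pi.single r 1) s then
        H (l + Pi.single r 1 - Pi.single s 1) else 0) else 0) =
    (∑ s ∈ range N, if rem l s then (∑ r ∈ range N, if addb (l - Pi.single s 1) r then
        g (((l - Pi.single s 1 : ℕ → ℕ) r : ℤ) - r) * H (l - Pi.single s 1 + Pi.single r 1) else 0) else 0) +
    cor N g l * H l := by
  have e1 : ∀ r, (if addb l r then g ((l r : ℤ) - r) * ∑ s ∈ range N, (if rem (l + Pi.single r 1) s then
        H (l + Pi.single r 1 - Pi.single s 1) else 0) else 0) =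
      ∑ s ∈ range N, (if addb l r then g ((l r : ℤ) - r) * (if rem (l + Pi.single r 1) s then
        H (l + Pi.single r 1 - Pi.single s 1) else 0) else 0) := by
    intro r
    split_ifs
    · rw [mul_sum]
    · simp
  simp only [e1, comm_pt hl, sum_add_distrib]
  congr 1
  · rw [sum_comm]
    apply sum_congr rfl
    intro s _
    split_ifs
    · rfl
    · simp
  · rw [cor, sum_mul]
    apply sum_congr rfl
    intro r hr
    rw [sum_ite_eq' ]
    simp only [hr, if_true]

lemma tele (g : ℤ → ℂ) (m : ℕ) (r : ℤ) : ∑ c ∈ range m, (g (c - r + 1) - 2 * g (c - r) + g (c - r - 1)) =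
    g (m - r) - g (m - r - 1) - g (-r) + g (-r - 1) := by
  induction m with
  | zero => simp
  | succ m ih =>
    rw [sum_range_succ, ih]
    push_cast
    rw [show (m : ℤ) + 1 - r = m - r + 1 by ring, show (m : ℤ) - r + 1 - 1 = m - r by ring]
    ring

def Bg (N : ℕ) (g : ℤ → ℂ) (l : ℕ → ℕ) : ℂ := ∑ r ∈ range N, ∑ c ∈ range (l r), g ((c : ℤ) - r)

open Classical in
lemma cor_eq {N n : ℕ} (hn : n < N) {l : ℕ → ℕ} (hl : IsP N n l) (g : ℤ → ℂ) :
    cor N g l = g 0 + Bg N (fun c => g (c + 1) - 2 * g c + g (c - 1)) l := by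
  have key : ∀ M, cor (M + 1) g l = g 0 + ∑ r ∈ range (M + 1), (g (l r - r) - g (l r - r - 1) - g (-r) + g (-r - 1))
      + (if rem l M then 0 else g (l M - M - 1)) - g (-M-1) := by
    intro M
    induction M with
    | zero =>
      simp [cor, addb]
      have : (l 0 : ℤ) - 1 = l 0 - 1 := rfl
      split_ifs <;> ring
    | succ M ih =>
      rw [cor, sum_range_succ, ← cor, ih, sum_range_succ _ (M + 1)]
      have h1 : rem l M ↔ addb l (M + 1) := by simp [rem, addb]
      have h3 : (l (M + 1) : ℤ) - 1 - ((M + 1 : ℕ) : ℤ) = l (M + 1) - ((M + 1 : ℕ) : ℤ) - 1 := by ring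
      have h4 : -(((M + 1 : ℕ)) : ℤ) = -(M : ℤ) - 1 := by push_cast; ring
      rw [h3, h4]
      by_cases h : rem l M
      · have h' := h1.1 h
        rw [if_pos h, if_pos h']
        split_ifs <;> ring
      · have h' := mt h1.2 h
        rw [if_neg h, if_neg h']
        have h2 : l M = l (M + 1) := by
          have := hl.anti (Nat.le_succ M)
          unfold rem at h; simp at this; omega
        have h5 : (l M : ℤ) - M - 1 = l (M + 1) - ((M + 1 : ℕ) : ℤ) := by rw [h2]; push_cast; ring
        rw [h5]
        split_ifs <;> ring
  obtain ⟨M, rfl⟩ : ∃ M, N = M + 1 := ⟨N - 1, by omega⟩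
  rw [key M]
  have h0 : l M = 0 := hl.zero M (by omega)
  have : ¬ rem l M := by unfold rem; omega
  rw [if_neg this, h0]
  simp only [Bg, tele]
  simp

end RS
end

noncomputable section
namespace RS
open Finset

open Classical in
lemma f_succ (N n : ℕ) (l : ℕ → ℕ) : ((f N (n + 1) l : ℕ) : ℂ) =
    ∑ s ∈ range N, if rem l s then (f N n (l - Pi.single s 1) : ℂ) else 0 := by
  simp [f]

open Classical in
lemma f_down {N : ℕ} : ∀ {n : ℕ}, n < N → ∀ {l : ℕ → ℕ}, IsP N n l →
    ∑ r ∈ range N, (if addb l r then (f N (n + 1) (l + Pi.single r 1) : ℂ) else 0) = (n + 1) * f N n l := by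
  intro n
  induction n with
  | zero =>
    intro hn l hl
    have h1 := comm (N := N) hl.anti (fun _ => 1) (fun k => (f N 0 k : ℂ))
    simp only [one_mul, ← f_succ, zero_add] at h1 ⊢
    rw [h1, cor_eq hn hl]
    have : ∀ s, ¬ rem l s := fun s hs => by have := hl.rem_lt hs; omega
    simp [this, Bg, hl.zero]
  | succ n ih =>
    intro hn l hl
    have h1 := comm (N := N) hl.anti (fun _ => 1) (fun k => (f N (n + 1) k : ℂ))
    simp only [one_mul, ← f_succ N (n + 1)] at h1
    rw [h1, cor_eq hn hl]
    have h2 : ∀ s ∈ range N, (if rem l s then ∑ r ∈ range N, (if addb (l - Pi.single s 1) r then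
        (f N (n + 1) (l - Pi.single s 1 + Pi.single r 1) : ℂ) else 0) else 0) =
        (n + 1) * (if rem l s then (f N n (l - Pi.single s 1) : ℂ) else 0) := by
      intro s _
      split_ifs with h
      · exact ih (by omega) (hl.sub (by omega) h)
      · simp
    rw [sum_congr rfl h2, ← mul_sum, ← f_succ]
    have h6 : Bg N (fun _ => (1 : ℂ) - 2 * 1 + 1) l = 0 := by
      unfold Bg
      norm_num
    rw [h6]
    push_cast
    ring

def Sq (N n : ℕ) (X : (ℕ → ℕ) → ℂ) : ℂ := ∑ l ∈ Pn N n, (f N n l : ℂ) ^ 2 * X l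

open Classical in
def An (N n : ℕ) (g : ℤ → ℂ) : ℂ := ∑ l ∈ Pn N n, ∑ r ∈ range N,
  if addb l r then (f N n l : ℂ) * f N (n + 1) (l + Pi.single r 1) * g ((l r : ℤ) - r) else 0

lemma Bg_add {N r : ℕ} (hr : r < N) (g : ℤ → ℂ) (l : ℕ → ℕ) :
    Bg N g (l + Pi.single r 1) = Bg N g l + g ((l r : ℤ) - r) := by
  unfold Bg
  have : ∀ q ∈ range N, ∑ c ∈ range ((l + Pi.single r 1 : ℕ → ℕ) q), g ((c : ℤ) - q) =
      ∑ c ∈ range (l q), g ((c : ℤ) - q) + if q = r then g ((l r : ℤ) - r) else 0 := by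
    intro q _
    by_cases h : q = r
    · subst h; simp [sum_range_succ]
    · simp [h]
  rw [sum_congr rfl this, sum_add_distrib]
  simp [hr]

open Classical in
lemma Sq_succ {N n : ℕ} (hn : n < N) (X Y : (ℕ → ℕ) → ℂ) (g : ℤ → ℂ)
    (hX : ∀ l r, r < N → X (l + Pi.single r 1) = X l + g ((l r : ℤ) - r)) :
    Sq N (n + 1) X = (n + 1) * Sq N n X + An N n g := by
  have h1 := sum_swap hn (fun k s => (f N n k : ℂ) * f N (n + 1) (k + Pi.single s 1) * X (k + Pi.single s 1))
  have h2 : Sq N (n + 1) X = ∑ l ∈ Pn N (n + 1), ∑ s ∈ range N, if rem l s then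
      (f N n (l - Pi.single s 1) : ℂ) * f N (n + 1) (l - Pi.single s 1 + Pi.single s 1) *
        X (l - Pi.single s 1 + Pi.single s 1) else 0 := by
    unfold Sq
    apply sum_congr rfl
    intro l _
    rw [pow_two]
    nth_rw 1 [f_succ]
    rw [sum_mul, sum_mul]
    apply sum_congr rfl
    intro s _
    split_ifs with h
    · rw [sub_add_single (by unfold rem at h; omega)]
    · simp
  rw [h2, ← h1, Sq, mul_sum, An, ← sum_add_distrib]
  apply sum_congr rfl
  intro l hl
  rw [mem_Pn hn.le] at hl
  have h3 := f_down hn hl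
  have h4 : (n + 1 : ℂ) * ((f N n l : ℂ) ^ 2 * X l) = ∑ r ∈ range N, 
      if addb l r then (f N n l : ℂ) * f N (n + 1) (l + Pi.single r 1) * X l else 0 := by
    rw [show (n + 1 : ℂ) * ((f N n l : ℂ) ^ 2 * X l) = ((n + 1) * f N n l) * (f N n l * X l) by ring, ← h3,
      sum_mul]
    apply sum_congr rfl
    intro r _
    split_ifs
    · ring
    · simp
  rw [h4, ← sum_add_distrib]
  apply sum_congr rfl
  intro r hr
  split_ifs
  · rw [hX l r (by simpa using hr)]; ring
  · simp

open Classical in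
lemma An_rec {N n : ℕ} (hn : n < N) (g : ℤ → ℂ) :
    An N n g = n * An N (n - 1) g + Sq N n (fun l => g 0 + Bg N (fun c => g (c + 1) - 2 * g c + g (c - 1)) l) := by
  have h1 : An N n g = ∑ l ∈ Pn N n, (f N n l : ℂ) * ((∑ s ∈ range N, if rem l s then (∑ r ∈ range N, if addb (l - Pi.single s 1) r then
        g (((l - Pi.single s 1 : ℕ → ℕ) r : ℤ) - r) * (f N n (l - Pi.single s 1 + Pi.single r 1) : ℂ) else 0) else 0) +
    cor N g l * f N n l) := by
    unfold An
    apply sum_congr rfl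
    intro l hl
    rw [mem_Pn hn.le] at hl
    rw [← comm hl.anti g (fun k => (f N n k : ℂ)), mul_sum]
    apply sum_congr rfl
    intro r _
    split_ifs
    · rw [f_succ]; ring
    · simp
  rw [h1]
  simp only [mul_add, sum_add_distrib]
  congr 1
  · cases n with
    | zero =>
      simp only [Nat.cast_zero, zero_mul]
      apply sum_eq_zero
      intro l hl
      rw [mem_Pn hn.le] at hl
      have : ∀ s, ¬ rem l s := fun s hs => by have := hl.rem_lt hs; omega
      simp [this]
    | succ n =>
      have hsw := sum_swap (show n < N by omega) (fun k s => (f N (n + 1) (k + Pi.single s 1) : ℂ) *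
        (∑ r ∈ range N, if addb k r then g ((k r : ℤ) - r) * (f N (n + 1) (k + Pi.single r 1) : ℂ) else 0))
      have e : ∑ l ∈ Pn N (n + 1), (f N (n + 1) l : ℂ) * (∑ s ∈ range N, if rem l s then (∑ r ∈ range N, if addb (l - Pi.single s 1) r then
        g (((l - Pi.single s 1 : ℕ → ℕ) r : ℤ) - r) * (f N (n + 1) (l - Pi.single s 1 + Pi.single r 1) : ℂ) else 0) else 0) = 
        ∑ l ∈ Pn N (n + 1), ∑ s ∈ range N, if rem l s then (f N (n + 1) (l - Pi.single s 1 + Pi.single s 1) : ℂ) * (∑ r ∈ range N, if addb (l - Pi.single s 1) r then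
        g (((l - Pi.single s 1 : ℕ → ℕ) r : ℤ) - r) * (f N (n + 1) (l - Pi.single s 1 + Pi.single r 1) : ℂ) else 0) else 0 := by
        apply sum_congr rfl
        intro l _
        rw [mul_sum]
        apply sum_congr rfl
        intro s _
        split_ifs with h
        · rw [sub_add_single (by unfold rem at h; omega)]
        · simp
      rw [e, ← hsw, An, mul_sum]
      simp only [Nat.add_sub_cancel]
      apply sum_congr rfl
      intro l hl
      rw [mem_Pn (by omega)] at hl
      have h3 := f_down (show n < N by omega) hl
      have h5 : ∀ C : ℂ, ∑ s ∈ range N, (if addb l s then (f N (n + 1) (l + Pi.single s 1) : ℂ) * C else 0) =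
          (n + 1) * f N n l * C := by
        intro C
        rw [← h3, sum_mul]
        apply sum_congr rfl
        intro s _
        split_ifs <;> simp
      rw [h5, mul_sum, mul_sum]
      apply sum_congr rfl
      intro r _
      push_cast
      split_ifs
      · ring
      · simp
  · unfold Sq
    apply sum_congr rfl
    intro l hl
    rw [mem_Pn hn.le] at hl
    rw [cor_eq hn hl]
    ring

lemma Pn_zero (N : ℕ) : Pn N 0 = {0} := by
  ext l
  rw [mem_Pn (Nat.zero_le _), mem_singleton]
  constructor
  · intro h; ext r; exact h.zero r (Nat.zero_le _)
  · rintro rfl; exact ⟨fun _ _ _ => le_rfl, fun _ _ => rfl, by simp⟩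

lemma Sq_one {N n : ℕ} (hn : n ≤ N) : Sq N n (fun _ => 1) = n.factorial := by
  induction n with
  | zero => rw [Sq, Pn_zero, sum_singleton]; simp [f]
  | succ n ih =>
    rw [Sq_succ (by omega) _ (fun _ => 1) (fun _ => 0) (by simp), ih (by omega)]
    simp [An, Nat.factorial_succ]

/-- exact formula for eigenfunctions of the second difference -/
lemma Sq_eig {N : ℕ} (g : ℤ → ℂ) (q : ℂ) (h0 : g 0 = 1)
    (hg : ∀ c, g (c + 1) - 2 * g c + g (c - 1) = q * g c) {n : ℕ} (hn : n ≤ N) :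
    Sq N n (Bg N g) = n.factorial * ∑ j ∈ range N, (n.choose (j + 1) : ℂ) / (j + 1).factorial * q ^ j ∧
    (n < N → An N n g = n.factorial * ∑ j ∈ range N, ((n + 1).choose (j + 1) : ℂ) / (j.factorial) * q ^ j) := by
  have hS : ∀ n, n ≤ N → Sq N n (fun l => g 0 + Bg N (fun c => g (c + 1) - 2 * g c + g (c - 1)) l) =
      n.factorial + q * Sq N n (Bg N g) := by
    intro n hn
    rw [← Sq_one hn]
    simp only [Sq, mul_sum, ← sum_add_distrib]
    apply sum_congr rfl
    intro l _
    simp only [hg, h0, Bg, ← mul_sum]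
    ring
  have hsucc : ∀ n, n < N → Sq N n (Bg N g) = n.factorial * ∑ j ∈ range N, (n.choose (j + 1) : ℂ) / (j + 1).factorial * q ^ j →
      (1 : ℂ) + q * ∑ j ∈ range N, (n.choose (j + 1) : ℂ) / (j + 1).factorial * q ^ j =
      ∑ j ∈ range N, (n.choose j : ℂ) / j.factorial * q ^ j := by
    intro n hn _
    obtain ⟨M, rfl⟩ : ∃ M, N = M + 1 := ⟨N - 1, by omega⟩
    have e1 := sum_range_succ (fun j => (n.choose (j + 1) : ℂ) / (j + 1).factorial * q ^ j) M
    have e2 := sum_range_succ' (fun j => (n.choose j : ℂ) / j.factorial * q ^ j) M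
    rw [e1, e2, Nat.choose_eq_zero_of_lt (show n < M + 1 by omega)]
    simp only [mul_sum, Nat.cast_zero, zero_div, zero_mul, add_zero, Nat.choose_zero_right, Nat.factorial_zero]
    rw [add_comm]
    congr 1
    · apply sum_congr rfl
      intro j _; ring
    · simp
  induction n with
  | zero =>
    have a : Sq N 0 (Bg N g) = (Nat.factorial 0 : ℂ) * ∑ j ∈ range N, (Nat.choose 0 (j + 1) : ℂ) / (j + 1).factorial * q ^ j := by
      simp [Sq, Pn_zero, f, Bg]
    refine ⟨a, ?_⟩
    intro hn
    rw [An_rec hn, hS 0 (by omega), a]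
    have := hsucc 0 hn a
    simp only [Nat.cast_zero, zero_mul, zero_add, Nat.factorial_zero, Nat.cast_one, one_mul] at this ⊢
    rw [this]
    apply sum_congr rfl
    intro j _
    cases j with
    | zero => simp
    | succ j => rw [Nat.choose_eq_zero_of_lt (show 0 < j + 1 by omega), Nat.choose_eq_zero_of_lt (show 1 < j + 1 + 1 by omega)]
  | succ n ih =>
    obtain ⟨i1, i2⟩ := ih (by omega)
    have a : Sq N (n + 1) (Bg N g) = ((n + 1).factorial : ℂ) * ∑ j ∈ range N, ((n + 1).choose (j + 1) : ℂ) / (j + 1).factorial * q ^ j := by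
      rw [Sq_succ (by omega) _ (fun _ => 1) g (fun l r hr => Bg_add hr g l), i1, i2 (by omega)]
      rw [Nat.factorial_succ]
      push_cast
      rw [← mul_assoc, mul_sum, mul_sum, mul_sum, ← sum_add_distrib]
      apply sum_congr rfl
      intro j _
      have h1 : ((n + 1).choose (j + 1) : ℂ) * (j + 1) = (n + 1) * n.choose j := by
        have := Nat.add_one_mul_choose_eq n j
        exact_mod_cast this.symm
      have h2 : ((n + 1).choose (j + 1) : ℂ) = n.choose j + n.choose (j + 1) := by
        rw [Nat.choose_succ_succ]; push_cast; rfl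
      have h3 : (j.factorial : ℂ) ≠ 0 := by exact_mod_cast Nat.factorial_ne_zero j
      have h4 : (j + 1 : ℂ) ≠ 0 := by exact_mod_cast Nat.succ_ne_zero j
      rw [Nat.factorial_succ]
      push_cast
      field_simp
      have h5 : (n.choose (j + 1) : ℂ) = (n + 1).choose (j + 1) - n.choose j := by rw [h2]; ring
      rw [h5]
      linear_combination (n.factorial * q ^ j : ℂ) * h1
    refine ⟨a, ?_⟩
    intro hn'
    rw [An_rec hn', hS _ (by omega), a]
    have := hsucc (n + 1) hn' a
    rw [Nat.add_sub_cancel, i2 (by omega)]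
    rw [show ((n + 1).factorial : ℂ) + q * (((n + 1).factorial : ℂ) * ∑ j ∈ range N, ((n + 1).choose (j + 1) : ℂ) / (j + 1).factorial * q ^ j) = 
      ((n + 1).factorial : ℂ) * (1 + q * ∑ j ∈ range N, ((n + 1).choose (j + 1) : ℂ) / (j + 1).factorial * q ^ j) by ring, this]
    rw [show ((n + 1 : ℕ) : ℂ) * ((n.factorial : ℂ) * ∑ j ∈ range N, ((n + 1).choose (j + 1) : ℂ) / j.factorial * q ^ j)
      = ((n + 1).factorial : ℂ) * ∑ j ∈ range N, ((n + 1).choose (j + 1) : ℂ) / j.factorial * q ^ j by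
        rw [Nat.factorial_succ]; push_cast; ring]
    rw [← mul_add, ← sum_add_distrib]
    congr 1
    apply sum_congr rfl
    intro j _
    rw [Nat.choose_succ_succ (n + 1) j]
    push_cast
    ring

end RS
end

noncomputable section
namespace RS
open Finset

def cn (L : List ℕ) (r : ℕ) : ℕ := L.count r

def lat : List ℕ → Prop
  | [] => True
  | r :: L => rem (cn (r :: L)) r ∧ lat L

lemma cn_cons (r : ℕ) (L : List ℕ) : cn (r :: L) = cn L + Pi.single r 1 := by
  ext q
  simp only [cn, Pi.add_apply, List.count_cons, Pi.single_apply, beq_iff_eq]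
  congr 1
  by_cases h : r = q
  · simp [h]
  · simp [h, Ne.symm h]

open Classical in
lemma lat_card (N : ℕ) : ∀ (n : ℕ) (l : ℕ → ℕ) (S : Finset (List ℕ)), (∀ r, N ≤ r → l r = 0) →
    (∀ L ∈ S, lat L ∧ L.length = n ∧ cn L = l) → S.card ≤ f N n l := by
  intro n
  induction n with
  | zero =>
    intro l S _ hS
    rw [f]
    by_cases hl : l = 0
    · rw [if_pos hl, card_le_one]
      intro a ha b hb
      have h1 := (hS a ha).2.1
      have h2 := (hS b hb).2.1
      rw [List.length_eq_zero_iff] at h1 h2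
      rw [h1, h2]
    · rw [if_neg hl]
      simp only [Nat.le_zero, card_eq_zero]
      rw [eq_empty_iff_forall_notMem]
      intro a ha
      apply hl
      have h1 := (hS a ha).2.1
      rw [List.length_eq_zero_iff] at h1
      rw [← (hS a ha).2.2, h1]
      ext; simp [cn]
  | succ n ih =>
    intro l S hl hS
    rw [f]
    have key : ∀ L ∈ S, ∃ r L', L = r :: L' ∧ r < N ∧ rem l r ∧ lat L' ∧ L'.length = n ∧ cn L' = l - Pi.single r 1 := by
      intro L hL
      obtain ⟨h1, h2, h3⟩ := hS L hL
      cases L with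
      | nil => simp at h2
      | cons r L' =>
        refine ⟨r, L', rfl, ?_, ?_, h1.2, by simpa using h2, ?_⟩
        · by_contra hc
          have h4 := hl r (by omega)
          rw [← h3] at h4
          simp [cn] at h4
        · rw [← h3]; exact h1.1
        · rw [← h3, cn_cons, add_sub_single]
    rw [card_eq_sum_card_fiberwise (f := fun L => L.headD 0) (t := range N)]
    · apply sum_le_sum
      intro r hr
      split_ifs with h
      · have : ({a ∈ S | a.headD 0 = r} : Finset (List ℕ)).card = (({a ∈ S | a.headD 0 = r} : Finset (List ℕ)).image List.tail).card := by
          rw [card_image_of_injOn]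
          intro a ha b hb hab
          simp only [coe_filter, Set.mem_setOf_eq] at ha hb
          obtain ⟨r1, L1, e1, -⟩ := key a ha.1
          obtain ⟨r2, L2, e2, -⟩ := key b hb.1
          subst e1; subst e2
          simp at ha hb hab
          rw [ha.2, hb.2, hab]
        rw [this]
        apply ih
        · intro q hq; simp [hl q hq]
        · intro L hL
          simp only [mem_image, mem_filter] at hL
          obtain ⟨a, ⟨ha, har⟩, rfl⟩ := hL
          obtain ⟨r1, L1, e1, h1, h2, h3, h4, h5⟩ := key a ha
          subst e1
          simp at har
          subst har
          exact ⟨h3, h4, h5⟩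
      · simp only [Nat.le_zero, card_eq_zero]
        rw [eq_empty_iff_forall_notMem]
        intro a ha
        simp only [mem_filter] at ha
        obtain ⟨r1, L1, e1, h1, h2, h3⟩ := key a ha.1
        subst e1
        simp at ha
        rw [ha.2] at h2
        exact h h2
    · intro a ha
      obtain ⟨r1, L1, e1, h1, h2, h3⟩ := key a ha
      subst e1
      simpa using h1

/-! tableau facts -/
lemma rd_len (T : List (List ℕ)) : ∀ N, T.length ≤ N → ∑ r ∈ range N, sh T r = (rd T).length := by
  induction T with
  | nil => intro N _; simp [sh, rd]
  | cons R T ih =>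
    intro N hN
    obtain ⟨M, rfl⟩ : ∃ M, N = M + 1 := ⟨N - 1, by simp at hN; omega⟩
    rw [sum_range_succ']
    simp only [(sh_cons R T).1, (sh_cons R T).2]
    rw [ih M (by simpa using hN)]
    simp [rd]

lemma tab_len (T : List (List ℕ)) (hT : IsTab T) : T.length ≤ (rd T).length := by
  induction T with
  | nil => simp
  | cons R T ih =>
    have := ih hT.2.2.2
    have h1 := List.length_pos_iff.2 hT.1
    simp [rd]; omega

lemma tab_isP (T : List (List ℕ)) (hT : IsTab T) {N : ℕ} (hN : (rd T).length ≤ N) : IsP N (rd T).length (sh T) := by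
  refine ⟨sh_anti T hT, ?_, rd_len T N ((tab_len T hT).trans hN)⟩
  intro r hr
  have := tab_len T hT
  rw [sh, List.getD_eq_default _ _ (this.trans hr)]; rfl

lemma PT_rd (w : List ℕ) (hw : w.Nodup) : (rd (PT w)).Perm w :=
  ((PT_spec w hw).1.perm.symm).trans (List.reverse_perm w)

lemma shape_isP {n : ℕ} (σ : Equiv.Perm (Fin n)) {N : ℕ} (hN : n ≤ N) : IsP N n (shape σ) := by
  rw [shape_eq]
  have h := (PT_rd _ (wd_nodup σ)).trans (wd_perm σ)
  have h1 := h.length_eq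
  rw [List.length_range] at h1
  have := tab_isP (N := N) _ (PT_spec _ (wd_nodup σ)).2 (by omega)
  rwa [h1] at this

lemma mem_rowOf (T : List (List ℕ)) : (rd T).Nodup → ∀ a ∈ rd T, ∀ r, a ∈ T.getD r [] ↔ r = rowOf T a := by
  induction T with
  | nil => intro _ a ha; simp [rd] at ha
  | cons R T ih =>
    intro hn a ha r
    simp only [rd] at hn ha
    rw [List.nodup_append] at hn
    have hsub : ∀ q, a ∈ T.getD q [] → a ∈ rd T := by
      clear ih hn ha
      intro q
      induction T generalizing q with
      | nil => simp
      | cons S T ih => cases q with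
        | zero => intro h; simp at h; simp [rd, h]
        | succ q => intro h; simp at h; have := ih q (by simpa using h); simp [rd, this]
    simp only [rowOf]
    split_ifs with h
    · cases r with
      | zero => simp [h]
      | succ q =>
        simp only [List.getD_cons_succ, Nat.succ_ne_zero, iff_false]
        intro h2
        exact hn.2.2 _ (hsub q h2) _ h rfl
    · have ha' : a ∈ rd T := by
        rcases List.mem_append.1 ha with h' | h'
        · exact h'
        · exact absurd h' h
      cases r with
      | zero => simp [h]
      | succ q =>
        simp only [List.getD_cons_succ, Nat.add_right_cancel_iff]
        exact ih hn.1 a ha' q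

lemma countP_succ (R : List ℕ) (hR : R.Nodup) (m : ℕ) : R.countP (fun a => decide (a < m + 1)) =
    R.countP (fun a => decide (a < m)) + if m ∈ R then 1 else 0 := by
  induction R with
  | nil => simp
  | cons a R ih =>
    have h1 := List.nodup_cons.1 hR
    rw [List.countP_cons, List.countP_cons, ih h1.2]
    by_cases h : a = m
    · subst h; simp [h1.1]
    · have : m ∈ a :: R ↔ m ∈ R := by simp [Ne.symm h]
      simp only [this]
      have h2 : a < m + 1 ↔ a < m := by omega
      simp only [h2]; omega

lemma dom_count (m : ℕ) : ∀ R S : List ℕ, dom R S → S.countP (fun a => decide (a < m + 1)) ≤ R.countP (fun a => decide (a < m))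
  | _, [], _ => by simp
  | [], _ :: _, h => by simp [dom] at h
  | a :: R, b :: S, h => by
    simp only [dom] at h
    have := dom_count m R S h.2
    rw [List.countP_cons, List.countP_cons]
    have h3 : b < m + 1 → a < m := by omega
    by_cases h4 : b < m + 1
    · simp [h4, h3 h4]; simpa using this
    · simp [h4]; simp at this; omega

lemma tab_row (T : List (List ℕ)) (hT : IsTab T) : ∀ r, (T.getD r []).Pairwise (· < ·) ∧ dom (T.getD r []) (T.getD (r + 1) []) := by
  induction T with
  | nil => intro r; simp [dom]
  | cons R T ih =>
    intro r
    cases r with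
    | zero =>
      refine ⟨hT.2.1, ?_⟩
      have := hT.2.2.1
      cases T <;> simpa using this
    | succ r => simpa using ih hT.2.2.2 r

def LT (T : List (List ℕ)) : ℕ → List ℕ
  | 0 => []
  | m + 1 => rowOf T m :: LT T m

lemma LT_len (T m) : (LT T m).length = m := by induction m <;> simp_all [LT]

lemma LT_cn (T : List (List ℕ)) (hT : IsTab T) (n : ℕ) (hp : (rd T).Perm (List.range n)) : ∀ m ≤ n,
    (∀ r, cn (LT T m) r = (T.getD r []).countP (fun a => decide (a < m))) ∧ lat (LT T m) := by
  have hnd : (rd T).Nodup := hp.nodup_iff.2 List.nodup_range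
  intro m
  induction m with
  | zero => intro _; simp [LT, cn, lat]
  | succ m ih =>
    intro hm
    obtain ⟨h1, h2⟩ := ih (by omega)
    have hmem : m ∈ rd T := by rw [hp.mem_iff]; simp; omega
    have h3 : ∀ r, cn (LT T (m + 1)) r = (T.getD r []).countP (fun a => decide (a < m + 1)) := by
      intro r
      rw [LT, cn_cons, countP_succ _ ((tab_row T hT r).1.imp (fun h => ne_of_lt h)), Pi.add_apply, h1]
      simp only [mem_rowOf T hnd m hmem, Pi.single_apply]
    refine ⟨h3, ?_, h2⟩
    have h4 : rowOf T m :: LT T m = LT T (m + 1) := rfl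
    rw [h4, rem, h3, h3]
    have h5 := dom_count m _ _ (tab_row T hT (rowOf T m)).2
    rw [countP_succ (T.getD (rowOf T m) []) ((tab_row T hT _).1.imp (fun h => ne_of_lt h)),
      if_pos ((mem_rowOf T hnd m hmem _).2 rfl)]
    omega

lemma LT_sh (T : List (List ℕ)) (hT : IsTab T) (n : ℕ) (hp : (rd T).Perm (List.range n)) : cn (LT T n) = sh T := by
  ext r
  rw [(LT_cn T hT n hp n le_rfl).1 r, sh, List.countP_eq_length]
  intro a ha
  have : ∀ (T : List (List ℕ)) q, a ∈ T.getD q [] → a ∈ rd T := by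
      intro T q
      induction T generalizing q with
      | nil => simp
      | cons S T ih => cases q with
        | zero => intro h; simp at h; simp [rd, h]
        | succ q => intro h; simp at h; have := ih q (by simpa using h); simp [rd, this]
  have := this T r ha
  rw [hp.mem_iff] at this
  simpa using this

lemma getD_mem (a : ℕ) : ∀ (T : List (List ℕ)) q, a ∈ T.getD q [] → a ∈ rd T := by
  intro T q
  induction T generalizing q with
  | nil => simp
  | cons S T ih => cases q with
    | zero => intro h; simp at h; simp [rd, h]
    | succ q => intro h; simp at h; have := ih q (by simpa using h); simp [rd, this]

lemma tab_ext : ∀ (T T' : List (List ℕ)), IsTab T → IsTab T' → (∀ r, T.getD r [] = T'.getD r []) → T = T'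
  | [], [], _, _, _ => rfl
  | [], R :: T, _, h, e => by have := e 0; simp at this; exact absurd this h.1
  | R :: T, [], h, _, e => by have := e 0; simp at this; exact absurd this h.1
  | R :: T, R' :: T', h, h', e => by
    have h0 := e 0
    simp at h0
    rw [h0, tab_ext T T' h.2.2.2 h'.2.2.2 (fun r => by simpa using e (r + 1))]

lemma LT_inj (n : ℕ) (T T' : List (List ℕ)) (hT : IsTab T) (hT' : IsTab T') (hp : (rd T).Perm (List.range n))
    (hp' : (rd T').Perm (List.range n)) (h : LT T n = LT T' n) : T = T' := by
  have hnd : (rd T).Nodup := hp.nodup_iff.2 List.nodup_range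
  have hnd' : (rd T').Nodup := hp'.nodup_iff.2 List.nodup_range
  have hrow : ∀ m < n, rowOf T m = rowOf T' m := by
    clear hp hp'
    induction n with
    | zero => intro m hm; omega
    | succ n ih =>
      simp only [LT, List.cons.injEq] at h
      intro m hm
      rcases Nat.lt_succ_iff_lt_or_eq.1 hm with h1 | h1
      · exact ih h.2 m h1
      · subst h1; exact h.1
  apply tab_ext T T' hT hT'
  intro r
  have hs := (tab_row T hT r).1
  have hs' := (tab_row T' hT' r).1
  refine List.Perm.eq_of_pairwise (le := (· < ·)) (fun a b _ _ h1 h2 => by omega) hs hs' ?_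
  rw [List.perm_ext_iff_of_nodup (hs.imp (fun h => ne_of_lt h)) (hs'.imp (fun h => ne_of_lt h))]
  intro a
  constructor
  · intro ha
    have h1 := getD_mem a T r ha
    have h2 : a < n := by rw [hp.mem_iff] at h1; simpa using h1
    rw [mem_rowOf T hnd a h1] at ha
    rw [mem_rowOf T' hnd' a (by rw [hp'.mem_iff]; simpa using h2), ha, hrow a h2]
  · intro ha
    have h1 := getD_mem a T' r ha
    have h2 : a < n := by rw [hp'.mem_iff] at h1; simpa using h1
    rw [mem_rowOf T' hnd' a h1] at ha
    rw [mem_rowOf T hnd a (by rw [hp.mem_iff]; simpa using h2), ha, hrow a h2]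

/-! recording -/
open Classical in
def qs : List ℕ → List ℕ
  | [] => []
  | x :: w => (if h : ∃ r, sh (PT (x :: w)) = sh (PT w) + Pi.single r 1 then h.choose else 0) :: qs w

lemma qs_len (w) : (qs w).length = w.length := by induction w <;> simp_all [qs]

lemma PT_cons_nd (x : ℕ) (w : List ℕ) (h : (x :: w).Nodup) : (x :: rd (PT w)).Nodup := by
  rw [((PT_rd w (List.nodup_cons.1 h).2).cons x).nodup_iff]; exact h

lemma qs_spec (w : List ℕ) (hw : w.Nodup) : cn (qs w) = sh (PT w) ∧ lat (qs w) := by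
  induction w with
  | nil => constructor
           · ext; simp [qs, cn, PT, sh]
           · trivial
  | cons x w ih =>
    have hw' := (List.nodup_cons.1 hw).2
    obtain ⟨h1, h2⟩ := ih hw'
    have h : ∃ r, sh (PT (x :: w)) = sh (PT w) + Pi.single r 1 :=
      sh_insT _ _ (PT_spec w hw').2 (PT_cons_nd x w hw)
    obtain ⟨r, hr, hq⟩ : ∃ r, sh (PT (x :: w)) = sh (PT w) + Pi.single r 1 ∧ qs (x :: w) = r :: qs w :=
      ⟨h.choose, h.choose_spec, by rw [qs, dif_pos h]⟩
    have h3 : cn (qs (x :: w)) = sh (PT (x :: w)) := by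
      rw [hq, cn_cons, h1, hr]
    refine ⟨h3, ?_⟩
    have h6 := sh_anti _ (PT_spec w hw').2 (Nat.le_succ r)
    rw [hq] at h3 ⊢
    refine ⟨?_, h2⟩
    rw [h3, rem, hr]
    simp at h6 ⊢; omega

lemma qs_inj : ∀ (w w' : List ℕ), w.Nodup → w'.Nodup → PT w = PT w' → qs w = qs w' → w = w'
  | [], [], _, _, _, _ => rfl
  | [], _ :: _, _, _, _, h => by simp [qs] at h
  | _ :: _, [], _, _, _, h => by simp [qs] at h
  | x :: w, y :: w', h1, h2, h3, h4 => by
    have h1' := (List.nodup_cons.1 h1).2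
    have h2' := (List.nodup_cons.1 h2).2
    have e1 : qs w = qs w' := by rw [qs, qs] at h4; exact (List.cons.inj h4).2
    have e2 : sh (PT w) = sh (PT w') := by rw [← (qs_spec w h1').1, ← (qs_spec w' h2').1, e1]
    obtain ⟨a, b⟩ := insT_inj (PT w) (PT w') x y (PT_spec w h1').2 (PT_spec w' h2').2 (PT_cons_nd x w h1) (PT_cons_nd y w' h2) e2 h3
    rw [b, qs_inj w w' h1' h2' a e1]

open Classical in
lemma shape_card_le {n N : ℕ} (hN : n ≤ N) (l : ℕ → ℕ) (hl : IsP N n l) :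
    (univ.filter (fun σ : Equiv.Perm (Fin n) => shape σ = l)).card ≤ (f N n l) ^ 2 := by
  set A := univ.filter (fun σ : Equiv.Perm (Fin n) => shape σ = l) with hA
  have hz : ∀ r, N ≤ r → l r = 0 := fun r hr => hl.zero r (by omega)
  have c1 : (A.image (fun σ => LT (PT (wd σ)) n)).card ≤ f N n l := by
    apply lat_card N n l _ hz
    intro L hL
    simp only [hA, mem_image, mem_filter, mem_univ, true_and] at hL
    obtain ⟨σ, h1, rfl⟩ := hL
    have hT := (PT_spec _ (wd_nodup σ)).2
    have hp := (PT_rd _ (wd_nodup σ)).trans (wd_perm σ)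
    refine ⟨(LT_cn _ hT n hp n le_rfl).2, LT_len _ _, ?_⟩
    rw [LT_sh _ hT n hp, ← h1, shape_eq]
  have c2 : (A.image (fun σ => qs (wd σ))).card ≤ f N n l := by
    apply lat_card N n l _ hz
    intro L hL
    simp only [hA, mem_image, mem_filter, mem_univ, true_and] at hL
    obtain ⟨σ, h1, rfl⟩ := hL
    have := qs_spec _ (wd_nodup σ)
    refine ⟨this.2, ?_, ?_⟩
    · rw [qs_len, (wd_perm σ).length_eq, List.length_range]
    · rw [this.1, ← h1, shape_eq]
  have c3 : A.card ≤ ((A.image (fun σ => LT (PT (wd σ)) n)) ×ˢ (A.image (fun σ => qs (wd σ)))).card := by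
    apply card_le_card_of_injOn (fun σ => (LT (PT (wd σ)) n, qs (wd σ)))
    · intro σ hσ
      simp only [coe_product, Set.mem_prod, coe_image]
      exact ⟨⟨σ, hσ, rfl⟩, ⟨σ, hσ, rfl⟩⟩
    · intro σ _ τ _ h
      simp only [Prod.mk.injEq] at h
      have e := LT_inj n _ _ (PT_spec _ (wd_nodup σ)).2 (PT_spec _ (wd_nodup τ)).2
        ((PT_rd _ (wd_nodup σ)).trans (wd_perm σ)) ((PT_rd _ (wd_nodup τ)).trans (wd_perm τ)) h.1
      exact wd_inj (qs_inj _ _ (wd_nodup σ) (wd_nodup τ) e h.2)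
  rw [card_product] at c3
  rw [pow_two]
  exact c3.trans (Nat.mul_le_mul c1 c2)

open Classical in
lemma shape_card {n N : ℕ} (hN : n ≤ N) (l : ℕ → ℕ) (hl : IsP N n l) :
    (univ.filter (fun σ : Equiv.Perm (Fin n) => shape σ = l)).card = (f N n l) ^ 2 := by
  have h1 : ∑ l ∈ Pn N n, (f N n l) ^ 2 = n.factorial := by
    have := Sq_one hN
    simp only [Sq, mul_one] at this
    exact_mod_cast this
  have h2 : ∑ l ∈ Pn N n, (univ.filter (fun σ : Equiv.Perm (Fin n) => shape σ = l)).card = n.factorial := by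
    rw [← card_eq_sum_card_fiberwise (s := (univ : Finset (Equiv.Perm (Fin n)))) (t := Pn N n) (f := fun σ => shape σ)
      (fun σ _ => (mem_Pn hN).2 (shape_isP σ hN))]
    rw [card_univ, Fintype.card_perm, Fintype.card_fin]
  have h3 := (sum_eq_sum_iff_of_le (s := Pn N n) (fun l hl => shape_card_le hN l ((mem_Pn hN).1 hl))).1 (h2.trans h1.symm)
  exact h3 l ((mem_Pn hN).2 hl)

lemma planch {n N : ℕ} (hN : n ≤ N) (X : (ℕ → ℕ) → ℂ) :
    ∑ σ : Equiv.Perm (Fin n), X (shape σ) = Sq N n X := by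
  classical
  rw [← sum_fiberwise_of_maps_to (s := univ) (t := Pn N n) (g := fun σ => shape σ)
    (fun σ _ => (mem_Pn hN).2 (shape_isP σ hN)), Sq]
  apply sum_congr rfl
  intro l hl
  rw [sum_congr rfl (g := fun _ => X l) (by intro σ hσ; simp at hσ; rw [hσ]), sum_const, shape_card hN l ((mem_Pn hN).1 hl)]
  simp

end RS
end

noncomputable section
namespace RS
open Finset

/-! Lipschitz -/
lemma Minc_bdd {n : ℕ} (σ : Equiv.Perm (Fin n)) (k : ℕ) :
    BddAbove {m | ∃ s : Finset (Fin n), IsUnionInc σ k s ∧ s.card = m} := by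
  refine ⟨n, ?_⟩
  rintro m ⟨s, _, rfl⟩
  simpa using card_le_univ s

lemma Minc_attain {n : ℕ} (σ : Equiv.Perm (Fin n)) (k : ℕ) :
    ∃ s : Finset (Fin n), IsUnionInc σ k s ∧ s.card = Minc σ k := by
  have := Nat.sSup_mem (s := {m | ∃ s : Finset (Fin n), IsUnionInc σ k s ∧ s.card = m})
    ⟨0, ∅, ⟨fun _ => ∅, by simp [IncSeq], by ext; simp⟩, rfl⟩ (Minc_bdd σ k)
  exact this

lemma Minc_lip {n : ℕ} (σ τ : Equiv.Perm (Fin n)) (D : Finset (Fin n)) (h : ∀ i, i ∉ D → σ i = τ i) (k : ℕ) :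
    Minc σ k ≤ Minc τ k + D.card := by
  obtain ⟨s, ⟨g, hg, hs⟩, hc⟩ := Minc_attain σ k
  have h1 : IsUnionInc τ k (s \ D) := by
    refine ⟨fun t => g t \ D, ?_, ?_⟩
    · intro t i hi j hj hij
      simp only [mem_sdiff] at hi hj
      rw [← h i hi.2, ← h j hj.2]
      exact hg t i hi.1 j hj.1 hij
    · ext x
      rw [hs]
      simp only [mem_sdiff, mem_biUnion, mem_univ, true_and]
      tauto
  have h2 : (s \ D).card ≤ Minc τ k := le_csSup (Minc_bdd τ k) ⟨_, h1, rfl⟩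
  have h3 := card_le_card_sdiff_add_card (s := s) (t := D)
  omega

/-- number of boxes of content larger than `i` -/
def G (N : ℕ) (i : ℤ) (l : ℕ → ℕ) : ℤ := ∑ r ∈ range N, max 0 ((l r : ℤ) - max 0 (i + r + 1))

lemma G_ge (N : ℕ) (i : ℤ) (l : ℕ → ℕ) (k : ℕ) (hk : k ≤ N) :
    ∑ r ∈ range k, (l r : ℤ) - ∑ r ∈ range k, max 0 (i + r + 1) ≤ G N i l := by
  rw [← sum_sub_distrib, G]
  calc _ ≤ ∑ r ∈ range k, max 0 ((l r : ℤ) - max 0 (i + r + 1)) := sum_le_sum (fun r _ => le_max_right _ _)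
    _ ≤ _ := sum_le_sum_of_subset_of_nonneg (range_subset_range.2 hk) (fun _ _ _ => le_max_left _ _)

lemma G_eq (N : ℕ) (i : ℤ) (l : ℕ → ℕ) (hl : Antitone l) : ∃ k ≤ N,
    ∑ r ∈ range k, (l r : ℤ) - ∑ r ∈ range k, max 0 (i + r + 1) = G N i l := by
  induction N with
  | zero => exact ⟨0, le_rfl, by simp [G]⟩
  | succ N ih =>
    by_cases h : (l N : ℤ) - max 0 (i + N + 1) ≤ 0
    · obtain ⟨k, hk, e⟩ := ih
      refine ⟨k, by omega, ?_⟩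
      rw [e, G, G, sum_range_succ, max_eq_left h, add_zero]
    · refine ⟨N + 1, le_rfl, ?_⟩
      rw [← sum_sub_distrib, G]
      apply sum_congr rfl
      intro r hr
      have h1 := hl (show r ≤ N by simp at hr; omega)
      have h2 : r ≤ N := by simp at hr; omega
      rw [max_eq_right (a := (0 : ℤ)) (b := (l r : ℤ) - max 0 (i + r + 1))]
      zify at h1 h2
      omega

lemma G_lip {n : ℕ} (σ τ : Equiv.Perm (Fin n)) (D : Finset (Fin n)) (h : ∀ i, i ∉ D → σ i = τ i) (N : ℕ) (i : ℤ) :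
    G N i (shape σ) ≤ G N i (shape τ) + D.card := by
  obtain ⟨k, hk, e⟩ := G_eq N i (shape σ) (shape_anti σ)
  have h1 := G_ge N i (shape τ) k hk
  have h2 := Minc_lip σ τ D h k
  rw [Minc_sum, Minc_sum] at h2
  zify at h2
  linarith

lemma G_swap {n : ℕ} (σ : Equiv.Perm (Fin n)) (x y : Fin n) (N : ℕ) (i : ℤ) :
    |(G N i (shape (σ * Equiv.swap x y)) : ℝ) - G N i (shape σ)| ≤ 2 := by
  have hc : ((({x, y} : Finset (Fin n)).card : ℕ) : ℤ) ≤ 2 := by exact_mod_cast card_le_two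
  have hD : ∀ i, i ∉ ({x, y} : Finset (Fin n)) → (σ * Equiv.swap x y) i = σ i := by
    intro i hi
    simp only [mem_insert, mem_singleton, not_or] at hi
    rw [Equiv.Perm.mul_apply, Equiv.swap_apply_of_ne_of_ne hi.1 hi.2]
  have h1 := G_lip _ _ _ hD N i
  have h2 := G_lip _ _ _ (fun i hi => (hD i hi).symm) N i
  rw [abs_le]
  have h1' : (G N i (shape (σ * Equiv.swap x y)) : ℝ) ≤ G N i (shape σ) + 2 := by exact_mod_cast h1.trans (by linarith)
  have h2' : (G N i (shape σ) : ℝ) ≤ G N i (shape (σ * Equiv.swap x y)) + 2 := by exact_mod_cast h2.trans (by linarith)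
  constructor <;> linarith

open Classical in
lemma G_Bg (N : ℕ) (i : ℤ) (l : ℕ → ℕ) :
    ∑ r ∈ range N, ∑ c ∈ range (l r), (if i < (c : ℤ) - r then (1 : ℝ) else 0) = G N i l := by
  rw [G]
  push_cast
  apply sum_congr rfl
  intro r _
  have : ∀ L : ℕ, ∑ c ∈ range L, (if i < (c : ℤ) - r then (1 : ℤ) else 0) = max 0 ((L : ℤ) - max 0 (i + r + 1)) := by
    intro L
    induction L with
    | zero => simp
    | succ L ih => rw [sum_range_succ, ih]; split_ifs <;> push_cast <;> omega
  have h := this (l r)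
  have h2 : ((∑ c ∈ range (l r), (if i < (c : ℤ) - r then (1 : ℤ) else 0) : ℤ) : ℝ) = ((max 0 ((l r : ℤ) - max 0 (i + r + 1)) : ℤ) : ℝ) := by rw [h]
  push_cast at h2
  simpa using h2

lemma G_anti (N : ℕ) (l : ℕ → ℕ) : Antitone (fun i => G N i l) := by
  intro i j hij
  apply sum_le_sum
  intro r _
  omega

lemma G_nonneg (N i l) : 0 ≤ G N i l := sum_nonneg (fun _ _ => le_max_left _ _)

lemma G_le {N n : ℕ} {l : ℕ → ℕ} (h : IsP N n l) (i : ℤ) : G N i l ≤ n := by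
  have := h.sum
  calc G N i l ≤ ∑ r ∈ range N, (l r : ℤ) := by
        apply sum_le_sum; intro r _; omega
    _ = n := by exact_mod_cast this

def bx (N : ℕ) (l : ℕ → ℕ) (i : ℤ) : ℤ := G N (i - 1) l - G N i l

lemma sum_bx (N : ℕ) (l : ℕ → ℕ) (i : ℤ) (m : ℕ) : ∑ t ∈ range m, bx N l (i + t + 1) = G N i l - G N (i + m) l := by
  induction m with
  | zero => simp
  | succ m ih =>
    rw [sum_range_succ, ih, bx]
    push_cast
    rw [show i + (m : ℤ) + 1 - 1 = i + m by ring, show i + ((m : ℤ) + 1) = i + m + 1 by ring]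
    ring

def Bs (l : ℕ → ℕ) (i : ℤ) : Set ℕ := {k : ℕ | i ≤ (l k : ℤ) - ((k : ℤ) + 1)}

lemma Bs_fin {l : ℕ → ℕ} {N : ℕ} (hz : ∀ r, N ≤ r → l r = 0) (i : ℤ) : (Bs l i).Finite := by
  apply (Set.finite_Iio (N + i.natAbs)).subset
  intro k hk
  simp only [Bs, Set.mem_ofPred_eq, Set.mem_Iio] at hk ⊢
  by_contra hc
  have := hz k (by omega)
  rw [this] at hk
  omega

lemma ncard_Bs {l : ℕ → ℕ} {N : ℕ} (hz : ∀ r, N ≤ r → l r = 0) (i : ℤ) : ((Bs l i).ncard : ℤ) = bx N l i + max 0 (-i) := by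
  classical
  have h1 : Bs l i = ↑((range N).filter (fun r : ℕ => 0 ≤ i + (r : ℤ) ∧ i + (r : ℤ) < (l r : ℤ)) ∪ (range (-i).toNat)) := by
    ext k
    simp only [Bs, Set.mem_ofPred_eq, coe_union, coe_filter, mem_range, Set.mem_union, coe_range, Set.mem_Iio]
    by_cases hk : k < N
    · simp [hk]; omega
    · rw [hz k (by omega)]; simp [hk]; omega
  rw [h1, Set.ncard_coe_finset, card_union_of_disjoint, card_range]
  · push_cast
    congr 1
    · rw [card_filter, bx, G, G, ← sum_sub_distrib]
      push_cast
      apply sum_congr rfl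
      intro r _
      split_ifs <;> omega
    · omega
  · rw [disjoint_left]
    intro k
    simp only [mem_filter, mem_range]
    omega

lemma profile_eq {l : ℕ → ℕ} {N : ℕ} (hz : ∀ r, N ≤ r → l r = 0) (i : ℤ) : profile l i = |i| + 2 * bx N l i := by
  have : profile l i = i + 2 * ((Bs l i).ncard : ℤ) := rfl
  rw [this, ncard_Bs hz]
  rcases le_total 0 i with h | h
  · rw [abs_of_nonneg h, max_eq_left (by omega)]; ring
  · rw [abs_of_nonpos h, max_eq_right (by omega)]; ring

lemma bx_lip1 {l : ℕ → ℕ} {N : ℕ} (hl : Antitone l) (hz : ∀ r, N ≤ r → l r = 0) (i : ℤ) : |bx N l (i + 1) - bx N l i| ≤ 1 := by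
  have h1 := ncard_Bs hz i
  have h2 := ncard_Bs hz (i + 1)
  have h3 : (Bs l (i + 1)).ncard ≤ (Bs l i).ncard := by
    apply Set.ncard_le_ncard _ (Bs_fin hz i)
    intro k hk
    simp only [Bs, Set.mem_ofPred_eq] at hk ⊢
    omega
  have h4 : (Bs l i).ncard ≤ (Bs l (i + 1)).ncard + 1 := by
    by_cases hx : ∃ a : ℕ, (l a : ℤ) - (a + 1) = i
    · obtain ⟨a, ha⟩ := hx
      refine (Set.ncard_le_ncard ?_ ((Bs_fin hz (i + 1)).insert a)).trans (Set.ncard_insert_le a _)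
      intro k hk
      simp only [Bs, Set.mem_ofPred_eq, Set.mem_insert_iff] at hk ⊢
      by_contra hc
      push Not at hc
      rcases lt_or_gt_of_ne hc.1 with h | h
      · have := hl h.le; omega
      · have := hl h.le; omega
    · push Not at hx
      refine (Set.ncard_le_ncard ?_ (Bs_fin hz (i + 1))).trans (Nat.le_succ _)
      intro k hk
      simp only [Bs, Set.mem_ofPred_eq] at hk ⊢
      have := hx k
      omega
  rw [abs_le]
  omega

lemma bx_lip {l : ℕ → ℕ} {N : ℕ} (hl : Antitone l) (hz : ∀ r, N ≤ r → l r = 0) (i : ℤ) (m : ℕ) : |bx N l (i + m) - bx N l i| ≤ m := by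
  induction m with
  | zero => simp
  | succ m ih =>
    have := bx_lip1 hl hz (i + m)
    push_cast
    rw [show i + ((m : ℤ) + 1) = i + m + 1 by ring]
    rw [abs_le] at *
    omega

/-- window estimate -/
lemma bx_window {l : ℕ → ℕ} {N : ℕ} (hl : Antitone l) (hz : ∀ r, N ≤ r → l r = 0) (i : ℤ) (m : ℕ) :
    |(m : ℤ) * bx N l i - (G N i l - G N (i + m) l)| ≤ m * m := by
  rw [← sum_bx]
  have : (m : ℤ) * bx N l i = ∑ t ∈ range m, bx N l i := by simp
  rw [this, ← sum_sub_distrib]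
  calc _ ≤ ∑ t ∈ range m, |bx N l i - bx N l (i + t + 1)| := abs_sum_le_sum_abs _ _
    _ ≤ ∑ t ∈ range m, (m : ℤ) := by
        apply sum_le_sum
        intro t ht
        have := bx_lip hl hz i (t + 1)
        simp only [mem_range] at ht
        push_cast at this
        rw [← add_assoc] at this
        rw [abs_sub_comm]
        omega
    _ = _ := by simp

end RS
end

noncomputable section
namespace RS
open Finset

lemma dec_mul {n : ℕ} (p : Fin (n + 1)) (e : Equiv.Perm (Fin n)) (x y : Fin n) :
    Equiv.Perm.decomposeFin.symm (p, e * Equiv.swap x y) =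
      Equiv.Perm.decomposeFin.symm (p, e) * Equiv.swap x.succ y.succ := by
  ext i
  refine Fin.cases ?_ (fun j => ?_) i
  · rw [Equiv.Perm.mul_apply, Equiv.swap_apply_of_ne_of_ne (Fin.succ_ne_zero x).symm (Fin.succ_ne_zero y).symm]
    simp
  · rw [Equiv.Perm.mul_apply, ← (Fin.succ_injective n).map_swap]
    simp

lemma dec_p {n : ℕ} (p : Fin (n + 1)) (e : Equiv.Perm (Fin n)) : ∃ x y,
    Equiv.Perm.decomposeFin.symm (p, e) = Equiv.Perm.decomposeFin.symm (0, e) * Equiv.swap x y := by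
  set s := Equiv.Perm.decomposeFin.symm (0, e) with hs
  refine ⟨s⁻¹ 0, s⁻¹ p, ?_⟩
  have : s * Equiv.swap (s⁻¹ 0) (s⁻¹ p) = Equiv.swap 0 p * s := by
    rw [Equiv.mul_swap_eq_swap_mul]; simp
  rw [this, hs]
  ext i
  refine Fin.cases ?_ (fun j => ?_) i
  · simp
  · simp

lemma conc : ∀ (n : ℕ) (F : Equiv.Perm (Fin n) → ℝ), (∀ σ x y, |F (σ * Equiv.swap x y) - F σ| ≤ 2) →
    ∃ m, ∑ σ, F σ = n.factorial * m ∧ ∑ σ, (F σ - m) ^ 2 ≤ 16 * n * n.factorial := by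
  intro n
  induction n with
  | zero =>
    intro F _
    refine ⟨F 1, ?_, ?_⟩
    · simp [Subsingleton.elim _ (1 : Equiv.Perm (Fin 0))]
    · simp [Subsingleton.elim _ (1 : Equiv.Perm (Fin 0))]
  | succ n ih =>
    intro F hF
    set D := (Equiv.Perm.decomposeFin (n := n)).symm with hD
    set g : Equiv.Perm (Fin n) → ℝ := fun e => (∑ p, F (D (p, e))) / (n + 1) with hg
    have hn : (0 : ℝ) < n + 1 := by positivity
    have hgs : ∀ e, ∑ p, F (D (p, e)) = (n + 1) * g e := by
      intro e; rw [hg]; field_simp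
    have hgL : ∀ e x y, |g (e * Equiv.swap x y) - g e| ≤ 2 := by
      intro e x y
      have h1 : |(n + 1) * (g (e * Equiv.swap x y) - g e)| ≤ (n + 1) * 2 := by
        rw [mul_sub, ← hgs, ← hgs, ← sum_sub_distrib]
        refine (abs_sum_le_sum_abs _ _).trans ?_
        have : ∀ p ∈ (univ : Finset (Fin (n + 1))), |F (D (p, e * Equiv.swap x y)) - F (D (p, e))| ≤ 2 := by
          intro p _
          rw [hD, dec_mul]
          exact hF _ _ _
        refine (sum_le_sum this).trans ?_
        simp
      rw [abs_mul, abs_of_pos hn] at h1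
      exact le_of_mul_le_mul_left h1 hn
    obtain ⟨m, hm, hv⟩ := ih g hgL
    have hbij : ∀ H : Equiv.Perm (Fin (n + 1)) → ℝ, ∑ σ, H σ = ∑ e, ∑ p, H (D (p, e)) := by
      intro H
      rw [← D.sum_comp, Fintype.sum_prod_type_right]
    refine ⟨m, ?_, ?_⟩
    · rw [hbij]
      simp only [hgs]
      rw [← mul_sum, hm, Nat.factorial_succ]; push_cast; ring
    · rw [hbij]
      have key : ∀ e, ∑ p, (F (D (p, e)) - m) ^ 2 ≤ (n + 1) * 16 + (n + 1) * (g e - m) ^ 2 := by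
        intro e
        have h2 : ∑ p, (F (D (p, e)) - m) ^ 2 = ∑ p, (F (D (p, e)) - g e) ^ 2 + (n + 1) * (g e - m) ^ 2 := by
          have : ∀ p, (F (D (p, e)) - m) ^ 2 = (F (D (p, e)) - g e) ^ 2 + ((g e - m) ^ 2 - 2 * (g e - m) * g e) + 2 * (g e - m) * F (D (p, e)) := by
            intro p; ring
          simp only [this, sum_add_distrib, ← mul_sum, hgs]
          simp; ring
        rw [h2]
        have h0 : ∀ p, |F (D (p, e)) - F (D (0, e))| ≤ 2 := by
          intro p
          obtain ⟨x, y, h⟩ := dec_p p e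
          rw [hD, h]; exact hF _ _ _
        have h3 : |F (D (0, e)) - g e| ≤ 2 := by
          have h1 : |(n + 1) * (F (D (0, e)) - g e)| ≤ (n + 1) * 2 := by
            have : (n + 1 : ℝ) * F (D (0, e)) = ∑ p : Fin (n + 1), F (D (0, e)) := by simp
            rw [mul_sub, ← hgs, this, ← sum_sub_distrib]
            refine (abs_sum_le_sum_abs _ _).trans ?_
            refine (sum_le_sum (fun p _ => (abs_sub_comm _ _).trans_le (h0 p))).trans ?_
            simp
          rw [abs_mul, abs_of_pos hn] at h1
          exact le_of_mul_le_mul_left h1 hn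
        have h4 : ∀ p ∈ (univ : Finset (Fin (n + 1))), (F (D (p, e)) - g e) ^ 2 ≤ 16 := by
          intro p _
          have := abs_le.1 (h0 p)
          have := abs_le.1 h3
          nlinarith
        have h5 := sum_le_sum h4
        simp at h5
        linarith
      refine (sum_le_sum (fun e _ => key e)).trans ?_
      rw [sum_add_distrib, ← mul_sum (s := univ) (f := fun e => (g e - m) ^ 2)]
      simp only [sum_const, card_univ, Fintype.card_perm, Fintype.card_fin, nsmul_eq_mul]
      have : (n + 1) * ∑ e, (g e - m) ^ 2 ≤ (n + 1) * (16 * n * n.factorial) := by gcongr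
      rw [Nat.factorial_succ]; push_cast
      nlinarith

open Classical in
/-- Chebyshev -/
lemma cheb {n : ℕ} (F : Equiv.Perm (Fin n) → ℝ) (hF : ∀ σ x y, |F (σ * Equiv.swap x y) - F σ| ≤ 2) (m : ℝ)
    (hm : ∑ σ, F σ = n.factorial * m) (t : ℝ) (ht : 0 < t) :
    ((univ.filter (fun σ => t ≤ |F σ - m|)).card : ℝ) ≤ 16 * n * n.factorial / t ^ 2 := by
  obtain ⟨m', h1, h2⟩ := conc n F hF
  have : m' = m := by
    have h0 : (n.factorial : ℝ) ≠ 0 := by positivity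
    exact mul_left_cancel₀ h0 (h1.symm.trans hm)
  subst this
  rw [le_div_iff₀ (by positivity)]
  refine le_trans ?_ h2
  rw [card_filter]
  push_cast
  rw [sum_mul]
  apply sum_le_sum
  intro σ _
  split_ifs with h
  · rw [← sq_abs (F σ - m')]; nlinarith [abs_nonneg (F σ - m')]
  · simp; positivity

end RS
end

noncomputable section
namespace RS
open Finset Equiv.Perm

def Tr {n : ℕ} (σ : Equiv.Perm (Fin n)) (T : Finset (Fin n)) : Prop := ∀ x, ∃ y ∈ T, σ.SameCycle y x

def Tv {n : ℕ} (σ : Equiv.Perm (Fin n)) : Prop := ∀ x y, σ.SameCycle x y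

lemma same_of_step {α : Type*} {σ σ' : Equiv.Perm α} (h : ∀ a, σ'.SameCycle a (σ a)) {a b : α}
    (hab : σ.SameCycle a b) : σ'.SameCycle a b := by
  obtain ⟨k, rfl⟩ := hab
  have hn : ∀ (k : ℕ) a, σ'.SameCycle a ((σ ^ k) a) := by
    intro k
    induction k with
    | zero => intro a; simpa using SameCycle.refl _ _
    | succ k ih => intro a; rw [pow_succ', Equiv.Perm.mul_apply]; exact (ih a).trans (h _)
  rcases Int.eq_nat_or_neg k with ⟨m, rfl | rfl⟩
  · simpa using hn m a
  · have := hn m ((σ ^ (-(m : ℤ))) a)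
    rw [← zpow_natCast, ← Equiv.Perm.mul_apply, ← zpow_add] at this
    simp only [add_neg_cancel, zpow_zero, Equiv.Perm.one_apply] at this
    exact this.symm

lemma merge {n : ℕ} (σ : Equiv.Perm (Fin n)) (x y : Fin n) (h : ¬ σ.SameCycle x y) :
    (σ * Equiv.swap x y).SameCycle x y ∧ ∀ a b, σ.SameCycle a b → (σ * Equiv.swap x y).SameCycle a b := by
  set σ' := σ * Equiv.swap x y with hs
  have e1 : σ' x = σ y := by simp [hs]
  have e2 : σ' y = σ x := by simp [hs]
  have e3 : ∀ z, z ≠ x → z ≠ y → σ' z = σ z := by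
    intro z h1 h2; simp [hs, Equiv.swap_apply_of_ne_of_ne h1 h2]
  have st : ∀ a, σ'.SameCycle a (σ' a) := fun a => ⟨1, by simp⟩
  have h1 : ∀ k : ℕ, σ'.SameCycle x ((σ ^ (k + 1)) y) := by
    intro k
    induction k with
    | zero => simp only [zero_add, pow_one]; rw [← e1]; exact st x
    | succ k ih =>
      rw [pow_succ', Equiv.Perm.mul_apply]
      by_cases hy : (σ ^ (k + 1)) y = y
      · rw [hy, ← e1]; exact st x
      · rw [← e3 _ _ hy]
        · exact ih.trans (st _)
        · intro hx
          exact h (SameCycle.symm ⟨((k + 1 : ℕ) : ℤ), by rw [zpow_natCast]; exact hx⟩)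
  have hxy : σ'.SameCycle x y := by
    have hpos := orderOf_pos σ
    have := h1 (orderOf σ - 1)
    rw [Nat.sub_add_cancel hpos, pow_orderOf_eq_one] at this
    simpa using this
  refine ⟨hxy, fun a b hab => same_of_step ?_ hab⟩
  intro a
  by_cases hax : a = x
  · subst hax; rw [← e2]; exact hxy.trans (st y)
  · by_cases hay : a = y
    · subst hay; rw [← e1]; exact hxy.symm.trans (st x)
    · rw [← e3 a hax hay]; exact st a

lemma exists_tv {n : ℕ} : ∀ (t : ℕ) (σ : Equiv.Perm (Fin n)) (T : Finset (Fin n)), T.card ≤ t → Tr σ T →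
    ∃ c : Equiv.Perm (Fin n), Tv c ∧ ∃ D : Finset (Fin n), D.card ≤ 2 * t ∧ ∀ i, i ∉ D → σ i = c i := by
  intro t
  induction t with
  | zero =>
    intro σ T hT h
    refine ⟨σ, ?_, ∅, by simp, by simp⟩
    intro x
    obtain ⟨y, hy, _⟩ := h x
    have : T = ∅ := by simpa using hT
    simp [this] at hy
  | succ t ih =>
    intro σ T hT h
    by_cases h1 : T.card ≤ 1
    · refine ⟨σ, ?_, ∅, by simp, by simp⟩
      intro x y
      obtain ⟨a, ha, hax⟩ := h x
      obtain ⟨b, hb, hby⟩ := h y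
      have := card_le_one.1 h1 a ha b hb
      subst this
      exact hax.symm.trans hby
    · obtain ⟨x, hx, y, hy, hxy⟩ := one_lt_card.1 (by omega : 1 < T.card)
      have hc : (T.erase x).card ≤ t := by rw [card_erase_of_mem hx]; omega
      have key : ∀ σ' : Equiv.Perm (Fin n), σ'.SameCycle x y → (∀ a b, σ.SameCycle a b → σ'.SameCycle a b) →
          Tr σ' (T.erase x) := by
        intro σ' h2 h3 z
        obtain ⟨a, ha, haz⟩ := h z
        by_cases hax : a = x
        · subst hax; exact ⟨y, mem_erase.2 ⟨hxy.symm, hy⟩, h2.symm.trans (h3 _ _ haz)⟩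
        · exact ⟨a, mem_erase.2 ⟨hax, ha⟩, h3 _ _ haz⟩
      by_cases hs : σ.SameCycle x y
      · obtain ⟨c, hc1, D, hD, hD'⟩ := ih σ _ hc (key σ hs (fun _ _ h => h))
        exact ⟨c, hc1, D, by omega, hD'⟩
      · obtain ⟨m1, m2⟩ := merge σ x y hs
        obtain ⟨c, hc1, D, hD, hD'⟩ := ih _ _ hc (key _ m1 m2)
        refine ⟨c, hc1, D ∪ {x, y}, ?_, ?_⟩
        · have := card_union_le D {x, y}
          have := card_le_two (a := x) (b := y)
          omega
        · intro i hi
          simp only [mem_union, mem_insert, mem_singleton, not_or] at hi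
          rw [← hD' i hi.1, Equiv.Perm.mul_apply, Equiv.swap_apply_of_ne_of_ne hi.2.1 hi.2.2]

lemma tv_conj {n : ℕ} (c c' : Equiv.Perm (Fin n)) (h : Tv c) (h' : Tv c') : ∃ g, g * c * g⁻¹ = c' := by
  by_cases hn : n ≤ 1
  · have : Subsingleton (Fin n) := by
      rw [← Fintype.card_le_one_iff_subsingleton]; simpa using hn
    exact ⟨1, Subsingleton.elim _ _⟩
  · have hN : Nontrivial (Fin n) := Fin.nontrivial_iff_two_le.2 (by omega)
    have hfix : ∀ c : Equiv.Perm (Fin n), Tv c → ∀ x, c x ≠ x := by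
      intro c hc x hx
      obtain ⟨y, hy⟩ := exists_ne x
      obtain ⟨k, hk⟩ := hc x y
      rw [zpow_apply_eq_self_of_apply_eq_self hx] at hk
      exact hy hk.symm
    have hcyc : ∀ c : Equiv.Perm (Fin n), Tv c → c.IsCycle ∧ c.support = univ := by
      intro c hc
      refine ⟨⟨⟨0, by omega⟩, hfix c hc _, fun y _ => hc _ y⟩, ?_⟩
      ext x; simp [hfix c hc x]
    have := (hcyc c h).1.isConj (hcyc c' h').1 (by rw [(hcyc c h).2, (hcyc c' h').2])
    rwa [isConj_iff] at this

lemma exists_tr {n : ℕ} (σ : Equiv.Perm (Fin n)) : ∃ T, Tr σ T ∧ T.card ≤ numCycles σ := by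
  classical
  have hch : ∀ c : Equiv.Perm (Fin n), ∃ x : Option (Fin n), c ∈ σ.cycleFactorsFinset → ∃ y, x = some y ∧ y ∈ c.support := by
    intro c
    by_cases hc : c ∈ σ.cycleFactorsFinset
    · have h1 := (mem_cycleFactorsFinset_iff.1 hc).1
      obtain ⟨y, hy, _⟩ := h1
      exact ⟨some y, fun _ => ⟨y, rfl, by simpa using hy⟩⟩
    · exact ⟨none, fun h => absurd h hc⟩
  choose r hr using hch
  refine ⟨(σ.cycleFactorsFinset.image r).eraseNone ∪ univ.filter (fun x => σ x = x), ?_, ?_⟩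
  · intro x
    by_cases hx : σ x = x
    · exact ⟨x, by simp [hx], SameCycle.refl _ _⟩
    · have hm : σ.cycleOf x ∈ σ.cycleFactorsFinset := cycleOf_mem_cycleFactorsFinset_iff.2 (by simpa using hx)
      obtain ⟨y, h1, h2⟩ := hr _ hm
      refine ⟨y, ?_, ?_⟩
      · simp only [mem_union, mem_eraseNone, mem_image]
        left; exact ⟨_, hm, h1⟩
      · rw [mem_support_cycleOf_iff] at h2
        exact h2.1.symm
  · refine (card_union_le _ _).trans ?_
    unfold numCycles
    have h1 : ((σ.cycleFactorsFinset.image r).eraseNone).card ≤ σ.cycleFactorsFinset.card := by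
      refine le_trans ?_ (card_image_le (f := r))
      rw [← card_map Function.Embedding.some, map_some_eraseNone]
      exact card_le_card (erase_subset _ _)
    have h2 : σ.cycleType.card = σ.cycleFactorsFinset.card := by
      rw [cycleType_def]; simp
    omega

def aH (n : ℕ) : ℝ := ∑ i ∈ range n, 1 / ((i : ℝ) + 1)

lemma unif_tr : ∀ n : ℕ, ∃ t : Equiv.Perm (Fin n) → ℕ, (∀ σ, ∃ T, Tr σ T ∧ T.card ≤ t σ) ∧
    ∑ σ, (t σ : ℝ) ≤ n.factorial * aH n := by
  intro n
  induction n with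
  | zero => refine ⟨fun _ => 0, fun σ => ⟨∅, fun x => x.elim0, by simp⟩, by simp [aH]⟩
  | succ n ih =>
    obtain ⟨t, h1, h2⟩ := ih
    set D := (Equiv.Perm.decomposeFin (n := n)) with hD
    refine ⟨fun σ => t (D σ).2 + if (D σ).1 = 0 then 1 else 0, ?_, ?_⟩
    · intro σ
      obtain ⟨⟨p, e⟩, rfl⟩ := D.symm.surjective σ
      simp only [Equiv.apply_symm_apply]
      obtain ⟨T, hT, hc⟩ := h1 e
      set s := D.symm (p, e) with hs
      have s0 : s 0 = p := by simp [hs, hD]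
      have s1 : ∀ x : Fin n, s x.succ = Equiv.swap 0 p (e x).succ := by intro x; simp [hs, hD]
      have st : ∀ a, s.SameCycle a (s a) := fun a => ⟨1, by simp⟩
      have step : ∀ a : Fin n, s.SameCycle a.succ (e a).succ := by
        intro a
        by_cases hp : (e a).succ = p
        · have : s a.succ = 0 := by rw [s1, hp]; simp
          have h3 := st a.succ
          rw [this] at h3
          have h4 := st 0
          rw [s0, ← hp] at h4
          exact h3.trans h4
        · have : s a.succ = (e a).succ := by
            rw [s1, Equiv.swap_apply_of_ne_of_ne (Fin.succ_ne_zero _) hp]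
          rw [← this]; exact st _
      have sc : ∀ a b : Fin n, e.SameCycle a b → s.SameCycle a.succ b.succ := by
        intro a b hab
        obtain ⟨k, _, _, rfl⟩ := hab.exists_pow_eq''
        have : ∀ k : ℕ, s.SameCycle a.succ ((e ^ k) a).succ := by
          intro k
          induction k with
          | zero => simpa using SameCycle.refl _ _
          | succ k ih => rw [pow_succ', Equiv.Perm.mul_apply]; exact ih.trans (step _)
        exact this _
      by_cases hp : p = 0
      · refine ⟨insert 0 (T.image Fin.succ), ?_, ?_⟩
        · intro x
          refine Fin.cases ⟨0, by simp, SameCycle.refl _ _⟩ (fun x => ?_) x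
          obtain ⟨y, hy, hyx⟩ := hT x
          exact ⟨y.succ, by simp [hy], sc _ _ hyx⟩
        · simp only [hp, if_true]
          have := card_insert_le (0 : Fin (n + 1)) (T.image Fin.succ)
          have h3 : (T.image Fin.succ).card ≤ T.card := card_image_le
          omega
      · refine ⟨T.image Fin.succ, ?_, ?_⟩
        · have hsucc : ∀ x : Fin n, ∃ y ∈ T.image Fin.succ, s.SameCycle y x.succ := by
            intro x
            obtain ⟨y, hy, hyx⟩ := hT x
            exact ⟨y.succ, by simp [hy], sc _ _ hyx⟩
          intro x
          refine Fin.cases ?_ (fun x => hsucc x) x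
          obtain ⟨q, hq⟩ := Fin.exists_succ_eq_of_ne_zero hp
          obtain ⟨y, hy, hyx⟩ := hsucc q
          refine ⟨y, hy, hyx.trans ?_⟩
          have := st 0
          rw [s0, ← hq] at this
          exact this.symm
        · have h3 : (T.image Fin.succ).card ≤ T.card := card_image_le
          omega
    · rw [← D.symm.sum_comp, Fintype.sum_prod_type_right]
      simp only [Equiv.apply_symm_apply, Nat.cast_add, Nat.cast_ite, Nat.cast_one, Nat.cast_zero, sum_add_distrib]
      simp only [sum_const, card_univ, Fintype.card_fin, Fintype.card_perm, sum_ite_eq', mem_univ, if_true, nsmul_eq_mul, mul_one]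
      rw [← mul_sum, Nat.factorial_succ, aH, sum_range_succ]
      have : ((n + 1 : ℕ) : ℝ) * ∑ σ, (t σ : ℝ) ≤ ((n + 1 : ℕ) : ℝ) * (n.factorial * aH n) := by gcongr
      rw [aH] at this
      push_cast at this ⊢
      have h0 : ((n : ℝ) + 1) * (1 / ((n : ℝ) + 1)) = 1 := by field_simp
      calc _ ≤ ((n : ℝ) + 1) * (n.factorial * ∑ i ∈ range n, 1 / ((i : ℝ) + 1)) + n.factorial := by simpa using this
        _ = ((n : ℝ) + 1) * (n.factorial * ∑ i ∈ range n, 1 / ((i : ℝ) + 1)) + n.factorial * (((n : ℝ) + 1) * (1 / ((n : ℝ) + 1))) := by rw [h0, mul_one]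
        _ = _ := by ring

lemma aH_lim : Filter.Tendsto (fun n : ℕ => (n : ℝ)⁻¹ * aH n) Filter.atTop (nhds 0) :=
  Filter.Tendsto.cesaro tendsto_one_div_add_atTop_nhds_zero_nat

end RS
end

noncomputable section
namespace RS
open Finset Equiv.Perm

def LP {n : ℕ} (F : Equiv.Perm (Fin n) → ℝ) : Prop :=
  ∀ σ τ (D : Finset (Fin n)), (∀ i, i ∉ D → σ i = τ i) → F σ ≤ F τ + D.card

lemma LP.swap {n : ℕ} {F : Equiv.Perm (Fin n) → ℝ} (hF : LP F) (σ : Equiv.Perm (Fin n)) (x y : Fin n) :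
    |F (σ * Equiv.swap x y) - F σ| ≤ 2 := by
  have hc : ((({x, y} : Finset (Fin n)).card : ℕ) : ℝ) ≤ 2 := by exact_mod_cast card_le_two
  have hD : ∀ i, i ∉ ({x, y} : Finset (Fin n)) → (σ * Equiv.swap x y) i = σ i := by
    intro i hi
    simp only [mem_insert, mem_singleton, not_or] at hi
    rw [Equiv.Perm.mul_apply, Equiv.swap_apply_of_ne_of_ne hi.1 hi.2]
  have h1 := hF _ _ _ hD
  have h2 := hF _ _ _ (fun i hi => (hD i hi).symm)
  rw [abs_le]
  constructor <;> linarith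

open Classical in
/-- number of `ρ` with `t ≤ |F (ρ σ ρ⁻¹) - m|` -/
def W {n : ℕ} (F : Equiv.Perm (Fin n) → ℝ) (m t : ℝ) (σ : Equiv.Perm (Fin n)) : ℝ :=
  ∑ ρ : Equiv.Perm (Fin n), if t ≤ |F (ρ * σ * ρ⁻¹) - m| then 1 else 0

lemma W_mono {n : ℕ} (F : Equiv.Perm (Fin n) → ℝ) (m : ℝ) {s t : ℝ} (h : s ≤ t) (σ : Equiv.Perm (Fin n)) :
    W F m t σ ≤ W F m s σ := by
  apply sum_le_sum
  intro ρ _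
  split_ifs with h1 h2 h2
  · rfl
  · exact absurd (h.trans h1) h2
  · norm_num
  · rfl

lemma W_nonneg {n : ℕ} (F : Equiv.Perm (Fin n) → ℝ) (m t : ℝ) (σ : Equiv.Perm (Fin n)) : 0 ≤ W F m t σ := by
  apply sum_nonneg
  intro ρ _
  split_ifs <;> norm_num

lemma W_le {n : ℕ} (F : Equiv.Perm (Fin n) → ℝ) (m t : ℝ) (σ : Equiv.Perm (Fin n)) : W F m t σ ≤ n.factorial := by
  calc W F m t σ ≤ ∑ ρ : Equiv.Perm (Fin n), (1 : ℝ) := by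
        apply sum_le_sum
        intro ρ _
        split_ifs <;> norm_num
    _ = _ := by simp [Fintype.card_perm]

lemma W_conj {n : ℕ} (F : Equiv.Perm (Fin n) → ℝ) (m t : ℝ) (σ g : Equiv.Perm (Fin n)) :
    W F m t (g * σ * g⁻¹) = W F m t σ := by
  have e := Equiv.sum_comp (Equiv.mulRight g) (fun ρ => if t ≤ |F (ρ * σ * ρ⁻¹) - m| then (1 : ℝ) else 0)
  refine Eq.trans ?_ (e.trans ?_)
  · apply sum_congr rfl
    intro ρ _
    have h : ρ * (g * σ * g⁻¹) * ρ⁻¹ = (Equiv.mulRight g ρ) * σ * (Equiv.mulRight g ρ)⁻¹ := by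
      simp only [Equiv.coe_mulRight]; group
    rw [h]
  · rfl

lemma W_near {n : ℕ} {F : Equiv.Perm (Fin n) → ℝ} (hF : LP F) (m t : ℝ) (σ τ : Equiv.Perm (Fin n)) (D : Finset (Fin n))
    (hD : ∀ i, i ∉ D → σ i = τ i) (s : ℝ) (hs : (D.card : ℝ) ≤ s) : W F m (t + s) σ ≤ W F m t τ := by
  apply sum_le_sum
  intro ρ _
  have hc : ((D.image ρ).card : ℝ) ≤ s := le_trans (by exact_mod_cast card_image_le) hs
  have h : ∀ i, i ∉ D.image ρ → (ρ * σ * ρ⁻¹) i = (ρ * τ * ρ⁻¹) i := by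
    intro i hi
    simp only [Equiv.Perm.mul_apply]
    rw [hD]
    intro h
    exact hi (mem_image.2 ⟨_, h, by simp⟩)
  have h1 := hF _ _ _ h
  have h2 := hF _ _ _ (fun i hi => (h i hi).symm)
  split_ifs with h3 h4
  · rfl
  · exfalso
    apply h4
    have : |F (ρ * σ * ρ⁻¹) - m| ≤ |F (ρ * σ * ρ⁻¹) - F (ρ * τ * ρ⁻¹)| + |F (ρ * τ * ρ⁻¹) - m| := abs_sub_le _ _ _
    have h5 : |F (ρ * σ * ρ⁻¹) - F (ρ * τ * ρ⁻¹)| ≤ s := by rw [abs_le]; constructor <;> linarith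
    linarith
  · norm_num
  · rfl

lemma W_tv {n : ℕ} {F : Equiv.Perm (Fin n) → ℝ} (m t : ℝ) (c c' : Equiv.Perm (Fin n)) (h : Tv c) (h' : Tv c') :
    W F m t c = W F m t c' := by
  obtain ⟨g, rfl⟩ := tv_conj c c' h h'
  rw [W_conj]

lemma exists_tv_n (n : ℕ) : ∃ c : Equiv.Perm (Fin n), Tv c := by
  obtain ⟨c, hc, _⟩ := exists_tv (n := n) _ 1 univ le_rfl (fun x => ⟨x, by simp, SameCycle.refl _ _⟩)
  exact ⟨c, hc⟩

/-- bound for long cycles -/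
lemma W_cycle {n : ℕ} {F : Equiv.Perm (Fin n) → ℝ} (hF : LP F) (m : ℝ) (hm : ∑ σ, F σ = n.factorial * m)
    (c : Equiv.Perm (Fin n)) (hc : Tv c) (t s : ℝ) (ht : 0 < t) (hs : 0 < s) (hs2 : 4 * aH n ≤ s) :
    W F m (t + s) c ≤ 32 * n * n.factorial / t ^ 2 := by
  classical
  obtain ⟨τ, h1, h2⟩ := unif_tr n
  have hA : ∑ σ, W F m t σ ≤ n.factorial * (16 * n * n.factorial / t ^ 2) := by
    unfold W
    rw [sum_comm]
    have : ∀ ρ ∈ (univ : Finset (Equiv.Perm (Fin n))), ∑ σ, (if t ≤ |F (ρ * σ * ρ⁻¹) - m| then (1 : ℝ) else 0) ≤ 16 * n * n.factorial / t ^ 2 := by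
      intro ρ _
      have e := Equiv.sum_comp (MulAut.conj ρ).toEquiv (fun σ => if t ≤ |F σ - m| then (1 : ℝ) else 0)
      refine le_trans (le_of_eq (Eq.trans ?_ e)) ?_
      · rfl
      have := cheb F hF.swap m hm t ht
      rw [card_filter] at this
      push_cast at this
      exact this
    refine (sum_le_sum this).trans ?_
    simp [Fintype.card_perm]
  have hB : ∀ σ, W F m (t + s) c * (1 - 2 * τ σ / s) ≤ W F m t σ := by
    intro σ
    by_cases hτ : 2 * (τ σ : ℝ) ≤ s
    · obtain ⟨T, hT, hTc⟩ := h1 σ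
      obtain ⟨c', hc', D, hD, hD'⟩ := exists_tv _ σ T hTc hT
      have h3 : W F m (t + s) c ≤ W F m t σ := by
        rw [W_tv m _ c c' hc hc']
        refine W_near hF m t c' σ D (fun i hi => (hD' i hi).symm) s (le_trans ?_ hτ)
        exact_mod_cast hD
      refine le_trans (mul_le_of_le_one_right (W_nonneg _ _ _ _) ?_) h3
      have : 0 ≤ 2 * (τ σ : ℝ) / s := by positivity
      linarith
    · refine le_trans (mul_nonpos_of_nonneg_of_nonpos (W_nonneg _ _ _ _) ?_) (W_nonneg _ _ _ _)
      push Not at hτ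
      rw [sub_nonpos, le_div_iff₀ hs]; linarith
  have hC := sum_le_sum (fun σ (_ : σ ∈ (univ : Finset (Equiv.Perm (Fin n)))) => hB σ)
  rw [← mul_sum] at hC
  have hE : (n.factorial : ℝ) / 2 ≤ ∑ σ, (1 - 2 * (τ σ : ℝ) / s) := by
    rw [sum_sub_distrib]
    simp only [sum_const, card_univ, Fintype.card_perm, Fintype.card_fin, nsmul_eq_mul, mul_one]
    rw [← sum_div, ← mul_sum]
    have : 2 * ∑ σ, (τ σ : ℝ) / s ≤ n.factorial / 2 := by
      rw [← sum_div, ← mul_div_assoc, div_le_iff₀ hs]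
      have hf : (0 : ℝ) < n.factorial := by positivity
      nlinarith
    rw [← sum_div, ← mul_div_assoc] at this
    linarith
  have hf : (0 : ℝ) < n.factorial := by positivity
  have h5 : W F m (t + s) c * (n.factorial / 2) ≤ n.factorial * (16 * n * n.factorial / t ^ 2) :=
    (mul_le_mul_of_nonneg_left hE (W_nonneg _ _ _ _)).trans (hC.trans hA)
  have h6 : (n.factorial : ℝ) * (16 * n * n.factorial / t ^ 2) = (32 * n * n.factorial / t ^ 2) * (n.factorial / 2) := by ring
  rw [h6] at h5
  exact le_of_mul_le_mul_right h5 (by positivity)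

open Classical in
lemma permProb_eq {n : ℕ} (p : Equiv.Perm (Fin n) → ℝ) (P : Equiv.Perm (Fin n) → Prop) :
    permProb p P = ∑ σ, if P σ then p σ else 0 := by
  unfold permProb
  apply sum_congr rfl
  intro σ _
  rw [Set.indicator_apply]
  rfl

lemma prob_le {n : ℕ} (hn : 1 ≤ n) (p : Equiv.Perm (Fin n) → ℝ) (hpos : ∀ σ, 0 ≤ p σ) (hsum : ∑ σ, p σ = 1)
    (hinv : ∀ σ ρ : Equiv.Perm (Fin n), p (ρ⁻¹ * σ * ρ) = p σ)
    {F : Equiv.Perm (Fin n) → ℝ} (hF : LP F) (m : ℝ) (hm : ∑ σ, F σ = n.factorial * m) (δ : ℝ) (hδ : 0 < δ)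
    (ha : 4 * aH n ≤ δ * n) :
    permProb p (fun σ => 3 * δ * n ≤ |F σ - m|) ≤ 32 / (δ ^ 2 * n) + permProb p (fun σ => δ / 2 < (numCycles σ : ℝ) / n) := by
  classical
  have hn0 : (0 : ℝ) < n := by exact_mod_cast hn
  have hf : (0 : ℝ) < n.factorial := by positivity
  obtain ⟨c, hc⟩ := exists_tv_n n
  have hW := W_cycle hF m hm c hc (δ * n) (δ * n) (by positivity) (by positivity) ha
  have e1 : n.factorial * permProb p (fun σ => 3 * δ * n ≤ |F σ - m|) = ∑ σ, p σ * W F m (3 * δ * n) σ := by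
    have : ∀ ρ ∈ (univ : Finset (Equiv.Perm (Fin n))), ∑ σ, p σ * (if 3 * δ * n ≤ |F (ρ * σ * ρ⁻¹) - m| then 1 else 0) = permProb p (fun σ => 3 * δ * n ≤ |F σ - m|) := by
      intro ρ _
      have e := Equiv.sum_comp (MulAut.conj ρ).toEquiv (fun σ => if 3 * δ * n ≤ |F σ - m| then p σ else 0)
      simp only [MulEquiv.toEquiv_eq_coe, MulEquiv.coe_toEquiv, MulAut.conj_apply] at e
      rw [permProb_eq, ← e]
      apply sum_congr rfl
      intro σ _
      have := hinv σ ρ⁻¹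
      rw [inv_inv] at this
      rw [this]
      by_cases h : 3 * δ * n ≤ |F (ρ * σ * ρ⁻¹) - m| <;> simp [h]
    unfold W
    simp only [mul_sum]
    rw [sum_comm, sum_congr rfl this]
    simp [Fintype.card_perm]
  have e2 : ∀ σ, p σ * W F m (3 * δ * n) σ ≤ p σ * (32 * n * n.factorial / (δ * n) ^ 2) +
      n.factorial * (if δ / 2 < (numCycles σ : ℝ) / n then p σ else 0) := by
    intro σ
    have hq : 0 ≤ 32 * n * n.factorial / (δ * n) ^ 2 := by positivity
    split_ifs with h
    · have := mul_le_mul_of_nonneg_left (W_le F m (3 * δ * n) σ) (hpos σ)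
      have := mul_nonneg (hpos σ) hq
      linarith
    · rw [mul_zero, add_zero]
      apply mul_le_mul_of_nonneg_left _ (hpos σ)
      refine le_trans ?_ hW
      push Not at h
      rw [div_le_iff₀ hn0] at h
      obtain ⟨T, hT, hTc⟩ := exists_tr σ
      obtain ⟨c', hc', D, hD, hD'⟩ := exists_tv _ σ T hTc hT
      rw [W_tv m _ c c' hc hc', show 3 * δ * n = (δ * n + δ * n) + δ * n by ring]
      refine W_near hF m _ σ c' D hD' _ ?_
      have : (D.card : ℝ) ≤ 2 * numCycles σ := by exact_mod_cast hD
      linarith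
  have e3 := sum_le_sum (fun σ (_ : σ ∈ (univ : Finset (Equiv.Perm (Fin n)))) => e2 σ)
  rw [← e1, sum_add_distrib, ← sum_mul, hsum, one_mul, ← mul_sum, ← permProb_eq] at e3
  have e4 : 32 * n * n.factorial / (δ * n) ^ 2 = n.factorial * (32 / (δ ^ 2 * n)) := by
    field_simp
  rw [e4, ← mul_add] at e3
  exact le_of_mul_le_mul_left e3 hf

lemma permProb_nonneg {n : ℕ} {p : Equiv.Perm (Fin n) → ℝ} (hpos : ∀ σ, 0 ≤ p σ) (P : Equiv.Perm (Fin n) → Prop) :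
    0 ≤ permProb p P := by
  classical
  rw [permProb_eq]
  apply sum_nonneg
  intro σ _
  split_ifs
  · exact hpos σ
  · rfl

lemma permProb_mono {n : ℕ} {p : Equiv.Perm (Fin n) → ℝ} (hpos : ∀ σ, 0 ≤ p σ) {P Q : Equiv.Perm (Fin n) → Prop}
    (h : ∀ σ, P σ → Q σ) : permProb p P ≤ permProb p Q := by
  classical
  rw [permProb_eq, permProb_eq]
  apply sum_le_sum
  intro σ _
  by_cases h1 : P σ
  · simp [h1, h σ h1]
  · simp only [h1, if_false]; split_ifs
    · exact hpos σ
    · rfl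

open Filter Topology in
lemma main_conc (p : (n : ℕ) → Equiv.Perm (Fin n) → ℝ)
    (hpos : ∀ n, 1 ≤ n → ∀ σ, 0 ≤ p n σ)
    (hsum : ∀ n, 1 ≤ n → ∑ σ, p n σ = 1)
    (hinv : ∀ n, 1 ≤ n → ∀ σ ρ : Equiv.Perm (Fin n), p n (ρ⁻¹ * σ * ρ) = p n σ)
    (hcyc : ∀ ε : ℝ, 0 < ε → Tendsto (fun n => permProb (p n) fun σ => ε < (numCycles σ : ℝ) / n) atTop (𝓝 0))
    (F : (n : ℕ) → Equiv.Perm (Fin n) → ℝ) (hF : ∀ n, LP (F n)) (m : ℕ → ℝ) (hm : ∀ n, ∑ σ, F n σ = n.factorial * m n)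
    (δ : ℝ) (hδ : 0 < δ) : Tendsto (fun n => permProb (p n) fun σ => δ * n ≤ |F n σ - m n|) atTop (𝓝 0) := by
  have l1 : Tendsto (fun n : ℕ => 32 / ((δ / 3) ^ 2 * (n : ℝ)) + permProb (p n) (fun σ => (δ / 3) / 2 < (numCycles σ : ℝ) / n)) atTop (𝓝 0) := by
    rw [← add_zero (0 : ℝ)]
    refine Tendsto.add ?_ (hcyc _ (by positivity))
    exact tendsto_const_nhds.div_atTop (tendsto_natCast_atTop_atTop.const_mul_atTop (by positivity))
  have l2 := aH_lim.eventually (gt_mem_nhds (show (0 : ℝ) < δ / 3 / 4 by positivity))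
  refine tendsto_of_tendsto_of_tendsto_of_le_of_le' tendsto_const_nhds l1 ?_ ?_
  · filter_upwards [eventually_ge_atTop 1] with n hn
    exact permProb_nonneg (hpos n hn) _
  · filter_upwards [eventually_ge_atTop 1, l2] with n hn h
    have hn0 : (0 : ℝ) < n := by exact_mod_cast hn
    have h' : 4 * aH n ≤ δ / 3 * n := by
      rw [inv_mul_lt_iff₀ hn0] at h; linarith
    have := prob_le hn (p n) (hpos n hn) (hsum n hn) (hinv n hn) (hF n) (m n) (hm n) (δ / 3) (by positivity) h'
    rwa [show 3 * (δ / 3) * (n : ℝ) = δ * n by ring] at this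

end RS
end

noncomputable section
namespace RS
open Finset MeasureTheory Real

lemma Omega_eq (s : ℝ) : Omega s = (2 / π) * (s * arcsin s + √(1 - s ^ 2)) := by
  unfold Omega
  split_ifs with h
  · rfl
  · push Not at h
    have h1 : 1 - s ^ 2 ≤ 0 := by
      have := (one_le_sq_iff_one_le_abs s).2 h
      linarith
    rw [sqrt_eq_zero_of_nonpos h1, add_zero]
    have hp := pi_pos.ne'
    rcases le_abs.1 h with h2 | h2
    · rw [arcsin_of_one_le h2, abs_of_nonneg (by linarith)]
      field_simp
    · rw [arcsin_of_le_neg_one (by linarith), abs_of_nonpos (by linarith)]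
      field_simp

/-- the limiting density -/
def hh (u : ℝ) : ℝ := Omega (u / 2) - |u| / 2

lemma hh_cont : Continuous hh := by
  unfold hh
  simp only [Omega_eq]
  have := continuous_arcsin
  fun_prop

lemma hh_zero {u : ℝ} (h : 2 ≤ |u|) : hh u = 0 := by
  unfold hh Omega
  rw [if_neg]
  · rw [abs_div, abs_two, sub_self]
  · rw [abs_div, abs_two, not_lt, le_div_iff₀ two_pos]; linarith

lemma hh_even (u : ℝ) : hh (-u) = hh u := by
  unfold hh
  rw [abs_neg, Omega_eq, Omega_eq, neg_div, arcsin_neg]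
  ring_nf

lemma hh_sin {t : ℝ} (h0 : 0 ≤ t) (h1 : t ≤ π / 2) :
    hh (2 * sin t) = (2 / π) * (t * sin t + cos t) - sin t := by
  have hs := sin_nonneg_of_nonneg_of_le_pi h0 (by linarith [pi_pos])
  have hc := cos_nonneg_of_neg_pi_div_two_le_of_le (by linarith) h1
  unfold hh
  rw [Omega_eq, abs_of_nonneg (by positivity), mul_div_cancel_left₀ _ two_ne_zero,
    arcsin_sin (by linarith) h1, ← cos_sq', sqrt_sq hc]
  ring

lemma hh_nonneg (u : ℝ) : 0 ≤ hh u := by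
  wlog hu : 0 ≤ u generalizing u
  · rw [← hh_even]; exact this _ (by linarith)
  by_cases h : 2 ≤ |u|
  · rw [hh_zero h]
  push Not at h
  rw [abs_of_nonneg hu] at h
  have e : u = 2 * sin (arcsin (u / 2)) := by rw [sin_arcsin] <;> linarith
  have ht0 : 0 ≤ arcsin (u / 2) := arcsin_nonneg.2 (by linarith)
  rw [e, hh_sin ht0 (arcsin_le_pi_div_two _)]
  have ht1 := arcsin_le_pi_div_two (u / 2)
  generalize arcsin (u / 2) = t at e ht0 ht1
  have hp := pi_pos
  have key : (π / 2 - t) * sin t ≤ cos t := by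
    rcases ht0.eq_or_lt with h0 | h0
    · rw [← h0]; simp
    · have hs := sin_pos_of_pos_of_lt_pi h0 (by linarith)
      have := le_tan (x := π / 2 - t) (by linarith) (by linarith)
      rw [tan_eq_sin_div_cos, sin_pi_div_two_sub, cos_pi_div_two_sub, le_div_iff₀ hs] at this
      exact this
  have : 2 / π * (t * sin t + cos t) - sin t = 2 / π * (cos t - (π / 2 - t) * sin t) := by
    field_simp; ring
  rw [this]
  exact mul_nonneg (by positivity) (by linarith)

lemma wallis (j : ℕ) : ∫ x in (0)..(π / 2), sin x ^ (2 * j) = π / 2 * ((2 * j).factorial / (4 ^ j * (j.factorial : ℝ) ^ 2)) := by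
  induction j with
  | zero => simp
  | succ k ih =>
    rw [show 2 * (k + 1) = 2 * k + 2 by ring, integral_sin_pow, ih]
    simp only [sin_zero, cos_pi_div_two, mul_zero, sub_zero]
    rw [Nat.factorial_succ (2 * k + 1), Nat.factorial_succ (2 * k), Nat.factorial_succ k]
    push_cast
    field_simp
    ring

lemma moment (j : ℕ) : ∫ x in (0)..(π / 2), (2 * sin x) ^ (2 * j) * hh (2 * sin x) * (2 * cos x) =
    (2 * j).factorial / (2 * ((j + 1).factorial : ℝ) ^ 2) := by
  have hp := pi_pos
  have e1 : ∫ x in (0)..(π / 2), (2 * sin x) ^ (2 * j) * hh (2 * sin x) * (2 * cos x) =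
     ∫ x in (0)..(π / 2), (2 * sin x) ^ (2 * j) * ((2 / π) * (x * sin x + cos x) - sin x) * (2 * cos x) := by
    apply intervalIntegral.integral_congr
    intro x hx
    rw [Set.uIcc_of_le (by positivity)] at hx
    simp only
    rw [hh_sin hx.1 hx.2]
  rw [e1]
  set C : ℝ := (2 / π) / (2 * (2 * j + 1) * (2 * j + 2)) with hC
  have hd : ∀ x ∈ Set.uIcc 0 (π / 2), HasDerivAt (fun x => (2 * sin x) ^ (2 * j + 1) / (2 * j + 1) * ((2 / π) * (x * sin x + cos x) - sin x)
      + (1 - 2 / π * x) * ((2 * sin x) ^ (2 * j + 2) / (2 * (2 * j + 1) * (2 * j + 2))))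
      ((2 * sin x) ^ (2 * j) * ((2 / π) * (x * sin x + cos x) - sin x) * (2 * cos x) - C * (2 * sin x) ^ (2 * j + 2)) x := by
    intro x _
    have hs := (hasDerivAt_sin x).const_mul 2
    have hk := (((hasDerivAt_id x).mul (hasDerivAt_sin x)).add (hasDerivAt_cos x)).const_mul (2 / π) |>.sub (hasDerivAt_sin x)
    have h1 := ((hs.pow (2 * j + 1)).div_const (2 * j + 1)).mul hk
    have h2 := (((hasDerivAt_id x).const_mul (2 / π)).const_sub 1).mul ((hs.pow (2 * j + 2)).div_const (2 * (2 * j + 1) * (2 * j + 2)))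
    refine ((h1.add h2).congr_deriv ?_)
    simp only [hC, id, Pi.sub_apply, Pi.add_apply, Pi.mul_apply, Pi.pow_apply]
    push_cast
    have a1 : (2 * (j : ℝ) + 1) ≠ 0 := by positivity
    have a2 : (2 * (j : ℝ) + 2) ≠ 0 := by positivity
    field_simp
    ring
  have e2 := intervalIntegral.integral_eq_sub_of_hasDerivAt hd (Continuous.intervalIntegrable (by fun_prop) _ _)
  rw [intervalIntegral.integral_sub (Continuous.intervalIntegrable (by fun_prop) _ _) (Continuous.intervalIntegrable (by fun_prop) _ _)] at e2
  have e3 : ∫ x in (0)..(π / 2), C * (2 * sin x) ^ (2 * j + 2) = C * 2 ^ (2 * j + 2) * ∫ x in (0)..(π / 2), sin x ^ (2 * (j + 1)) := by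
    rw [← intervalIntegral.integral_const_mul]
    apply intervalIntegral.integral_congr
    intro x _
    simp only
    rw [mul_pow, mul_assoc]; ring_nf
  rw [e3, wallis] at e2
  have e4 := sub_eq_iff_eq_add.1 e2
  rw [e4]
  simp only [sin_zero, sin_pi_div_two, cos_pi_div_two, hC]
  rw [show 2 * (j + 1) = 2 * j + 2 by ring, Nat.factorial_succ (2 * j + 1), Nat.factorial_succ (2 * j), show (2:ℝ) ^ (2 * j + 2) = 4 ^ (j + 1) by rw [show 2 * j + 2 = 2 * (j + 1) by ring, pow_mul]; norm_num]
  push_cast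
  field_simp
  ring

end RS
end

noncomputable section
namespace RS
open Finset MeasureTheory Real

lemma hh_int : Integrable hh := by
  apply hh_cont.integrable_of_hasCompactSupport
  apply HasCompactSupport.of_support_subset_isCompact (isCompact_Icc (a := (-2 : ℝ)) (b := 2))
  intro x hx
  by_contra h
  apply hx
  apply hh_zero
  rw [← not_lt]
  intro h2
  exact h (Set.mem_Icc.2 ⟨(abs_lt.1 h2).1.le, (abs_lt.1 h2).2.le⟩)

lemma hh_unif : UniformContinuous hh := by
  apply HasCompactSupport.uniformContinuous_of_continuous _ hh_cont
  apply HasCompactSupport.of_support_subset_isCompact (isCompact_Icc (a := (-2 : ℝ)) (b := 2))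
  intro x hx
  by_contra h
  apply hx
  apply hh_zero
  rw [← not_lt]
  intro h2
  exact h (Set.mem_Icc.2 ⟨(abs_lt.1 h2).1.le, (abs_lt.1 h2).2.le⟩)

lemma cos_int (θ : ℝ) : HasSum (fun j : ℕ => (-(θ ^ 2)) ^ j / ((j + 1).factorial : ℝ) ^ 2)
    (2 * ∫ u in (0)..2, hh u * cos (θ * u)) := by
  have e1 : ∫ u in (0)..2, hh u * cos (θ * u) = ∫ x in (0)..(π / 2), hh (2 * sin x) * cos (θ * (2 * sin x)) * (2 * cos x) := by
    have := intervalIntegral.integral_comp_mul_deriv (a := 0) (b := π / 2) (f := fun x => 2 * sin x) (f' := fun x => 2 * cos x)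
      (g := fun u => hh u * cos (θ * u)) (fun x _ => (hasDerivAt_sin x).const_mul 2) (by fun_prop) (by have := hh_cont; fun_prop)
    simp only [Function.comp_def, sin_zero, mul_zero, sin_pi_div_two, mul_one] at this
    exact this.symm
  rw [e1]
  have h2 : HasSum (fun j : ℕ => ∫ x in (0)..(π / 2), (-(θ ^ 2)) ^ j / (2 * j).factorial * ((2 * sin x) ^ (2 * j) * hh (2 * sin x) * (2 * cos x)))
      (∫ x in (0)..(π / 2), hh (2 * sin x) * cos (θ * (2 * sin x)) * (2 * cos x)) := by
    obtain ⟨B, hB⟩ : ∃ B, ∀ x, ‖hh x‖ ≤ B := by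
      apply hh_cont.bounded_above_of_compact_support
      apply HasCompactSupport.of_support_subset_isCompact (isCompact_Icc (a := (-2 : ℝ)) (b := 2))
      intro x hx
      by_contra h
      apply hx
      apply hh_zero
      rw [← not_lt]
      intro h2
      exact h (Set.mem_Icc.2 ⟨(abs_lt.1 h2).1.le, (abs_lt.1 h2).2.le⟩)
    apply intervalIntegral.hasSum_integral_of_dominated_convergence (fun j _ => (2 * |θ|) ^ (2 * j) / (2 * j).factorial * (2 * B))
    · intro j
      apply Continuous.aestronglyMeasurable
      have := hh_cont
      fun_prop
    · intro j
      filter_upwards with x _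
      have hB0 : 0 ≤ B := (norm_nonneg _).trans (hB 0)
      simp only [norm_mul, norm_div, norm_pow, norm_neg]
      simp only [Real.norm_eq_abs, Nat.abs_cast, abs_two]
      have h1 := abs_sin_le_one x
      have h3 := abs_cos_le_one x
      have h4 := hB (2 * sin x)
      rw [Real.norm_eq_abs] at h4
      calc (|θ| ^ 2) ^ j / ((2 * j).factorial : ℝ) * ((2 * |sin x|) ^ (2 * j) * |hh (2 * sin x)| * (2 * |cos x|))
          ≤ (|θ| ^ 2) ^ j / ((2 * j).factorial : ℝ) * ((2 * 1) ^ (2 * j) * B * (2 * 1)) := by gcongr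
        _ = _ := by rw [mul_pow, ← pow_mul]; ring
    · filter_upwards with x _
      apply Summable.mul_right
      exact (Real.summable_pow_div_factorial (2 * |θ|)).comp_injective (i := fun j : ℕ => 2 * j) (fun a b h => by simpa using h)
    · simp
    · filter_upwards with x _
      have := ((Real.hasSum_cos (θ * (2 * sin x))).mul_left (hh (2 * sin x) * (2 * cos x)))
      convert! this using 1
      · funext j
        rw [mul_pow θ, pow_mul θ, neg_pow]; ring
      · ring
  convert! h2.mul_left 2 using 1
  funext j
  rw [intervalIntegral.integral_const_mul, moment]
  field_simp

open Complex in
lemma char_h (θ : ℝ) : ∫ u : ℝ, hh u • cexp (θ * u * I) = ∑' j : ℕ, (-((θ : ℂ) ^ 2)) ^ j / (((j + 1).factorial : ℕ) : ℂ) ^ 2 := by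
  have hc : Continuous fun u : ℝ => hh u • cexp (θ * u * I) := by
    have := hh_cont
    fun_prop
  have e1 : ∫ u : ℝ, hh u • cexp (θ * u * I) = ∫ u in (-2)..2, hh u • cexp (θ * u * I) := by
    rw [intervalIntegral.integral_of_le (by norm_num)]
    symm
    apply setIntegral_eq_integral_of_forall_compl_eq_zero
    intro x hx
    rw [hh_zero, zero_smul]
    rw [← not_lt]
    intro h2
    exact hx ⟨(abs_lt.1 h2).1, (abs_lt.1 h2).2.le⟩
  rw [e1, ← intervalIntegral.integral_add_adjacent_intervals (b := 0) (hc.intervalIntegrable _ _) (hc.intervalIntegrable _ _)]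
  have e2 : ∫ u in (-2 : ℝ)..0, hh u • cexp (θ * u * I) = ∫ u in (0 : ℝ)..2, hh u • cexp (-(θ * u * I)) := by
    have := intervalIntegral.integral_comp_neg (a := (0 : ℝ)) (b := 2) (fun u : ℝ => hh u • cexp (θ * u * I))
    rw [neg_zero] at this
    rw [← this]
    apply intervalIntegral.integral_congr
    intro u _
    simp only [hh_even]
    push_cast
    ring_nf
  rw [e2, ← intervalIntegral.integral_add (Continuous.intervalIntegrable (by have := hh_cont; fun_prop) _ _) (hc.intervalIntegrable _ _)]
  have e3 : ∫ u in (0 : ℝ)..2, (hh u • cexp (-(θ * u * I)) + hh u • cexp (θ * u * I)) = ((2 * ∫ u in (0)..2, hh u * Real.cos (θ * u) : ℝ) : ℂ) := by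
    rw [← intervalIntegral.integral_const_mul, ← intervalIntegral.integral_ofReal]
    apply intervalIntegral.integral_congr
    intro u _
    simp only [real_smul]
    push_cast
    rw [Complex.cos]
    ring_nf
  rw [e3, ← (cos_int θ).tsum_eq, ofReal_tsum]
  congr 1
  funext j
  push_cast
  rfl

/-- the limit law -/
def nu : Measure ℝ := volume.withDensity (fun u => ENNReal.ofReal (hh u))

lemma nu_apply {s : Set ℝ} (hs : MeasurableSet s) : nu s = ENNReal.ofReal (∫ u in s, hh u) := by
  unfold nu
  rw [withDensity_apply _ hs, ofReal_integral_eq_lintegral_ofReal hh_int.integrableOn (Filter.Eventually.of_forall hh_nonneg)]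

lemma hh_total : ∫ u, hh u = 1 := by
  have := char_h 0
  simp only [Complex.ofReal_zero, zero_mul, Complex.exp_zero, Complex.real_smul, mul_one] at this
  rw [integral_complex_ofReal] at this
  rw [tsum_eq_single 0] at this
  · simp at this; exact_mod_cast this
  · intro j hj
    simp [hj]

instance nu_prob : IsProbabilityMeasure nu := ⟨by
  rw [nu_apply MeasurableSet.univ, setIntegral_univ, hh_total, ENNReal.ofReal_one]⟩

lemma nu_char (θ : ℝ) : charFun nu θ = ∑' j : ℕ, (-((θ : ℂ) ^ 2)) ^ j / (((j + 1).factorial : ℕ) : ℂ) ^ 2 := by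
  rw [charFun_apply_real, ← char_h]
  unfold nu
  rw [integral_withDensity_eq_integral_toReal_smul (by have := hh_cont; fun_prop) (by simp)]
  apply integral_congr_ae
  filter_upwards with u
  rw [ENNReal.toReal_ofReal (hh_nonneg u)]

/-- limiting tail -/
def Ga (u : ℝ) : ℝ := nu.real (Set.Ioi u)

lemma Ga_anti : Antitone Ga := fun _ _ h => measureReal_mono (Set.Ioi_subset_Ioi h)

lemma Ga_sub {u v : ℝ} (h : u ≤ v) : Ga u - Ga v = ∫ x in u..v, hh x := by
  have e : ∀ w, Ga w = ∫ x in Set.Ioi w, hh x := by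
    intro w
    unfold Ga Measure.real
    rw [nu_apply measurableSet_Ioi, ENNReal.toReal_ofReal (setIntegral_nonneg measurableSet_Ioi (fun x _ => hh_nonneg x))]
  rw [e, e, intervalIntegral.integral_of_le h, ← Set.Ioc_union_Ioi_eq_Ioi h, setIntegral_union (Set.Ioc_disjoint_Ioi le_rfl) measurableSet_Ioi hh_int.integrableOn hh_int.integrableOn]
  ring

lemma Ga_left {u : ℝ} (h : u ≤ -2) : Ga u = 1 := by
  have h1 := Ga_sub (u := u) (v := 0)
  unfold Ga Measure.real
  rw [nu_apply measurableSet_Ioi, setIntegral_eq_integral_of_forall_compl_eq_zero, hh_total]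
  · simp
  · intro x hx
    apply hh_zero
    simp only [Set.mem_Ioi, not_lt] at hx
    rw [abs_of_nonpos (by linarith)]; linarith

lemma Ga_right {u : ℝ} (h : 2 ≤ u) : Ga u = 0 := by
  unfold Ga Measure.real
  rw [nu_apply measurableSet_Ioi, setIntegral_congr_fun (g := fun _ => 0) measurableSet_Ioi]
  · simp
  · intro x hx
    apply hh_zero
    simp only [Set.mem_Ioi] at hx
    rw [abs_of_nonneg (by linarith)]; linarith

end RS
end

noncomputable section
namespace RS
open Finset MeasureTheory Real Filter Topology

def qr (θ : ℝ) (n : ℕ) : ℝ := 2 * cos (θ / √n) - 2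

lemma sq_theta (θ : ℝ) {n : ℕ} (_hn : 1 ≤ n) : (θ / √n) ^ 2 = θ ^ 2 / n := by
  rw [div_pow, sq_sqrt (Nat.cast_nonneg n)]

lemma qr_abs (θ : ℝ) {n : ℕ} (hn : 1 ≤ n) : |qr θ n| ≤ θ ^ 2 / n := by
  unfold qr
  have h1 := one_sub_sq_div_two_le_cos (x := θ / √n)
  have h2 := cos_le_one (θ / √n)
  rw [sq_theta θ hn] at h1
  rw [abs_le]
  constructor <;> linarith

lemma qr_lim (θ : ℝ) : Tendsto (fun n : ℕ => (n : ℝ) * qr θ n) atTop (𝓝 (-(θ ^ 2))) := by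
  rw [tendsto_iff_norm_sub_tendsto_zero]
  have l : Tendsto (fun n : ℕ => (5 / 48 * θ ^ 4) / (n : ℝ)) atTop (𝓝 0) := tendsto_const_nhds.div_atTop tendsto_natCast_atTop_atTop
  refine squeeze_zero' (Eventually.of_forall fun n => norm_nonneg _) ?_ l
  obtain ⟨M, hM⟩ := exists_nat_ge (θ ^ 2)
  filter_upwards [eventually_ge_atTop 1, eventually_ge_atTop M] with n hn hnM
  have hn0 : (0 : ℝ) < n := by exact_mod_cast hn
  have hx : |θ / √n| ≤ 1 := by
    rw [← sq_le_one_iff_abs_le_one, sq_theta θ hn, div_le_one hn0]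
    exact hM.trans (by exact_mod_cast hnM)
  have hb := cos_bound hx
  have e4 : |θ / √n| ^ 4 = θ ^ 4 / n ^ 2 := by
    rw [show |θ / √n| ^ 4 = (|θ / √n| ^ 2) ^ 2 by ring, sq_abs, sq_theta θ hn]; ring
  rw [e4, sq_theta θ hn] at hb
  have : (n : ℝ) * qr θ n - -(θ ^ 2) = 2 * n * (cos (θ / √n) - (1 - θ ^ 2 / n / 2)) := by
    unfold qr; field_simp; ring
  rw [this, Real.norm_eq_abs, abs_mul, abs_of_pos (by positivity)]
  calc _ ≤ 2 * (n : ℝ) * (θ ^ 4 / n ^ 2 * (5 / 96)) := by gcongr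
    _ = _ := by field_simp; ring

lemma choose_lim (k : ℕ) : Tendsto (fun n : ℕ => (n.choose k : ℝ) * ((n : ℝ)⁻¹) ^ k) atTop (𝓝 (1 / (k.factorial : ℝ))) := by
  have l1 := ProbabilityTheory.tendsto_choose_mul_pow_atTop (r := 1) (p := fun n : ℕ => (n : ℝ)⁻¹) k (by
    apply tendsto_const_nhds.congr'
    filter_upwards [eventually_ge_atTop 1] with n hn
    have hn0 : (n : ℝ) ≠ 0 := by exact_mod_cast (by omega : n ≠ 0)
    exact (mul_inv_cancel₀ hn0).symm)
  rw [one_pow] at l1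
  exact l1

def sT (θ : ℝ) (n j : ℕ) : ℝ := (n.choose (j + 1) : ℝ) / (j + 1).factorial / n * qr θ n ^ j

lemma term_lim (θ : ℝ) (j : ℕ) : Tendsto (fun n : ℕ => sT θ n j) atTop
    (𝓝 ((-(θ ^ 2)) ^ j / ((j + 1).factorial : ℝ) ^ 2)) := by
  have l2 := ((qr_lim θ).pow j).mul ((choose_lim (j + 1)).div_const ((j + 1).factorial : ℝ))
  have e : (-(θ ^ 2)) ^ j * (1 / ((j + 1).factorial : ℝ) / (j + 1).factorial) = (-(θ ^ 2)) ^ j / ((j + 1).factorial : ℝ) ^ 2 := by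
    generalize ((j + 1).factorial : ℝ) = f
    rw [div_div, ← pow_two, mul_one_div]
  rw [e] at l2
  refine l2.congr' ?_
  filter_upwards [eventually_ge_atTop 1] with n hn
  have hn0 : (n : ℝ) ≠ 0 := by exact_mod_cast (by omega : n ≠ 0)
  have hf : ((j + 1).factorial : ℝ) ≠ 0 := by exact_mod_cast Nat.factorial_ne_zero _
  unfold sT
  generalize ((j + 1).factorial : ℝ) = f at hf
  generalize (n.choose (j + 1) : ℝ) = g
  generalize (n : ℝ) = x at hn0
  rw [mul_pow, inv_pow]
  field_simp
  ring

lemma term_bound (θ : ℝ) {n : ℕ} (hn : 1 ≤ n) (j : ℕ) : ‖sT θ n j‖ ≤ (θ ^ 2) ^ j / j.factorial := by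
  have hn0 : (0 : ℝ) < n := by exact_mod_cast hn
  unfold sT
  rw [norm_mul, norm_pow, norm_div, norm_div]
  simp only [Real.norm_eq_abs, Nat.abs_cast]
  have hc : (n.choose (j + 1) : ℝ) ≤ (n : ℝ) ^ (j + 1) / (j + 1).factorial := Nat.choose_le_pow_div (α := ℝ) (j + 1) n
  have hf : (1 : ℝ) ≤ (j + 1).factorial := by exact_mod_cast Nat.factorial_pos _
  have hf2 : ((j).factorial : ℝ) ≤ (j + 1).factorial := by exact_mod_cast Nat.factorial_le (Nat.le_succ j)
  have hf3 : (0 : ℝ) < j.factorial := by exact_mod_cast Nat.factorial_pos _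
  have hq := qr_abs θ hn
  generalize ((j + 1).factorial : ℝ) = f at *
  generalize (j.factorial : ℝ) = f' at *
  generalize (n.choose (j + 1) : ℝ) = g at *
  generalize qr θ n = q at *
  generalize (n : ℝ) = x at *
  calc g / f / x * |q| ^ j ≤ x ^ (j + 1) / f / 1 / x * (θ ^ 2 / x) ^ j := by gcongr
    _ = (θ ^ 2) ^ j / f := by rw [div_pow]; field_simp; ring
    _ ≤ _ := by gcongr

lemma series_lim (θ : ℝ) : Tendsto (fun n : ℕ => ∑ j ∈ range n, sT θ n j) atTop
    (𝓝 (∑' j : ℕ, (-(θ ^ 2)) ^ j / ((j + 1).factorial : ℝ) ^ 2)) := by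
  have h1 : Tendsto (fun n : ℕ => ∑' j : ℕ, sT θ n j) atTop
    (𝓝 (∑' j : ℕ, (-(θ ^ 2)) ^ j / ((j + 1).factorial : ℝ) ^ 2)) := by
    refine tendsto_tsum_of_dominated_convergence (bound := fun j => (θ ^ 2) ^ j / j.factorial) (Real.summable_pow_div_factorial _) (term_lim θ) ?_
    filter_upwards [eventually_ge_atTop 1] with n hn j
    exact term_bound θ hn j
  refine h1.congr ?_
  intro n
  apply tsum_eq_sum
  intro j hj
  unfold sT
  rw [Nat.choose_eq_zero_of_lt (by simp at hj; omega)]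
  simp

abbrev Bx (n : ℕ) := (_ : Equiv.Perm (Fin n)) × (_ : ℕ) × ℕ

def Sx (n : ℕ) : Finset (Bx n) := (univ : Finset (Equiv.Perm (Fin n))).sigma fun σ => (range n).sigma fun r => range (shape σ r)

def xi (n : ℕ) (x : Bx n) : ℝ := (((x.2.2 : ℤ) - (x.2.1 : ℤ) : ℤ) : ℝ) / √n

lemma Sx_sum {M : Type*} [AddCommMonoid M] (n : ℕ) (g : ℝ → M) : ∑ x ∈ Sx n, g (xi n x) =
    ∑ σ : Equiv.Perm (Fin n), ∑ r ∈ range n, ∑ c ∈ range (shape σ r), g ((((c : ℤ) - (r : ℤ) : ℤ) : ℝ) / √n) := by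
  unfold Sx
  rw [sum_sigma]
  apply sum_congr rfl
  intro σ _
  rw [sum_sigma]
  rfl

lemma Sx_card (n : ℕ) : (Sx n).card = n * n.factorial := by
  unfold Sx
  rw [card_sigma]
  simp only [card_sigma, card_range]
  rw [sum_congr rfl (fun σ _ => (shape_isP σ le_rfl).sum)]
  simp [Fintype.card_perm, mul_comm]

def mu (n : ℕ) : Measure ℝ := ((Sx n).card : ENNReal)⁻¹ • ∑ x ∈ Sx n, Measure.dirac (xi n x)

lemma mu_prob {n : ℕ} (hn : 1 ≤ n) : IsProbabilityMeasure (mu n) := by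
  constructor
  have : ((Sx n).card : ENNReal) ≠ 0 := by
    rw [Sx_card]
    have := Nat.factorial_pos n
    exact_mod_cast (by positivity : n * n.factorial ≠ 0)
  simp only [mu, Measure.smul_apply, Measure.coe_finsetSum, Finset.sum_apply, measure_univ, sum_const, nsmul_eq_mul, mul_one, smul_eq_mul]
  exact ENNReal.inv_mul_cancel this (by simp)

lemma mu_integral (n : ℕ) (g : ℝ → ℂ) : ∫ x, g x ∂(mu n) = ((n : ℂ) * n.factorial)⁻¹ * ∑ σ : Equiv.Perm (Fin n), ∑ r ∈ range n, ∑ c ∈ range (shape σ r), g ((((c : ℤ) - (r : ℤ) : ℤ) : ℝ) / √n) := by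
  unfold mu
  rw [integral_smul_measure, integral_finsetSum_measure, ← Sx_sum n g, Sx_card]
  · simp
  · intro i _
    exact integrable_dirac (by simp)

lemma mu_char (n : ℕ) (hn : 1 ≤ n) (θ : ℝ) : charFun (mu n) θ = ((∑ j ∈ range n, sT θ n j : ℝ) : ℂ) := by
  rw [charFun_apply_real, mu_integral]
  set g : ℤ → ℂ := fun c => Complex.exp (θ * ((c : ℝ) / √n : ℝ) * Complex.I) with hgd
  have e0 : ∀ σ : Equiv.Perm (Fin n), ∑ r ∈ range n, ∑ c ∈ range (shape σ r), Complex.exp (θ * (((((c : ℤ) - (r : ℤ) : ℤ) : ℝ) / √n : ℝ) : ℂ) * Complex.I) = Bg n g (shape σ) := by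
    intro σ
    rfl
  rw [sum_congr rfl (fun σ _ => e0 σ), planch le_rfl (Bg n g)]
  have := (Sq_eig (N := n) g (qr θ n) (by simp [hgd]) ?_ (le_refl n)).1
  · rw [this]
    have hn0 : (n : ℂ) ≠ 0 := by exact_mod_cast (by omega : n ≠ 0)
    have hf : (n.factorial : ℂ) ≠ 0 := by exact_mod_cast Nat.factorial_ne_zero n
    unfold sT
    push_cast
    rw [mul_inv, mul_assoc, inv_mul_cancel_left₀ hf, mul_sum]
    apply sum_congr rfl
    intro j _
    field_simp
  · intro c
    simp only [hgd, qr]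
    have e1 : (θ : ℂ) * (((((c + 1 : ℤ) : ℝ) / √n : ℝ)) : ℂ) * Complex.I = θ * (((c : ℝ) / √n : ℝ) : ℂ) * Complex.I + ((θ / √n : ℝ) : ℂ) * Complex.I := by
      push_cast; ring
    have e2 : (θ : ℂ) * (((((c - 1 : ℤ) : ℝ) / √n : ℝ)) : ℂ) * Complex.I = θ * (((c : ℝ) / √n : ℝ) : ℂ) * Complex.I + -((θ / √n : ℝ) : ℂ) * Complex.I := by
      push_cast; ring
    rw [e1, e2, Complex.exp_add, Complex.exp_add]
    push_cast
    rw [Complex.cos]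
    ring

def muP (n : ℕ) : ProbabilityMeasure ℝ := ⟨mu (n + 1), mu_prob (by omega)⟩
def nuP : ProbabilityMeasure ℝ := ⟨nu, nu_prob⟩

lemma mu_lim : Tendsto muP atTop (𝓝 nuP) := by
  apply ProbabilityMeasure.tendsto_of_tendsto_charFun
  intro θ
  change Tendsto (fun n => charFun (mu (n + 1)) θ) atTop (𝓝 (charFun nu θ))
  rw [nu_char]
  have h := (Complex.continuous_ofReal.tendsto _).comp ((tendsto_add_atTop_iff_nat 1).2 (series_lim θ))
  have e : ((∑' j : ℕ, (-(θ ^ 2)) ^ j / ((j + 1).factorial : ℝ) ^ 2 : ℝ) : ℂ) = ∑' j : ℕ, (-((θ : ℂ) ^ 2)) ^ j / (((j + 1).factorial : ℕ) : ℂ) ^ 2 := by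
    rw [Complex.ofReal_tsum]
    congr 1
    funext j
    push_cast
    rfl
  rw [e] at h
  refine h.congr ?_
  intro n
  rw [mu_char _ (by omega)]
  rfl

lemma mu_tail (u : ℝ) : Tendsto (fun n => (mu n).real (Set.Ioi u)) atTop (𝓝 (Ga u)) := by
  rw [← tendsto_add_atTop_iff_nat 1]
  have h := ProbabilityMeasure.tendsto_measure_of_null_frontier_of_tendsto' mu_lim (E := Set.Ioi u) (by
    rw [frontier_Ioi]
    change nu {u} = 0
    rw [nu_apply (measurableSet_singleton u)]
    simp)
  exact (ENNReal.tendsto_toReal (measure_ne_top nu _)).comp h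

def idx (u : ℝ) (n : ℕ) : ℤ := ⌊u * √n⌋

lemma mu_Ioi {n : ℕ} (hn : 1 ≤ n) (u : ℝ) : (n.factorial : ℝ) * (n * (mu n).real (Set.Ioi u)) = ∑ σ : Equiv.Perm (Fin n), (G n (idx u n) (shape σ) : ℝ) := by
  classical
  have hs : (0 : ℝ) < √n := by apply sqrt_pos.2; exact_mod_cast hn
  have e : (mu n).real (Set.Ioi u) = ((n : ℝ) * n.factorial)⁻¹ * ∑ x ∈ Sx n, (Set.Ioi u).indicator (fun _ => (1 : ℝ)) (xi n x) := by
    unfold mu Measure.real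
    simp only [Measure.smul_apply, Measure.coe_finsetSum, Finset.sum_apply, smul_eq_mul]
    rw [ENNReal.toReal_mul, ENNReal.toReal_sum]
    · rw [Sx_card]
      congr 1
      · simp
      · apply sum_congr rfl
        intro x _
        rw [Measure.dirac_apply' _ measurableSet_Ioi]
        simp only [Set.indicator_apply]
        split_ifs <;> simp
    · intro a _
      exact measure_ne_top _ _
  rw [e, Sx_sum n]
  have hn0 : (n : ℝ) ≠ 0 := by exact_mod_cast (by omega : n ≠ 0)
  have hf : (n.factorial : ℝ) ≠ 0 := by exact_mod_cast Nat.factorial_ne_zero n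
  rw [mul_inv, ← mul_assoc (n : ℝ), mul_inv_cancel_left₀ hn0, mul_inv_cancel_left₀ hf]
  apply sum_congr rfl
  intro σ _
  rw [← G_Bg]
  apply sum_congr rfl
  intro r _
  apply sum_congr rfl
  intro c _
  rw [Set.indicator_apply]
  have : (((c : ℤ) - (r : ℤ) : ℤ) : ℝ) / √n ∈ Set.Ioi u ↔ idx u n < (c : ℤ) - r := by
    rw [Set.mem_Ioi, lt_div_iff₀ hs, idx, Int.floor_lt]
  by_cases h : idx u n < (c : ℤ) - r
  · rw [if_pos h, if_pos (this.2 h)]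
  · rw [if_neg h, if_neg (fun h' => h (this.1 h'))]

end RS
end

noncomputable section
namespace RS
open Finset MeasureTheory Real Filter Topology

lemma G_LP (n : ℕ) (i : ℤ) : LP (fun σ : Equiv.Perm (Fin n) => (G n i (shape σ) : ℝ)) := by
  intro σ τ D h
  have := G_lip σ τ D h n i
  simp only
  exact_mod_cast this

lemma permProb_union {n : ℕ} {p : Equiv.Perm (Fin n) → ℝ} (hpos : ∀ σ, 0 ≤ p σ) {ι : Type*} (S : Finset ι) (P : ι → Equiv.Perm (Fin n) → Prop) :
    permProb p (fun σ => ∃ l ∈ S, P l σ) ≤ ∑ l ∈ S, permProb p (P l) := by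
  classical
  simp only [permProb_eq]
  rw [sum_comm]
  apply sum_le_sum
  intro σ _
  have h0 : ∀ l ∈ S, (0 : ℝ) ≤ if P l σ then p σ else 0 := by
    intro l _
    split_ifs
    · exact hpos σ
    · rfl
  by_cases h : ∃ l ∈ S, P l σ
  · rw [if_pos h]
    obtain ⟨l, hl, h2⟩ := h
    have := single_le_sum h0 hl
    rwa [if_pos h2] at this
  · rw [if_neg h]
    exact sum_nonneg h0

lemma permProb_compl {n : ℕ} (p : Equiv.Perm (Fin n) → ℝ) (hs : ∑ σ, p σ = 1) (P : Equiv.Perm (Fin n) → Prop) :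
    permProb p P = 1 - permProb p (fun σ => ¬ P σ) := by
  classical
  rw [permProb_eq, permProb_eq, eq_sub_iff_add_eq, ← sum_add_distrib, ← hs]
  apply sum_congr rfl
  intro σ _
  by_cases h : P σ <;> simp [h]

/-- the grid closeness event -/
def bad (n : ℕ) (u δ : ℝ) (σ : Equiv.Perm (Fin n)) : Prop := δ ≤ |(G n (idx u n) (shape σ) : ℝ) / n - Ga u|

lemma bad_prob (p : (n : ℕ) → Equiv.Perm (Fin n) → ℝ)
    (hpos : ∀ n, 1 ≤ n → ∀ σ, 0 ≤ p n σ)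
    (hsum : ∀ n, 1 ≤ n → ∑ σ, p n σ = 1)
    (hinv : ∀ n, 1 ≤ n → ∀ σ ρ : Equiv.Perm (Fin n), p n (ρ⁻¹ * σ * ρ) = p n σ)
    (hcyc : ∀ ε : ℝ, 0 < ε → Tendsto (fun n => permProb (p n) fun σ => ε < (numCycles σ : ℝ) / n) atTop (𝓝 0))
    (u δ : ℝ) (hδ : 0 < δ) : Tendsto (fun n => permProb (p n) (bad n u δ)) atTop (𝓝 0) := by
  have h1 := main_conc p hpos hsum hinv hcyc (fun n σ => (G n (idx u n) (shape σ) : ℝ)) (fun n => G_LP n _)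
    (fun n => (∑ σ : Equiv.Perm (Fin n), (G n (idx u n) (shape σ) : ℝ)) / n.factorial)
    (fun n => by
      have hf : (n.factorial : ℝ) ≠ 0 := by exact_mod_cast Nat.factorial_ne_zero n
      rw [mul_div_cancel₀ _ hf]) (δ / 2) (by positivity)
  have h2 := (Metric.tendsto_nhds.1 (mu_tail u)) (δ / 2) (by positivity)
  refine tendsto_of_tendsto_of_tendsto_of_le_of_le' tendsto_const_nhds h1 ?_ ?_
  · filter_upwards [eventually_ge_atTop 1] with n hn
    exact permProb_nonneg (hpos n hn) _
  · filter_upwards [eventually_ge_atTop 1, h2] with n hn hd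
    apply permProb_mono (hpos n hn)
    intro σ hb
    unfold bad at hb
    have hn0 : (0 : ℝ) < n := by exact_mod_cast hn
    have hf : (n.factorial : ℝ) ≠ 0 := by exact_mod_cast Nat.factorial_ne_zero n
    rw [← mu_Ioi hn u, mul_div_cancel_left₀ _ hf]
    rw [Real.dist_eq] at hd
    have h3 : (G n (idx u n) (shape σ) : ℝ) - n * (mu n).real (Set.Ioi u) = n * ((G n (idx u n) (shape σ) : ℝ) / n - (mu n).real (Set.Ioi u)) := by
      field_simp
    rw [h3, abs_mul, abs_of_pos hn0, mul_comm]
    apply mul_le_mul_of_nonneg_left _ hn0.le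
    have := abs_sub_le ((G n (idx u n) (shape σ) : ℝ) / n) ((mu n).real (Set.Ioi u)) (Ga u)
    linarith

lemma hh_bdd : ∃ B : ℝ, 0 < B ∧ ∀ u, hh u ≤ B := by
  obtain ⟨B, hB⟩ : ∃ B, ∀ x, ‖hh x‖ ≤ B := by
    apply hh_cont.bounded_above_of_compact_support
    apply HasCompactSupport.of_support_subset_isCompact (isCompact_Icc (a := (-2 : ℝ)) (b := 2))
    intro x hx
    by_contra h
    apply hx
    apply hh_zero
    rw [← not_lt]
    intro h2
    exact h (Set.mem_Icc.2 ⟨(abs_lt.1 h2).1.le, (abs_lt.1 h2).2.le⟩)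
  refine ⟨B + 1, by linarith [norm_nonneg (hh 0), hB 0], fun u => ?_⟩
  linarith [le_abs_self (hh u), hB u, Real.norm_eq_abs (hh u)]

lemma idx_mono {n : ℕ} {u v : ℝ} (h : u ≤ v) : idx u n ≤ idx v n := by
  unfold idx
  gcongr

/-- uniform closeness from grid closeness -/
lemma unif_close {n : ℕ} (hn : 1 ≤ n) (σ : Equiv.Perm (Fin n)) {τ δ : ℝ} (hτ : 0 < τ) (K : ℕ) (hK : 2 ≤ K * τ)
    (hG : ∀ u, Ga u - Ga (u + τ) ≤ δ)
    (hb : ∀ l ∈ Finset.Icc (-(K : ℤ)) K, ¬ bad n (l * τ) δ σ) (i : ℤ) :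
    |(G n i (shape σ) : ℝ) / n - Ga (i / √n)| ≤ 2 * δ := by
  have hn0 : (0 : ℝ) < n := by exact_mod_cast hn
  have hs : (0 : ℝ) < √n := sqrt_pos.2 hn0
  have hA : ∀ a b : ℤ, a ≤ b → (G n b (shape σ) : ℝ) / n ≤ (G n a (shape σ) : ℝ) / n := by
    intro a b hab
    have : (G n b (shape σ) : ℝ) ≤ G n a (shape σ) := by exact_mod_cast G_anti n (shape σ) hab
    gcongr
  have h0 : ∀ a : ℤ, 0 ≤ (G n a (shape σ) : ℝ) / n := by
    intro a
    have : (0 : ℝ) ≤ G n a (shape σ) := by exact_mod_cast G_nonneg n a (shape σ)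
    positivity
  have h1 : ∀ a : ℤ, (G n a (shape σ) : ℝ) / n ≤ 1 := by
    intro a
    rw [div_le_one hn0]
    exact_mod_cast G_le (shape_isP σ le_rfl) a
  have hall : ∀ l : ℤ, |(G n (idx (l * τ) n) (shape σ) : ℝ) / n - Ga (l * τ)| < δ := by
    intro l
    by_cases hl : l ∈ Finset.Icc (-(K : ℤ)) K
    · exact not_le.1 (hb l hl)
    · rw [Finset.mem_Icc, not_and_or, not_le, not_le] at hl
      rcases hl with hl | hl
      · have hl' : (l : ℝ) ≤ -K := by exact_mod_cast hl.le
        have h2 := not_le.1 (hb (-K) (by simp))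
        have h3 : (l : ℝ) * τ ≤ ((-K : ℤ) : ℝ) * τ := by push_cast; gcongr
        have h4 : ((-K : ℤ) : ℝ) * τ ≤ -2 := by push_cast; linarith
        rw [Ga_left h4] at h2
        rw [Ga_left (h3.trans h4)]
        have h5 := hA _ _ (idx_mono (n := n) h3)
        have h6 := h1 (idx (l * τ) n)
        rw [abs_lt] at h2 ⊢
        constructor <;> linarith
      · have hl' : (K : ℝ) ≤ l := by exact_mod_cast hl.le
        have h2 := not_le.1 (hb K (by simp))
        have h3 : ((K : ℤ) : ℝ) * τ ≤ (l : ℝ) * τ := by push_cast; gcongr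
        have h4 : 2 ≤ ((K : ℤ) : ℝ) * τ := by push_cast; linarith
        rw [Ga_right h4] at h2
        rw [Ga_right (h4.trans h3)]
        have h5 := hA _ _ (idx_mono (n := n) h3)
        have h6 := h0 (idx (l * τ) n)
        rw [abs_lt] at h2 ⊢
        constructor <;> linarith
  set v : ℝ := i / √n with hv
  have hvi : v * √n = i := by rw [hv]; field_simp
  set l : ℤ := ⌊v / τ⌋ with hl
  have e1 : (l : ℝ) * τ ≤ v := by rw [← le_div_iff₀ hτ]; exact Int.floor_le _
  have e2 : v ≤ ((l + 1 : ℤ) : ℝ) * τ := by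
    rw [← div_le_iff₀ hτ]; push_cast; exact (Int.lt_floor_add_one _).le
  have ei : idx v n = i := by unfold idx; rw [hvi, Int.floor_intCast]
  have g1 := hA _ _ (idx_mono (n := n) e1)
  have g2 := hA _ _ (idx_mono (n := n) e2)
  rw [ei] at g1 g2
  have a1 := hall l
  have a2 := hall (l + 1)
  have b1 := Ga_anti e1
  have b2 := Ga_anti e2
  have b3 := hG (l * τ)
  rw [show (l : ℝ) * τ + τ = ((l + 1 : ℤ) : ℝ) * τ by push_cast; ring] at b3
  rw [abs_lt] at a1 a2
  rw [abs_le]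
  constructor <;> linarith

lemma window {n : ℕ} (hn : 1 ≤ n) (σ : Equiv.Perm (Fin n)) {δ η ε ω : ℝ} (hη : 0 < η) (hηω : 2 * η ≤ ω) (hηn : 1 ≤ η * √n)
    (hω : ∀ x y : ℝ, |x - y| ≤ ω → |hh x - hh y| ≤ ε)
    (hc : ∀ i : ℤ, |(G n i (shape σ) : ℝ) / n - Ga (i / √n)| ≤ 2 * δ) (i : ℤ) :
    |(bx n (shape σ) i : ℝ) / √n - hh (i / √n)| ≤ 2 * η + 4 * δ / η + ε := by
  have hn0 : (0 : ℝ) < n := by exact_mod_cast hn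
  have hs : (0 : ℝ) < √n := sqrt_pos.2 hn0
  have hss : √n * √n = n := mul_self_sqrt hn0.le
  have hδ : 0 ≤ δ := by have := (abs_nonneg _).trans (hc 0); linarith
  set m : ℕ := ⌈η * √n⌉₊ with hm
  set w : ℝ := m / √n with hw
  have hmw : (m : ℝ) = w * √n := by rw [hw]; field_simp
  have w1 : η ≤ w := by rw [hw, le_div_iff₀ hs]; exact Nat.le_ceil _
  have w2 : w ≤ 2 * η := by
    rw [hw, div_le_iff₀ hs]
    have := (Nat.ceil_lt_add_one (show 0 ≤ η * √n by positivity)).le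
    rw [← hm] at this
    linarith
  have hw0 : 0 < w := hη.trans_le w1
  have hW : |(m : ℝ) * bx n (shape σ) i - (G n i (shape σ) - G n (i + m) (shape σ))| ≤ m * m := by
    have := bx_window (N := n) (shape_anti σ) (fun r hr => (shape_isP σ le_rfl).zero r hr) i m
    exact_mod_cast this
  set v : ℝ := i / √n with hv
  have hv2 : ((i + m : ℤ) : ℝ) / √n = v + w := by rw [hv, hw]; push_cast; rw [add_div]
  have c1 := hc i
  have c2 := hc (i + m)
  rw [hv2] at c2
  have c3 : |Ga v - Ga (v + w) - w * hh v| ≤ w * ε := by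
    rw [Ga_sub (by linarith)]
    have : w * hh v = ∫ x in v..(v + w), hh v := by simp
    rw [this, ← intervalIntegral.integral_sub (hh_cont.intervalIntegrable _ _) (by simp)]
    have := intervalIntegral.norm_integral_le_of_norm_le_const (a := v) (b := v + w) (f := fun x => hh x - hh v) (C := ε) (by
      intro x hx
      rw [Set.uIoc_of_le (by linarith)] at hx
      apply hω
      rw [abs_le]
      constructor <;> linarith [hx.1, hx.2])
    rw [Real.norm_eq_abs] at this
    rw [add_sub_cancel_left, abs_of_pos hw0, mul_comm] at this
    exact this
  set b : ℝ := (bx n (shape σ) i : ℝ)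
  set g1 : ℝ := (G n i (shape σ) : ℝ)
  set g2 : ℝ := (G n (i + m) (shape σ) : ℝ)
  have hW2 : |w * (b / √n) - (g1 / n - g2 / n)| ≤ w * w := by
    have e : (m : ℝ) * b - (g1 - g2) = n * (w * (b / √n) - (g1 / n - g2 / n)) := by
      have hs0 : √(n : ℝ) ≠ 0 := (Real.sqrt_pos.2 hn0).ne'
      have e1 : (n : ℝ) * (w * (b / √n)) = w * √n * b := by
        rw [mul_div_assoc', mul_div_assoc', div_eq_iff hs0]
        linear_combination (-(w * b)) * hss
      have e2 : (n : ℝ) * (g1 / n - g2 / n) = g1 - g2 := by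
        have := hn0.ne'
        field_simp
      rw [hmw, mul_sub, e1, e2]
    rw [e, abs_mul, abs_of_pos hn0, hmw, show w * √n * (w * √n) = n * (w * w) by linear_combination (w * w) * hss] at hW
    exact le_of_mul_le_mul_left hW hn0
  have key : |w * (b / √n - hh v)| ≤ w * w + 4 * δ + w * ε := by
    rw [abs_le] at *
    constructor <;> linarith [hW2.1, hW2.2, c1.1, c1.2, c2.1, c2.2, c3.1, c3.2]
  rw [abs_mul, abs_of_pos hw0] at key
  have : w * |b / √n - hh v| ≤ w * (w + 4 * δ / w + ε) := by
    rw [show w * (w + 4 * δ / w + ε) = w * w + 4 * δ + w * ε by field_simp]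
    exact key
  have k2 := le_of_mul_le_mul_left this hw0
  have k3 : 4 * δ / w ≤ 4 * δ / η := by gcongr
  linarith

lemma final_eq {n : ℕ} (σ : Equiv.Perm (Fin n)) (i : ℤ) :
    (profile (shape σ) i : ℝ) / (2 * √n) - Omega ((i : ℝ) / (2 * √n)) = (bx n (shape σ) i : ℝ) / √n - hh (i / √n) := by
  rw [profile_eq (N := n) (fun r hr => (shape_isP σ le_rfl).zero r hr)]
  unfold hh
  rw [div_div, mul_comm (√n) 2, abs_div, abs_of_nonneg (sqrt_nonneg _)]
  push_cast
  ring

end RS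

open RS Filter Topology in
lemma RS.final (p : (n : ℕ) → Equiv.Perm (Fin n) → ℝ)
    (hpos : ∀ n, 1 ≤ n → ∀ σ, 0 ≤ p n σ)
    (hsum : ∀ n, 1 ≤ n → ∑ σ, p n σ = 1)
    (hinv : ∀ n, 1 ≤ n → ∀ σ ρ : Equiv.Perm (Fin n), p n (ρ⁻¹ * σ * ρ) = p n σ)
    (hcyc : ∀ ε : ℝ, 0 < ε →
      Filter.Tendsto (fun n => permProb (p n) fun σ => ε < (numCycles σ : ℝ) / n)
        Filter.atTop (nhds 0)) :
    ∀ ε : ℝ, 0 < ε →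
      Filter.Tendsto (fun n => permProb (p n) fun σ =>
          (⨆ i : ℤ, |(profile (shape σ) i : ℝ) / (2 * Real.sqrt n)
            - Omega ((i : ℝ) / (2 * Real.sqrt n))|) < ε)
        Filter.atTop (nhds 1) := by
  intro ε hε
  obtain ⟨ω, hω0, hω⟩ := Metric.uniformContinuous_iff.1 hh_unif (ε / 8) (by positivity)
  obtain ⟨B, hB0, hB⟩ := hh_bdd
  obtain ⟨η, hη, hη1, hη2⟩ : ∃ η : ℝ, 0 < η ∧ 2 * η ≤ ω / 2 ∧ 2 * η ≤ ε / 8 :=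
    ⟨min (ω / 4) (ε / 16), by positivity, by linarith [min_le_left (ω / 4) (ε / 16)], by linarith [min_le_right (ω / 4) (ε / 16)]⟩
  set δ : ℝ := ε * η / 32 with hδd
  have hδ : 0 < δ := by positivity
  set τ : ℝ := δ / B with hτd
  have hτ : 0 < τ := by positivity
  obtain ⟨K, hK⟩ := exists_nat_ge (2 / τ)
  rw [div_le_iff₀ hτ] at hK
  have hG : ∀ u, Ga u - Ga (u + τ) ≤ δ := by
    intro u
    rw [Ga_sub (by linarith)]
    calc ∫ x in u..(u + τ), hh x ≤ ∫ x in u..(u + τ), B :=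
          intervalIntegral.integral_mono_on (by linarith) (hh_cont.intervalIntegrable _ _) (by simp) (fun x _ => hB x)
      _ = δ := by simp [hτd]; field_simp
  have h1 : Tendsto (fun n => ∑ l ∈ Finset.Icc (-(K : ℤ)) K, permProb (p n) (bad n (l * τ) δ)) atTop (𝓝 0) := by
    have := tendsto_finsetSum (Finset.Icc (-(K : ℤ)) K) (fun l _ => bad_prob p hpos hsum hinv hcyc (l * τ) δ hδ)
    simpa using this
  have h2 : Tendsto (fun n => 1 - ∑ l ∈ Finset.Icc (-(K : ℤ)) K, permProb (p n) (bad n (l * τ) δ)) atTop (𝓝 1) := by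
    simpa using h1.const_sub 1
  have hlarge : ∀ᶠ n : ℕ in atTop, 1 ≤ η * √n := by
    have : Tendsto (fun n : ℕ => η * √(n : ℝ)) atTop atTop :=
      (Real.tendsto_sqrt_atTop.comp tendsto_natCast_atTop_atTop).const_mul_atTop hη
    exact this.eventually_ge_atTop 1
  refine tendsto_of_tendsto_of_tendsto_of_le_of_le' h2 tendsto_const_nhds ?_ ?_
  · filter_upwards [eventually_ge_atTop 1, hlarge] with n hn hηn
    rw [permProb_compl (p n) (hsum n hn)]
    apply sub_le_sub_left
    refine (permProb_mono (hpos n hn) ?_).trans (permProb_union (hpos n hn) _ _)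
    intro σ hσ
    by_contra hcon
    push Not at hcon
    apply hσ
    have hc := unif_close hn σ hτ K hK hG hcon
    have hw := window hn σ hη hη1 hηn (fun x y hxy => by
      have := hω (a := x) (b := y) (by rw [Real.dist_eq]; linarith)
      rw [Real.dist_eq] at this
      exact this.le) hc
    have hd : 4 * δ / η = ε / 8 := by rw [hδd]; field_simp; norm_num
    refine lt_of_le_of_lt (ciSup_le (c := ε / 2) ?_) (by linarith)
    intro i
    rw [final_eq]
    linarith [hw i]
  · filter_upwards [eventually_ge_atTop 1] with n hn
    rw [permProb_compl (p n) (hsum n hn)]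
    linarith [permProb_nonneg (hpos n hn) (fun σ => ¬ (⨆ i : ℤ, |(profile (shape σ) i : ℝ) / (2 * Real.sqrt n)
            - Omega ((i : ℝ) / (2 * Real.sqrt n))|) < ε)]

end

theorem stmt_8 (p : (n : ℕ) → Equiv.Perm (Fin n) → ℝ)
    (hpos : ∀ n, 1 ≤ n → ∀ σ, 0 ≤ p n σ)
    (hsum : ∀ n, 1 ≤ n → ∑ σ, p n σ = 1)
    (hinv : ∀ n, 1 ≤ n → ∀ σ ρ : Equiv.Perm (Fin n), p n (ρ⁻¹ * σ * ρ) = p n σ)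
    (hcyc : ∀ ε : ℝ, 0 < ε →
      Filter.Tendsto (fun n => permProb (p n) fun σ => ε < (numCycles σ : ℝ) / n)
        Filter.atTop (nhds 0)) :
    ∀ ε : ℝ, 0 < ε →
      Filter.Tendsto (fun n => permProb (p n) fun σ =>
          (⨆ i : ℤ, |(profile (shape σ) i : ℝ) / (2 * Real.sqrt n)
            - Omega ((i : ℝ) / (2 * Real.sqrt n))|) < ε)
        Filter.atTop (nhds 1) := by
  exact RS.final p hpos hsum hinv hcyc
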